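/- Let α,β>−1 and let M,N≥0 be integers with M+N>0. Then there exists a constant C such that for all θ,φ∈(0,π) with θ≠φ: (∫₀^∞ |∂_t^M δ_N^odd H̃_t^{α,β}(θ,φ)|² t^{2M+2N−1} dt)^{1/2} ≤ C/μ⁺_{α,β}(B(θ,|θ−φ|)), and moreover (∫₀^∞ |∂_θ ∂_t^M δ_N^odd H̃_t^{α,β}(θ,φ)|² t^{2M+2N−1} dt)^{1/2} + (∫₀^∞ |∂_φ ∂_t^M δ_N^odd H̃_t^{α,β}(θ,φ)|² t^{2M+2N−1} dt)^{1/2} ≤ C/(|θ−φ|·μ⁺_{α,β}(B(θ,|θ−φ|))), where δ_N^odd acts in the variable θ. -/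

import Mathlib

open MeasureTheory Real Set
open scoped ENNReal

noncomputable section

/-- The classical Jacobi polynomial `P_n^{α,β}`. -/
def jacobiP (α β : ℝ) (n : ℕ) (x : ℝ) : ℝ :=
  ∑ m ∈ Finset.range (n + 1),
    (Real.Gamma (α + n + 1) * Real.Gamma (α + β + n + m + 1)) /
      ((m.factorial : ℝ) * ((n - m).factorial : ℝ) * Real.Gamma (α + β + n + 1) *
        Real.Gamma (α + m + 1)) * ((x - 1) / 2) ^ m

/-- `Ψ^{α,β}(θ) = |sin(θ/2)|^{α+1/2} (cos(θ/2))^{β+1/2}`. -/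
def jPsi (α β θ : ℝ) : ℝ := |Real.sin (θ / 2)| ^ (α + 1 / 2) * Real.cos (θ / 2) ^ (β + 1 / 2)

/-- The measure `μ_{α,β}` on `(−π, π)`, with density `(Ψ^{α,β})²` w.r.t. Lebesgue measure. -/
def jacobiMeasure (α β : ℝ) : Measure ℝ :=
  (volume.restrict (Ioo (-π) π)).withDensity fun θ => ENNReal.ofReal (jPsi α β θ ^ 2)

/-- The restriction `μ⁺_{α,β}` of `μ_{α,β}` to `(0, π)`. -/
def jacobiMeasurePlus (α β : ℝ) : Measure ℝ := (jacobiMeasure α β).restrict (Ioo 0 π)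

/-- The normalizing constant `c_n^{α,β}` making `𝒫_n^{α,β}` have unit `L²(μ⁺)` norm. -/
def cJ (α β : ℝ) (n : ℕ) : ℝ :=
  (∫ θ, jacobiP α β n (Real.cos θ) ^ 2 ∂(jacobiMeasurePlus α β)) ^ (-(1 / 2) : ℝ)

/-- The normalized trigonometric Jacobi polynomial `𝒫_n^{α,β}(θ)`. -/
def trigP (α β : ℝ) (n : ℕ) (θ : ℝ) : ℝ := cJ α β n * jacobiP α β n (Real.cos θ)

/-- The eigenvalue `λ_n^{α,β} = (n + (α+β+1)/2)²`. -/
def jLam (α β : ℝ) (n : ℕ) : ℝ := ((n : ℝ) + (α + β + 1) / 2) ^ 2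

/-- The symmetrized system `Φ_n^{α,β}`. -/
def symPhi (α β : ℝ) (n : ℕ) (θ : ℝ) : ℝ :=
  if Even n then (Real.sqrt 2)⁻¹ * trigP α β (n / 2) θ
  else (Real.sqrt 2)⁻¹ * (Real.sin θ / 2) * trigP (α + 1) (β + 1) ((n - 1) / 2) θ

/-- The Jacobi functions `φ_n^{α,β} = Ψ^{α,β} 𝒫_n^{α,β}`. -/
def phiFun (α β : ℝ) (n : ℕ) (θ : ℝ) : ℝ := jPsi α β θ * trigP α β n θ

/-- The symmetrized Jacobi function system `Θ_n^{α,β}`. -/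
def jTheta (α β : ℝ) (n : ℕ) (θ : ℝ) : ℝ :=
  if Even n then (Real.sqrt 2)⁻¹ * phiFun α β (n / 2) θ
  else (Real.sqrt 2)⁻¹ * Real.sign θ * phiFun (α + 1) (β + 1) ((n - 1) / 2) θ

/-- The symmetrized Jacobi–Poisson semigroup `ℍ_t^{α,β}f(θ)` (polynomial setting). -/
def symH (α β : ℝ) (f : ℝ → ℝ) (t θ : ℝ) : ℝ :=
  ∑' n : ℕ, Real.exp (-t * Real.sqrt (jLam α β ((n + 1) / 2))) *
    (∫ φ, f φ * symPhi α β n φ ∂(jacobiMeasure α β)) * symPhi α β n θ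

/-- The symmetrized Jacobi–Poisson semigroup `H̄_t^{α,β}f(θ)` (function setting). -/
def symHbar (α β : ℝ) (f : ℝ → ℝ) (t θ : ℝ) : ℝ :=
  ∑' n : ℕ, Real.exp (-t * Real.sqrt (jLam α β ((n + 1) / 2))) *
    (∫ φ in Ioo (-π) π, f φ * jTheta α β n φ) * jTheta α β n θ

/-- The non-symmetrized Jacobi–Poisson semigroup `ℋ_t^{α,β}f(θ)` (polynomial setting). -/
def jacH (α β : ℝ) (f : ℝ → ℝ) (t θ : ℝ) : ℝ :=
  ∑' n : ℕ, Real.exp (-t * Real.sqrt (jLam α β n)) *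
    (∫ φ, f φ * trigP α β n φ ∂(jacobiMeasurePlus α β)) * trigP α β n θ

/-- The non-symmetrized Jacobi–Poisson semigroup `𝓗̄_t^{α,β}f(θ)` (function setting). -/
def jacHbar (α β : ℝ) (f : ℝ → ℝ) (t θ : ℝ) : ℝ :=
  ∑' n : ℕ, Real.exp (-t * Real.sqrt (jLam α β n)) *
    (∫ φ in Ioo 0 π, f φ * phiFun α β n φ) * phiFun α β n θ

/-- The symmetrized derivative `𝔻_{α,β}`. -/
def symD (α β : ℝ) (f : ℝ → ℝ) : ℝ → ℝ := fun θ =>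
  deriv f θ + (α - β + (α + β + 1) * Real.cos θ) / Real.sin θ * ((f θ - f (-θ)) / 2)

/-- The symmetrized derivative `D̄_{α,β}` (function setting). -/
def symDbar (α β : ℝ) (f : ℝ → ℝ) : ℝ → ℝ := fun θ =>
  deriv f θ -
    ((2 * α + 1) / 4 * (Real.cos (θ / 2) / Real.sin (θ / 2)) -
      (2 * β + 1) / 4 * Real.tan (θ / 2)) * f (-θ)

/-- The derivative `D_{α,β}` (non-symmetrized function setting). -/
def jacD (α β : ℝ) (f : ℝ → ℝ) : ℝ → ℝ := fun θ =>
  deriv f θ - (2 * α + 1) / 4 * (Real.cos (θ / 2) / Real.sin (θ / 2)) * f θ +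
    (2 * β + 1) / 4 * Real.tan (θ / 2) * f θ

/-- `δ*_{α,β} = −d/dθ − (α+1/2)cot(θ/2) + (β+1/2)tan(θ/2)`. -/
def delStar (α β : ℝ) (f : ℝ → ℝ) : ℝ → ℝ := fun θ =>
  -deriv f θ - (α + 1 / 2) * (Real.cos (θ / 2) / Real.sin (θ / 2)) * f θ +
    (β + 1 / 2) * Real.tan (θ / 2) * f θ

/-- `δ_N^even`: `N` alternating factors, rightmost (first applied) one being `δ = d/dθ`. -/
def deltaEven (α β : ℝ) : ℕ → (ℝ → ℝ) → ℝ → ℝ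
  | 0 => fun f => f
  | N + 1 => fun f => (if N % 2 = 0 then deriv else delStar α β) (deltaEven α β N f)

/-- `δ_N^odd`: `N` alternating factors, rightmost (first applied) one being `δ*_{α,β}`. -/
def deltaOdd (α β : ℝ) : ℕ → (ℝ → ℝ) → ℝ → ℝ
  | 0 => fun f => f
  | N + 1 => fun f => (if N % 2 = 0 then delStar α β else deriv) (deltaOdd α β N f)

/-- The Jacobi–Poisson kernel `H_t^{α,β}(θ,φ)` (even part of the symmetrized kernel). -/
def jHker (α β t θ φ : ℝ) : ℝ :=
  (1 / 2) * ∑' n : ℕ, Real.exp (-t * Real.sqrt (jLam α β n)) * trigP α β n θ * trigP α β n φ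

/-- The kernel `H̃_t^{α,β}(θ,φ)` (odd part of the symmetrized kernel). -/
def jHtil (α β t θ φ : ℝ) : ℝ :=
  (1 / 8) * Real.sin θ * Real.sin φ *
    ∑' n : ℕ, Real.exp (-t * Real.sqrt (jLam α β (n + 1))) *
      trigP (α + 1) (β + 1) n θ * trigP (α + 1) (β + 1) n φ

/-- `μ⁺_{α,β}(B(θ,r))` where `B(θ,r) = (θ−r, θ+r) ∩ (0,π)`. -/
def ballMeasure (α β θ r : ℝ) : ℝ≥0∞ := jacobiMeasurePlus α β (Ioo (θ - r) (θ + r))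

/-- The Muckenhoupt class `A_p^{α,β}` (`1 < p < ∞`) on `(−π,π)` w.r.t. `μ_{α,β}`. -/
def IsApWeight (α β p : ℝ) (w : ℝ → ℝ) : Prop :=
  (∀ θ, 0 ≤ w θ) ∧
    ∃ C : ℝ, ∀ a b : ℝ, -π ≤ a → a ≤ b → b ≤ π →
      (∫⁻ θ in Ioo a b, ENNReal.ofReal (w θ) ∂(jacobiMeasure α β)) *
          (∫⁻ θ in Ioo a b, ENNReal.ofReal (w θ ^ (-1 / (p - 1))) ∂(jacobiMeasure α β)) ^
            (p - 1) ≤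
        ENNReal.ofReal C * jacobiMeasure α β (Ioo a b) ^ p

/-- The Muckenhoupt class `A_1^{α,β}` on `(−π,π)` w.r.t. `μ_{α,β}`. -/
def IsA1Weight (α β : ℝ) (w : ℝ → ℝ) : Prop :=
  (∀ θ, 0 ≤ w θ) ∧
    ∃ C : ℝ, ∀ a b : ℝ, -π ≤ a → a ≤ b → b ≤ π →
      ∫⁻ θ in Ioo a b, ENNReal.ofReal (w θ) ∂(jacobiMeasure α β) ≤
        ENNReal.ofReal C *
          essInf (fun θ => ENNReal.ofReal (w θ)) ((jacobiMeasure α β).restrict (Ioo a b)) *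
          jacobiMeasure α β (Ioo a b)

/-- The Muckenhoupt class `(A_p^{α,β})⁺` (`1 < p < ∞`) on `(0,π)` w.r.t. `μ⁺_{α,β}`. -/
def IsApWeightPlus (α β p : ℝ) (w : ℝ → ℝ) : Prop :=
  (∀ θ, 0 ≤ w θ) ∧
    ∃ C : ℝ, ∀ a b : ℝ, 0 ≤ a → a ≤ b → b ≤ π →
      (∫⁻ θ in Ioo a b, ENNReal.ofReal (w θ) ∂(jacobiMeasurePlus α β)) *
          (∫⁻ θ in Ioo a b, ENNReal.ofReal (w θ ^ (-1 / (p - 1))) ∂(jacobiMeasurePlus α β)) ^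
            (p - 1) ≤
        ENNReal.ofReal C * jacobiMeasurePlus α β (Ioo a b) ^ p

/-- The Muckenhoupt class `(A_1^{α,β})⁺` on `(0,π)` w.r.t. `μ⁺_{α,β}`. -/
def IsA1WeightPlus (α β : ℝ) (w : ℝ → ℝ) : Prop :=
  (∀ θ, 0 ≤ w θ) ∧
    ∃ C : ℝ, ∀ a b : ℝ, 0 ≤ a → a ≤ b → b ≤ π →
      ∫⁻ θ in Ioo a b, ENNReal.ofReal (w θ) ∂(jacobiMeasurePlus α β) ≤
        ENNReal.ofReal C *
          essInf (fun θ => ENNReal.ofReal (w θ)) ((jacobiMeasurePlus α β).restrict (Ioo a b)) *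
          jacobiMeasurePlus α β (Ioo a b)

/-- The double power weight `w_{r,s}(θ) = |sin(θ/2)|^r (cos(θ/2))^s`. -/
def wrs (r s θ : ℝ) : ℝ := |Real.sin (θ / 2)| ^ r * Real.cos (θ / 2) ^ s


section

/-- rising factorial -/
def rf (x : ℝ) (n : ℕ) : ℝ := ∏ i ∈ Finset.range n, (x + i)

lemma rf_zero (x : ℝ) : rf x 0 = 1 := by simp [rf]

lemma rf_succ (x : ℝ) (n : ℕ) : rf x (n + 1) = rf x n * (x + n) := by
  simp [rf, Finset.prod_range_succ]

lemma rf_succ' (x : ℝ) (n : ℕ) : rf x (n + 1) = x * rf (x + 1) n := by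
  rw [rf, rf, Finset.prod_range_succ']
  simp only [Nat.cast_zero, add_zero, mul_comm]
  congr 1
  apply Finset.prod_congr rfl
  intro i _
  push_cast; ring

lemma rf_add (x : ℝ) (m n : ℕ) : rf x (m + n) = rf x m * rf (x + m) n := by
  induction n with
  | zero => simp [rf_zero]
  | succ n ih => rw [← add_assoc, rf_succ, ih, rf_succ]; push_cast; ring

lemma rf_pos {x : ℝ} (hx : 0 < x) (n : ℕ) : 0 < rf x n := by
  unfold rf
  apply Finset.prod_pos
  intro i _
  positivity

lemma Gamma_rf {x : ℝ} (hx : 0 < x) (n : ℕ) : Real.Gamma (x + n) = rf x n * Real.Gamma x := by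
  induction n with
  | zero => simp [rf_zero]
  | succ n ih =>
    push_cast
    rw [← add_assoc, Real.Gamma_add_one (by positivity), ih, rf_succ]; ring

open Polynomial in
/-- Jacobi operator in the variable `p = (1-x)/2` -/
def LL (a b : ℝ) (f : ℝ[X]) : ℝ[X] :=
  X * (1 - X) * derivative (derivative f) + (C (a + 1) * (1 - X) - C (b + 1) * X) * derivative f

open Polynomial in
lemma LL_add (a b : ℝ) (f g : ℝ[X]) : LL a b (f + g) = LL a b f + LL a b g := by
  simp only [LL, derivative_add]; ring

open Polynomial in
lemma LL_sub (a b : ℝ) (f g : ℝ[X]) : LL a b (f - g) = LL a b f - LL a b g := by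
  simp only [LL, derivative_sub]; ring

open Polynomial in
lemma LL_C_mul (a b c : ℝ) (f : ℝ[X]) : LL a b (C c * f) = C c * LL a b f := by
  simp only [LL, derivative_C_mul]; ring

open Polynomial in
lemma LL_sum {ι : Type*} (a b : ℝ) (s : Finset ι) (f : ι → ℝ[X]) :
    LL a b (∑ i ∈ s, f i) = ∑ i ∈ s, LL a b (f i) := by
  classical
  induction s using Finset.induction_on with
  | empty => simp [LL]
  | insert i s hi ih => rw [Finset.sum_insert hi, Finset.sum_insert hi, LL_add, ih]

open Polynomial in
lemma deriv_pow_aux (i : ℕ) : ((X : ℝ[X]) * derivative (X ^ i)) = C (i : ℝ) * X ^ i := by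
  cases i with
  | zero => simp
  | succ i => rw [derivative_X_pow]; simp; ring

open Polynomial in
lemma LL_mono (a b : ℝ) (i j : ℕ) :
    LL a b (X ^ i * (1 - X) ^ j) =
      C ((i : ℝ) * (i + a)) * (X ^ (i - 1) * (1 - X) ^ j) +
      C ((j : ℝ) * (j + b)) * (X ^ i * (1 - X) ^ (j - 1))
      - C (((i + j : ℕ) : ℝ) * ((i + j : ℕ) + a + b + 1)) * (X ^ i * (1 - X) ^ j) := by
  have hX : ∀ i : ℕ, derivative ((X : ℝ[X]) ^ i) = C (i : ℝ) * X ^ (i - 1) := by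
    intro i; rw [derivative_X_pow]
  have hY : ∀ i : ℕ, derivative ((1 - X : ℝ[X]) ^ i) = - (C (i : ℝ) * (1 - X) ^ (i - 1)) := by
    intro i; rw [derivative_pow]; simp
  unfold LL
  rcases i with _ | _ | i <;> rcases j with _ | _ | j <;>
  · simp only [derivative_mul, hX, hY, derivative_C, derivative_add, derivative_neg, Nat.add_sub_cancel]
    simp
    try simp only [show (C (2 : ℝ) : ℝ[X]) = 2 from map_ofNat C 2]
    try ring

open Polynomial in
lemma LL_coeff (a b : ℝ) (f : ℝ[X]) (j : ℕ) :
    (LL a b f).coeff j = (j + 1 : ℝ) * (j + 1 + a) * f.coeff (j + 1)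
      - (j : ℝ) * (j + a + b + 1) * f.coeff j := by
  induction f using Polynomial.induction_on' with
  | add p q hp hq => rw [LL_add, coeff_add, hp, hq, coeff_add, coeff_add]; ring
  | monomial n c =>
    rw [← C_mul_X_pow_eq_monomial, LL_C_mul]
    have := LL_mono a b n 0
    simp only [pow_zero, mul_one] at this
    rw [this]
    simp only [coeff_C_mul, coeff_X_pow, coeff_sub, coeff_add]
    rcases n with _ | n
    · by_cases h : j = 0 <;> simp [h]
    · by_cases h1 : j = n
      · subst h1; simp; ring
      · by_cases h2 : j = n + 1
        · subst h2; simp; ring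
        · have : ¬ (j + 1 = n + 1) := by omega
          simp [h1, h2]

open Polynomial in
lemma LL_uniq {a b : ℝ} (ha : 0 < a) (hb : 0 < b) (k : ℕ) (f : ℝ[X])
    (hf : LL a b f = - (C ((k : ℝ) * (k + a + b + 1)) * f)) (hd : ∀ j, k ≤ j → f.coeff j = 0) :
    f = 0 := by
  have key : ∀ m, ∀ j, k - m ≤ j → f.coeff j = 0 := by
    intro m
    induction m with
    | zero => intro j hj; exact hd j (by simpa using hj)
    | succ m ih =>
      intro j hj
      by_cases hj2 : k - m ≤ j
      · exact ih j hj2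
      · have hjk : j < k := by omega
        have h1 := LL_coeff a b f j
        rw [hf, ih (j + 1) (by omega)] at h1
        simp only [coeff_neg, coeff_C_mul] at h1
        have hjk' : (j : ℝ) + 1 ≤ k := by exact_mod_cast hjk
        have hj0 : (0 : ℝ) ≤ j := Nat.cast_nonneg j
        have : ((k : ℝ) - j) * (k + j + a + b + 1) * f.coeff j = 0 := by nlinarith
        rcases mul_eq_zero.mp this with h | h
        · rcases mul_eq_zero.mp h with h | h <;> nlinarith
        · exact h
  ext j
  simpa using key k j (by omega)

/-- coefficients `b_{ij}` -/
def bco (a b : ℝ) (i j : ℕ) : ℝ :=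
  1 / ((i.factorial : ℝ) * (j.factorial : ℝ) * rf (a + 1) i * rf (b + 1) j)

lemma bco_succ_left {a : ℝ} (ha : 0 < a) (b : ℝ) (i j : ℕ) :
    ((i + 1 : ℕ) : ℝ) * ((i + 1 : ℕ) + a) * bco a b (i + 1) j = bco a b i j := by
  unfold bco
  rw [rf_succ, Nat.factorial_succ]
  have h1 : (i.factorial : ℝ) ≠ 0 := by positivity
  have h4 : ((i : ℝ) + 1) ≠ 0 := by positivity
  have h5 : (a + 1 + i : ℝ) ≠ 0 := by positivity
  push_cast
  rw [show ((i : ℝ) + 1) * (i + 1 + a) * (1 / (((i : ℝ) + 1) * i.factorial * j.factorial * (rf (a + 1) i * (a + 1 + i)) * rf (b + 1) j)) = (((i : ℝ) + 1) / (i + 1)) * ((a + 1 + i) / (a + 1 + i)) * (1 / (i.factorial * j.factorial * rf (a + 1) i * rf (b + 1) j)) by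
    simp only [div_eq_mul_inv, mul_inv]; ring]
  rw [div_self h4, div_self h5]; ring

lemma bco_succ_right (a : ℝ) {b : ℝ} (hb : 0 < b) (i j : ℕ) :
    ((j + 1 : ℕ) : ℝ) * ((j + 1 : ℕ) + b) * bco a b i (j + 1) = bco a b i j := by
  have := bco_succ_left hb a j i
  have h2 : ∀ i j, bco b a i j = bco a b j i := by
    intro i j; unfold bco; ring
  rwa [h2, h2] at this

open Polynomial in
/-- the polynomials `B_k` -/
def Bg (a b : ℝ) (k : ℕ) (s t : ℝ) : ℝ[X] :=
  ∑ ij ∈ Finset.HasAntidiagonal.antidiagonal k, C (bco a b ij.1 ij.2 * s ^ ij.1 * t ^ ij.2) * (X ^ ij.1 * (1 - X) ^ ij.2)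

open Polynomial in
lemma LL_Bg_zero (a b s t : ℝ) : LL a b (Bg a b 0 s t) = 0 := by
  simp [Bg, LL]

open Polynomial in
lemma LL_Bg {a b : ℝ} (ha : 0 < a) (hb : 0 < b) (k : ℕ) (s t : ℝ) :
    LL a b (Bg a b (k + 1) s t) = C (s + t) * Bg a b k s t -
      C (((k + 1 : ℕ) : ℝ) * ((k + 1 : ℕ) + a + b + 1)) * Bg a b (k + 1) s t := by
  have h1 : LL a b (Bg a b (k + 1) s t) =
      (∑ ij ∈ Finset.HasAntidiagonal.antidiagonal (k + 1), C (bco a b ij.1 ij.2 * s ^ ij.1 * t ^ ij.2) *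
        (C ((ij.1 : ℝ) * (ij.1 + a)) * (X ^ (ij.1 - 1) * (1 - X) ^ ij.2))) +
      (∑ ij ∈ Finset.HasAntidiagonal.antidiagonal (k + 1), C (bco a b ij.1 ij.2 * s ^ ij.1 * t ^ ij.2) *
        (C ((ij.2 : ℝ) * (ij.2 + b)) * (X ^ ij.1 * (1 - X) ^ (ij.2 - 1)))) -
      C (((k + 1 : ℕ) : ℝ) * ((k + 1 : ℕ) + a + b + 1)) * Bg a b (k + 1) s t := by
    rw [Bg, LL_sum, Finset.mul_sum, ← Finset.sum_add_distrib, ← Finset.sum_sub_distrib]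
    apply Finset.sum_congr rfl
    intro ij hij
    rw [LL_C_mul, LL_mono, Finset.HasAntidiagonal.mem_antidiagonal.mp hij]
    ring
  rw [h1]
  congr 1
  rw [Finset.Nat.sum_antidiagonal_succ, Finset.Nat.sum_antidiagonal_succ', C_add, add_mul]
  simp only [Nat.cast_zero, zero_mul, C_0, mul_zero, zero_add, Nat.add_sub_cancel, Bg,
    Finset.mul_sum]
  congr 1
  · apply Finset.sum_congr rfl
    intro ij _
    rw [← bco_succ_left ha b ij.1 ij.2]
    simp only [C_mul, pow_succ]
    ring
  · apply Finset.sum_congr rfl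
    intro ij _
    rw [← bco_succ_right a hb ij.1 ij.2]
    simp only [C_mul, pow_succ]
    ring

open Polynomial in
/-- coefficients of Jacobi polynomials in the variable `(1-x)/2` -/
def jco (a b : ℝ) (n m : ℕ) : ℝ :=
  if m ≤ n then (-1) ^ m * ((Real.Gamma (a + n + 1) * Real.Gamma (a + b + n + m + 1)) /
      ((m.factorial : ℝ) * ((n - m).factorial : ℝ) * Real.Gamma (a + b + n + 1) *
        Real.Gamma (a + m + 1))) else 0

open Polynomial in
def Jp (a b : ℝ) (n : ℕ) : ℝ[X] := ∑ m ∈ Finset.range (n + 1), C (jco a b n m) * X ^ m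

open Polynomial in
lemma Jp_coeff (a b : ℝ) (n m : ℕ) : (Jp a b n).coeff m = jco a b n m := by
  simp only [Jp, finsetSum_coeff, coeff_C_mul, coeff_X_pow, mul_ite, mul_one, mul_zero]
  rw [Finset.sum_ite_eq]
  by_cases h : m ≤ n
  · simp [Nat.lt_succ_iff, h]
  · simp [jco, h]

open Polynomial in
lemma Jp_eval (a b : ℝ) (n : ℕ) (x : ℝ) : jacobiP a b n x = (Jp a b n).eval ((1 - x) / 2) := by
  simp only [Jp, jacobiP, eval_finsetSum, eval_mul, eval_C, eval_pow, eval_X]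
  apply Finset.sum_congr rfl
  intro m hm
  rw [Finset.mem_range, Nat.lt_succ_iff] at hm
  rw [jco, if_pos hm, show (x - 1) / 2 = (-1) * ((1 - x) / 2) by ring, mul_pow]
  ring

lemma jco_rec {a b : ℝ} (ha : 0 < a) (hb : 0 < b) (n m : ℕ) :
    (m + 1 : ℝ) * (m + 1 + a) * jco a b n (m + 1) =
      ((m : ℝ) * (m + a + b + 1) - n * (n + a + b + 1)) * jco a b n m := by
  unfold jco
  by_cases h : m + 1 ≤ n
  · obtain ⟨k, rfl⟩ := Nat.exists_eq_add_of_le h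
    rw [if_pos h, if_pos (by omega), show m + 1 + k - (m + 1) = k by omega,
      show m + 1 + k - m = k + 1 by omega, Nat.factorial_succ, Nat.factorial_succ]
    push_cast
    rw [show a + b + (m + 1 + k) + ((m : ℝ) + 1) + 1 = (a + b + (m + 1 + k) + m + 1) + 1 by ring,
      Real.Gamma_add_one (s := a + b + (m + 1 + k) + m + 1) (by positivity),
      show a + ((m : ℝ) + 1) + 1 = (a + m + 1) + 1 by ring,
      Real.Gamma_add_one (s := a + m + 1) (by positivity)]
    have h1 : Real.Gamma (a + m + 1) ≠ 0 := (Real.Gamma_pos_of_pos (by positivity)).ne'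
    have h2 : Real.Gamma (a + b + (m + 1 + k) + 1) ≠ 0 := (Real.Gamma_pos_of_pos (by positivity)).ne'
    have h3 : (m.factorial : ℝ) ≠ 0 := by positivity
    have h4 : (k.factorial : ℝ) ≠ 0 := by positivity
    have h5 : (a + m + 1) ≠ 0 := by positivity
    generalize Real.Gamma (a + b + (m + 1 + k) + m + 1) = G1 at *
    generalize Real.Gamma (a + b + (m + 1 + k) + 1) = G2 at *
    generalize Real.Gamma (a + m + 1) = G3 at *
    generalize Real.Gamma (a + (m + 1 + k) + 1) = G4 at *
    field_simp
    ring
  · rw [if_neg h]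
    by_cases h' : m ≤ n
    · have : m = n := by omega
      subst this; ring
    · rw [if_neg h']; ring

open Polynomial in
lemma Jp_eigen {a b : ℝ} (ha : 0 < a) (hb : 0 < b) (n : ℕ) :
    LL a b (Jp a b n) = - (C ((n : ℝ) * (n + a + b + 1)) * Jp a b n) := by
  ext m
  rw [LL_coeff, coeff_neg, coeff_C_mul, Jp_coeff, Jp_coeff, jco_rec ha hb]
  ring

open Polynomial in
lemma Jp_deriv {a b : ℝ} (ha : 0 < a) (hb : 0 < b) (n : ℕ) :
    derivative (Jp a b (n + 1)) = C (-((n : ℝ) + 1 + a + b + 1)) * Jp (a + 1) (b + 1) n := by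
  ext m
  rw [coeff_derivative, coeff_C_mul, Jp_coeff, Jp_coeff]
  unfold jco
  by_cases h : m ≤ n
  · rw [if_pos (by omega), if_pos h, Nat.factorial_succ, show n + 1 - (m + 1) = n - m by omega]
    push_cast
    rw [show a + b + ((n : ℝ) + 1) + (m + 1) + 1 = a + b + n + m + 1 + 1 + 1 by ring,
      show a + 1 + (b + 1) + (n : ℝ) + m + 1 = a + b + n + m + 1 + 1 + 1 by ring,
      show a + 1 + (b + 1) + (n : ℝ) + 1 = (a + b + (n + 1) + 1) + 1 by ring,
      Real.Gamma_add_one (s := a + b + (n + 1) + 1) (by positivity),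
      show a + 1 + (n : ℝ) + 1 = a + (n + 1) + 1 by ring,
      show a + 1 + (m : ℝ) + 1 = a + (m + 1) + 1 by ring]
    have h1 : Real.Gamma (a + (m + 1) + 1) ≠ 0 := (Real.Gamma_pos_of_pos (by positivity)).ne'
    have h2 : Real.Gamma (a + b + (n + 1) + 1) ≠ 0 := (Real.Gamma_pos_of_pos (by positivity)).ne'
    have h3 : (m.factorial : ℝ) ≠ 0 := by positivity
    have h4 : ((n - m).factorial : ℝ) ≠ 0 := by positivity
    have h5 : (a + b + (n + 1) + 1) ≠ 0 := by positivity
    generalize Real.Gamma (a + b + n + m + 1 + 1 + 1) = G1 at *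
    generalize Real.Gamma (a + b + (n + 1) + 1) = G2 at *
    generalize Real.Gamma (a + (m + 1) + 1) = G3 at *
    generalize Real.Gamma (a + (n + 1) + 1) = G4 at *
    field_simp
    ring
  · rw [if_neg (by omega), if_neg h]; ring

lemma jco_top {a b : ℝ} (ha : 0 < a) (hb : 0 < b) (n : ℕ) :
    jco a b n n = (-1) ^ n * rf (a + b + 1 + n) n / n.factorial := by
  unfold jco
  rw [if_pos le_rfl]
  have h2 := Gamma_rf (x := a + b + 1 + n) (by positivity) n
  rw [show a + b + (n : ℝ) + n + 1 = a + b + 1 + n + n by ring, h2,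
    show a + b + (n : ℝ) + 1 = a + b + 1 + n by ring]
  have h1 : Real.Gamma (a + b + 1 + n) ≠ 0 := (Real.Gamma_pos_of_pos (by positivity)).ne'
  have h3 : Real.Gamma (a + n + 1) ≠ 0 := (Real.Gamma_pos_of_pos (by positivity)).ne'
  simp
  field_simp

lemma jco_zero {a b : ℝ} (ha : 0 < a) (hb : 0 < b) (n : ℕ) :
    jco a b n 0 = rf (a + 1) n / n.factorial := by
  unfold jco
  rw [if_pos (Nat.zero_le n)]
  have h2 := Gamma_rf (x := a + 1) (by positivity) n
  rw [show a + (n : ℝ) + 1 = a + 1 + n by ring, h2]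
  have h1 : Real.Gamma (a + b + n + 1) ≠ 0 := (Real.Gamma_pos_of_pos (by positivity)).ne'
  have h3 : Real.Gamma (a + 1) ≠ 0 := (Real.Gamma_pos_of_pos (by positivity)).ne'
  simp
  field_simp

/-- connection coefficients -/
def dco (a b : ℝ) (k n : ℕ) : ℝ := 1 / (((k - n).factorial : ℝ) * rf (2 * n + a + b + 2) (k - n))

def cco (a b : ℝ) (n : ℕ) : ℝ :=
  n.factorial / (rf (a + b + 1 + n) n * rf (a + 1) n * rf (b + 1) n)

lemma dco_rec {a b : ℝ} (ha : 0 < a) (hb : 0 < b) {k n : ℕ} (h : n ≤ k) :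
    (((k + 1 : ℕ) : ℝ) * ((k + 1 : ℕ) + a + b + 1) - n * (n + a + b + 1)) * dco a b (k + 1) n =
      dco a b k n := by
  obtain ⟨m, rfl⟩ := Nat.exists_eq_add_of_le h
  unfold dco
  rw [show n + m + 1 - n = m + 1 by omega, show n + m - n = m by omega, rf_succ, Nat.factorial_succ]
  have h1 := (rf_pos (x := 2 * (n : ℝ) + a + b + 2) (by positivity) m).ne'
  have h2 : (2 * (n : ℝ) + a + b + 2 + m) ≠ 0 := by positivity
  have h3 : (m.factorial : ℝ) ≠ 0 := by positivity
  push_cast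
  field_simp
  ring

open Polynomial in
lemma Bg_coeff_gt (a b : ℝ) (k : ℕ) (s t : ℝ) (j : ℕ) (hj : k < j) : (Bg a b k s t).coeff j = 0 := by
  rw [Bg, finsetSum_coeff]
  apply Finset.sum_eq_zero
  intro ij hij
  have h := Finset.HasAntidiagonal.mem_antidiagonal.mp hij
  rw [coeff_C_mul, mul_comm (X ^ ij.1) _, coeff_mul_X_pow', if_pos (by omega)]
  have : ((1 - X : ℝ[X]) ^ ij.2).natDegree ≤ ij.2 * 1 := by
    apply natDegree_pow_le_of_le
    compute_degree
  rw [coeff_eq_zero_of_natDegree_lt (by omega), mul_zero]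

open Polynomial in
lemma coeff_one_sub_pow (j : ℕ) : ((1 - X : ℝ[X]) ^ j).coeff j = (-1) ^ j := by
  have h : (1 - X : ℝ[X]).natDegree ≤ 1 := by compute_degree
  have := coeff_pow_of_natDegree_le (m := j) (n := 1) h
  rw [mul_one] at this
  rw [this]; simp [coeff_one, coeff_X]

open Polynomial in
lemma Bg_coeff_top (a b : ℝ) (k : ℕ) (s t : ℝ) : (Bg a b k s t).coeff k =
    ∑ ij ∈ Finset.HasAntidiagonal.antidiagonal k, bco a b ij.1 ij.2 * s ^ ij.1 * (-t) ^ ij.2 := by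
  rw [Bg, finsetSum_coeff]
  apply Finset.sum_congr rfl
  intro ij hij
  have h := Finset.HasAntidiagonal.mem_antidiagonal.mp hij
  rw [coeff_C_mul, mul_comm (X ^ ij.1) _, coeff_mul_X_pow', if_pos (by omega),
    show k - ij.1 = ij.2 by omega, coeff_one_sub_pow, neg_pow t]
  ring

open Polynomial in
lemma Bg_special {a b : ℝ} (ha : 0 < a) (hb : 0 < b) (k : ℕ) :
    Bg a b k (-1) 1 = C (1 / (rf (a + 1) k * rf (b + 1) k)) * Jp a b k := by
  have heig : LL a b (Bg a b k (-1) 1) = - (C ((k : ℝ) * (k + a + b + 1)) * Bg a b k (-1) 1) := by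
    cases k with
    | zero => rw [LL_Bg_zero]; simp
    | succ k => rw [LL_Bg ha hb]; simp
  have hJk : jco a b k k ≠ 0 := by
    rw [jco_top ha hb]
    have := (rf_pos (x := a + b + 1 + k) (by positivity) k).ne'
    positivity
  have h0 : jco a b k 0 ≠ 0 := by
    rw [jco_zero ha hb]
    have := (rf_pos (x := a + 1) (by positivity) k)
    positivity
  set q : ℝ := (Bg a b k (-1) 1).coeff k / jco a b k k with hq
  have h1 : Bg a b k (-1) 1 - C q * Jp a b k = 0 := by
    apply LL_uniq ha hb k
    · rw [LL_sub, LL_C_mul, Jp_eigen ha hb, heig]; ring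
    · intro j hj
      rcases hj.lt_or_eq with h | h
      · rw [coeff_sub, Bg_coeff_gt _ _ _ _ _ _ h, coeff_C_mul, Jp_coeff, jco, if_neg (by omega)]; simp
      · subst h
        rw [coeff_sub, coeff_C_mul, Jp_coeff, hq, div_mul_cancel₀ _ hJk, sub_self]
  have h2 : Bg a b k (-1) 1 = C q * Jp a b k := sub_eq_zero.mp h1
  have h3 : q = 1 / (rf (a + 1) k * rf (b + 1) k) := by
    have h4 := congrArg (fun f => f.eval 0) h2
    simp only [eval_mul, eval_C] at h4
    rw [← coeff_zero_eq_eval_zero (Jp a b k), Jp_coeff, jco_zero ha hb, Bg, eval_finsetSum,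
      Finset.sum_eq_single (0, k)] at h4
    · simp [bco, rf_zero] at h4
      have e1 := (rf_pos (x := a + 1) (by positivity) k)
      have e2 := (rf_pos (x := b + 1) (by positivity) k)
      have e3 : (k.factorial : ℝ) ≠ 0 := by positivity
      field_simp at h4 ⊢
      linarith
    · intro ij hij hne
      have h := Finset.HasAntidiagonal.mem_antidiagonal.mp hij
      have : ij.1 ≠ 0 := by
        intro h0; apply hne; ext <;> simp <;> omega
      simp [this]
    · simp
  rw [h2, h3]

open Polynomial in
theorem Bg_decomp {a b : ℝ} (ha : 0 < a) (hb : 0 < b) (k : ℕ) (y : ℝ) :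
    Bg a b k y (1 - y) = ∑ n ∈ Finset.range (k + 1),
      C (dco a b k n * cco a b n * (Jp a b n).eval y) * Jp a b n := by
  have top : ∀ k, (Bg a b k y (1 - y)).coeff k = dco a b k k * cco a b k * (Jp a b k).eval y * jco a b k k := by
    intro k
    have h1 := congrArg (fun f => f.eval y) (Bg_special ha hb k)
    simp only [eval_mul, eval_C] at h1
    have h2 : (Bg a b k y (1 - y)).coeff k = (-1) ^ k * eval y (Bg a b k (-1) 1) := by
      rw [Bg_coeff_top, Bg, eval_finsetSum, Finset.mul_sum]
      apply Finset.sum_congr rfl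
      intro ij hij
      have h := Finset.HasAntidiagonal.mem_antidiagonal.mp hij
      simp only [eval_mul, eval_C, eval_pow, eval_X, eval_sub, eval_one, one_pow, mul_one]
      rw [← h, neg_pow (1 - y), pow_add]
      have : ((-1 : ℝ) ^ ij.1) * (-1) ^ ij.1 = 1 := by rw [← mul_pow]; simp
      linear_combination (-(bco a b ij.1 ij.2 * y ^ ij.1 * (-1) ^ ij.2 * (1 - y) ^ ij.2)) * this
    rw [h2, h1, jco_top ha hb, dco, cco]
    have e1 := (rf_pos (x := a + 1) (by positivity) k)
    have e2 := (rf_pos (x := b + 1) (by positivity) k)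
    have e4 := (rf_pos (x := a + b + 1 + k) (by positivity) k)
    have e3 : (k.factorial : ℝ) ≠ 0 := by positivity
    simp [rf_zero]
    field_simp
  rw [← sub_eq_zero]
  apply LL_uniq ha hb k
  · induction k with
    | zero => 
      simp only [LL_sub, LL_Bg_zero, LL_sum, LL_C_mul, Jp_eigen ha hb]; simp
    | succ k ih =>
      have ih' : Bg a b k y (1 - y) = ∑ n ∈ Finset.range (k + 1),
          C (dco a b k n * cco a b n * (Jp a b n).eval y) * Jp a b n := by
        rw [← sub_eq_zero]
        apply LL_uniq ha hb k _ ih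
        intro j hj
        rw [coeff_sub, finsetSum_coeff]
        simp only [coeff_C_mul, Jp_coeff]
        rcases hj.lt_or_eq with h | h
        · rw [Bg_coeff_gt _ _ _ _ _ _ h, Finset.sum_eq_zero]
          · simp
          · intro n hn
            rw [Finset.mem_range] at hn
            rw [jco, if_neg (by omega), mul_zero]
        · subst h
          rw [Finset.sum_range_succ, Finset.sum_eq_zero, top]
          · ring
          · intro n hn
            rw [Finset.mem_range] at hn
            rw [jco, if_neg (by omega), mul_zero]
      rw [LL_sub, LL_Bg ha hb, LL_sum, mul_sub, show y + (1 - y) = 1 by ring, C_1, one_mul, ih',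
        Finset.mul_sum, Finset.sum_range_succ _ (k + 1), Finset.sum_range_succ _ (k + 1)]
      have : ∀ n ∈ Finset.range (k + 1), LL a b (C (dco a b (k + 1) n * cco a b n * (Jp a b n).eval y) * Jp a b n)
          = C (dco a b k n * cco a b n * (Jp a b n).eval y) * Jp a b n -
            C (((k + 1 : ℕ) : ℝ) * ((k + 1 : ℕ) + a + b + 1)) * (C (dco a b (k + 1) n * cco a b n * (Jp a b n).eval y) * Jp a b n) := by
        intro n hn
        rw [Finset.mem_range] at hn
        rw [LL_C_mul, Jp_eigen ha hb, ← dco_rec ha hb (show n ≤ k by omega)]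
        simp only [C_mul, C_sub]
        ring
      rw [Finset.sum_congr rfl this, Finset.sum_sub_distrib, LL_C_mul, Jp_eigen ha hb]
      ring
  · intro j hj
    rw [coeff_sub, finsetSum_coeff]
    simp only [coeff_C_mul, Jp_coeff]
    rcases hj.lt_or_eq with h | h
    · rw [Bg_coeff_gt _ _ _ _ _ _ h, Finset.sum_eq_zero]
      · simp
      · intro n hn
        rw [Finset.mem_range] at hn
        rw [jco, if_neg (by omega), mul_zero]
    · subst h
      rw [Finset.sum_range_succ, Finset.sum_eq_zero, top]
      · ring
      · intro n hn
        rw [Finset.mem_range] at hn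
        rw [jco, if_neg (by omega), mul_zero]

end

section

/-- the Gegenbauer measure in the angular variable -/
def nu (a : ℝ) : Measure ℝ :=
  (volume.restrict (Icc 0 π)).withDensity (fun ω => ENNReal.ofReal (sin ω ^ (2 * |a|)))

lemma sin_rpow_le (a : ℝ) {ω : ℝ} (h : ω ∈ Icc 0 π) : sin ω ^ (2 * |a|) ≤ 1 :=
  Real.rpow_le_one (sin_nonneg_of_mem_Icc h) (sin_le_one _) (by positivity)

lemma cont_sin_rpow (a : ℝ) : Continuous (fun ω : ℝ => sin ω ^ (2 * |a|)) :=
  continuous_sin.rpow_const (fun _ => Or.inr (by positivity))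

instance nu_finite (a : ℝ) : IsFiniteMeasure (nu a) := by
  unfold nu
  apply isFiniteMeasure_withDensity_ofReal
  exact ((cont_sin_rpow a).integrableOn_Icc (μ := volume) (a := 0) (b := π)).2

lemma nu_restrict (a : ℝ) : (nu a).restrict (Icc 0 π) = nu a := by
  unfold nu
  rw [restrict_withDensity measurableSet_Icc, Measure.restrict_restrict measurableSet_Icc, inter_self]

lemma nu_int {a : ℝ} (ha : 0 < a) (f : ℝ → ℝ) :
    ∫ ω, f ω ∂(nu a) = ∫ ω in 0..π, sin ω ^ (2 * a) * f ω := by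
  unfold nu
  rw [integral_withDensity_eq_integral_toReal_smul]
  · rw [intervalIntegral.integral_of_le pi_pos.le, ← integral_Icc_eq_integral_Ioc]
    apply setIntegral_congr_fun measurableSet_Icc
    intro ω hω
    simp only [smul_eq_mul]
    rw [ENNReal.toReal_ofReal (Real.rpow_nonneg (sin_nonneg_of_mem_Icc hω) _), abs_of_pos ha]
  · exact (cont_sin_rpow a).measurable.ennreal_ofReal
  · exact Filter.Eventually.of_forall (fun _ => ENNReal.ofReal_lt_top)

/-- the product measure -/
def nn (a b : ℝ) : Measure (ℝ × ℝ) := (nu a).prod (nu b)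

instance nn_finite (a b : ℝ) : IsFiniteMeasure (nn a b) := by unfold nn; infer_instance

lemma nn_restrict (a b : ℝ) : (nn a b).restrict (Icc 0 π ×ˢ Icc 0 π) = nn a b := by
  unfold nn
  rw [← Measure.prod_restrict, nu_restrict, nu_restrict]

lemma nu_integrable (a : ℝ) {f : ℝ → ℝ} (hf : Continuous f) : Integrable f (nu a) := by
  rw [← nu_restrict]
  exact hf.continuousOn.integrableOn_compact isCompact_Icc

lemma nn_integrable (a b : ℝ) {f : ℝ × ℝ → ℝ} (hf : Continuous f) : Integrable f (nn a b) := by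
  rw [← nn_restrict]
  exact hf.continuousOn.integrableOn_compact (isCompact_Icc.prod isCompact_Icc)

lemma nu_byparts {a : ℝ} (ha : 0 < a) {F F' : ℝ → ℝ} (hF : ∀ ω, HasDerivAt F (F' ω) ω)
    (hF' : Continuous F') :
    ∫ ω, ((2 * a + 1) * (cos ω * F ω) + sin ω * F' ω) ∂(nu a) = 0 := by
  rw [nu_int ha]
  have hFc : Continuous F := continuous_iff_continuousAt.mpr (fun x => (hF x).continuousAt)
  have h := intervalIntegral.integral_eq_sub_of_hasDerivAt (a := 0) (b := π)
    (f := fun ω => sin ω ^ (2 * a + 1) * F ω)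
    (f' := fun ω => (2 * a + 1) * sin ω ^ (2 * a) * cos ω * F ω + sin ω ^ (2 * a + 1) * F' ω) ?_ ?_
  · simp only [sin_pi, sin_zero] at h
    rw [Real.zero_rpow (by positivity)] at h
    simp only [zero_mul, sub_zero] at h
    refine Eq.trans ?_ h
    apply intervalIntegral.integral_congr
    intro ω hω
    rw [uIcc_of_le pi_pos.le] at hω
    have hs := sin_nonneg_of_mem_Icc hω
    simp only
    rw [Real.rpow_add_one' hs (by positivity)]
    ring
  · intro ω hω
    have h1 := (hasDerivAt_sin ω).rpow_const (p := 2 * a + 1) (Or.inr (by linarith))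
    have h2 := h1.fun_mul (hF ω)
    refine h2.congr_deriv ?_
    rw [show 2 * a + 1 - 1 = 2 * a by ring]; ring
  · apply Continuous.intervalIntegrable
    have c1 : Continuous (fun ω : ℝ => sin ω ^ (2 * a)) :=
      continuous_sin.rpow_const (fun _ => Or.inr (by positivity))
    have c2 : Continuous (fun ω : ℝ => sin ω ^ (2 * a + 1)) :=
      continuous_sin.rpow_const (fun _ => Or.inr (by positivity))
    fun_prop

lemma nu_mom_rec {a : ℝ} (ha : 0 < a) (n : ℕ) :
    (2 * a + n + 2) * ∫ ω, cos ω ^ (n + 2) ∂(nu a) = (n + 1) * ∫ ω, cos ω ^ n ∂(nu a) := by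
  have h := nu_byparts ha (F := fun ω => cos ω ^ (n + 1))
    (F' := fun ω => ((n + 1 : ℕ) : ℝ) * cos ω ^ n * (- sin ω)) (fun ω => by
      exact (hasDerivAt_cos ω).fun_pow (n + 1)) (by fun_prop)
  have e : ∀ ω : ℝ, (2 * a + 1) * (cos ω * cos ω ^ (n + 1)) + sin ω * (((n + 1 : ℕ) : ℝ) * cos ω ^ n * (- sin ω))
      = (2 * a + n + 2) * cos ω ^ (n + 2) - (n + 1) * cos ω ^ n := by
    intro ω
    have := sin_sq ω
    push_cast
    have : sin ω * ((n + 1) * cos ω ^ n * (- sin ω)) = - (n + 1) * cos ω ^ n * (1 - cos ω ^ 2) := by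
      rw [← this]; ring
    rw [this]; ring
  simp only [e] at h
  rw [integral_sub ((nu_integrable a (by fun_prop)).const_mul _) ((nu_integrable a (by fun_prop)).const_mul _),
    integral_const_mul, integral_const_mul] at h
  linarith

lemma nu_mom_odd {a : ℝ} (ha : 0 < a) (i : ℕ) : ∫ ω, cos ω ^ (2 * i + 1) ∂(nu a) = 0 := by
  induction i with
  | zero =>
    have h := nu_byparts ha (F := fun ω => 1) (F' := fun ω => 0) (fun ω => hasDerivAt_const _ _) (by fun_prop)
    simp only [mul_one, mul_zero, add_zero, integral_const_mul] at h
    rcases mul_eq_zero.mp h with h | h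
    · linarith
    · simpa using h
  | succ i ih =>
    have h := nu_mom_rec ha (2 * i + 1)
    rw [ih, mul_zero] at h
    rcases mul_eq_zero.mp h with h | h
    · have : (0:ℝ) ≤ ((2 * i + 1 : ℕ) : ℝ) := by positivity
      linarith
    · exact h

/-- total mass -/
def mz (a : ℝ) : ℝ := ∫ _ω, (1 : ℝ) ∂(nu a)

lemma mz_pos {a : ℝ} (ha : 0 < a) : 0 < mz a := by
  unfold mz
  rw [nu_int ha]
  apply intervalIntegral.intervalIntegral_pos_of_pos_on
  · apply Continuous.intervalIntegrable
    have c1 : Continuous (fun ω : ℝ => sin ω ^ (2 * a)) :=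
      continuous_sin.rpow_const (fun _ => Or.inr (by positivity))
    fun_prop
  · intro x hx
    have := Real.rpow_pos_of_pos (sin_pos_of_mem_Ioo hx) (2 * a)
    linarith
  · exact pi_pos

lemma nu_mom_even {a : ℝ} (ha : 0 < a) (i : ℕ) : ∫ ω, cos ω ^ (2 * i) ∂(nu a) =
    mz a * ((2 * i).factorial / (4 ^ i * i.factorial * rf (a + 1) i)) := by
  induction i with
  | zero => simp [mz, rf_zero]
  | succ i ih =>
    have h := nu_mom_rec ha (2 * i)
    rw [ih] at h
    have h0 := rf_pos (x := a + 1) (by linarith) i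
    rw [rf_succ]
    have hf1 : ((2 * (i + 1)).factorial : ℝ) = (2 * i + 2) * ((2 * i + 1) * (2 * i).factorial) := by
      rw [show 2 * (i + 1) = (2 * i + 1) + 1 by ring, Nat.factorial_succ, Nat.factorial_succ]; push_cast; ring
    have hf2 : ((i + 1).factorial : ℝ) = (i + 1) * i.factorial := by
      rw [Nat.factorial_succ]; push_cast; ring
    rw [show 2 * (i + 1) = 2 * i + 2 by ring] at *
    rw [hf1, hf2]
    have hp : (2 * a + ((2 * i : ℕ) : ℝ) + 2) ≠ 0 := by positivity
    apply mul_left_cancel₀ hp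
    rw [h]
    have : (i.factorial : ℝ) ≠ 0 := by positivity
    have : a + 1 + i ≠ 0 := by positivity
    push_cast
    field_simp
    ring

/-- differentiation under the integral sign -/
lemma deriv_under {X : Type*} [TopologicalSpace X] [MeasurableSpace X] [OpensMeasurableSpace X]
    [SecondCountableTopology X] [T2Space X]
    {μ : Measure X} [IsFiniteMeasure μ] {T : Set X} (hT : IsCompact T) (hTm : MeasurableSet T)
    (hμ : μ.restrict T = μ)
    {U : Set ℝ} (hU : IsOpen U) {f f' : ℝ → X → ℝ}
    (hf : ∀ x ∈ U, Continuous (f x))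
    (hd : ∀ x ∈ U, ∀ w, HasDerivAt (fun y => f y w) (f' x w) x)
    (hc : ContinuousOn (fun p : ℝ × X => f' p.1 p.2) (U ×ˢ univ)) {x₀ : ℝ} (hx : x₀ ∈ U) :
    HasDerivAt (fun x => ∫ w, f x w ∂μ) (∫ w, f' x₀ w ∂μ) x₀ := by
  obtain ⟨ε, hε, hb⟩ := Metric.isOpen_iff.mp hU x₀ hx
  have hcb : Metric.closedBall x₀ (ε / 2) ⊆ U := (Metric.closedBall_subset_ball (by linarith)).trans hb
  have hcomp : IsCompact (Metric.closedBall x₀ (ε / 2) ×ˢ T) := (isCompact_closedBall _ _).prod hT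
  obtain ⟨C, hC⟩ := hcomp.exists_bound_of_continuousOn (hc.mono (prod_mono hcb (subset_univ _)))
  have hf'c : ∀ x ∈ U, Continuous (f' x) := by
    intro x hxU
    rw [← continuousOn_univ]
    exact hc.comp (f := fun w : X => (x, w)) (by fun_prop) (fun w _ => ⟨hxU, mem_univ _⟩)
  have haeT : ∀ᵐ w ∂μ, w ∈ T := by
    rw [← hμ]; exact ae_restrict_mem hTm
  refine (hasDerivAt_integral_of_dominated_loc_of_deriv_le (μ := μ) (F := f) (F' := f')
    (s := Metric.ball x₀ (ε / 2)) (bound := fun _ => C) (Metric.ball_mem_nhds _ (by linarith)) ?_ ?_ ?_ ?_ ?_ ?_).2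
  · filter_upwards [hU.mem_nhds hx] with y hy
    exact (hf y hy).aestronglyMeasurable
  · rw [← hμ]
    exact (hf x₀ hx).continuousOn.integrableOn_compact hT
  · exact (hf'c x₀ hx).aestronglyMeasurable
  · filter_upwards [haeT] with w hw y hy
    exact hC (y, w) ⟨Metric.ball_subset_closedBall hy, hw⟩
  · exact integrable_const C
  · exact Filter.Eventually.of_forall (fun w y hy => hd y (hcb (Metric.ball_subset_closedBall hy)) w)

lemma nu_deriv_under (a : ℝ) {U : Set ℝ} (hU : IsOpen U) {f f' : ℝ → ℝ → ℝ}
    (hf : ∀ x ∈ U, Continuous (f x))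
    (hd : ∀ x ∈ U, ∀ w, HasDerivAt (fun y => f y w) (f' x w) x)
    (hc : ContinuousOn (fun p : ℝ × ℝ => f' p.1 p.2) (U ×ˢ univ)) {x₀ : ℝ} (hx : x₀ ∈ U) :
    HasDerivAt (fun x => ∫ w, f x w ∂(nu a)) (∫ w, f' x₀ w ∂(nu a)) x₀ :=
  deriv_under isCompact_Icc measurableSet_Icc (nu_restrict a) hU hf hd hc hx

lemma nn_deriv_under (a b : ℝ) {U : Set ℝ} (hU : IsOpen U) {f f' : ℝ → ℝ × ℝ → ℝ}
    (hf : ∀ x ∈ U, Continuous (f x))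
    (hd : ∀ x ∈ U, ∀ w, HasDerivAt (fun y => f y w) (f' x w) x)
    (hc : ContinuousOn (fun p : ℝ × (ℝ × ℝ) => f' p.1 p.2) (U ×ˢ univ)) {x₀ : ℝ} (hx : x₀ ∈ U) :
    HasDerivAt (fun x => ∫ w, f x w ∂(nn a b)) (∫ w, f' x₀ w ∂(nn a b)) x₀ :=
  deriv_under (isCompact_Icc.prod isCompact_Icc) (measurableSet_Icc.prod measurableSet_Icc)
    (nn_restrict a b) hU hf hd hc hx

end

section

lemma HasSum.cg {ι : Type*} {f g : ι → ℝ} {a b : ℝ} (h : HasSum f a) (hf : ∀ n, g n = f n) (hb : b = a) :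
    HasSum g b := by
  rw [hb, show g = f from funext hf]; exact h

lemma asc_rf (p : ℝ) (n : ℕ) : (ascPochhammer ℕ n).smeval p = rf p n := by
  induction n with
  | zero => simp [rf_zero, Polynomial.smeval_one]
  | succ n ih =>
    rw [ascPochhammer_succ_right, Polynomial.smeval_mul, ih, rf_succ]
    simp [Polynomial.smeval_add, Polynomial.smeval_X, Polynomial.smeval_natCast]

lemma choose_rf (p : ℝ) (n : ℕ) : Ring.choose (p + n - 1) n = rf p n / n.factorial := by
  have h := Ring.descPochhammer_eq_factorial_smul_choose (p + n - 1) n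
  rw [Polynomial.descPochhammer_smeval_eq_ascPochhammer, show p + n - 1 - n + 1 = p by ring, asc_rf] at h
  rw [h, nsmul_eq_mul]
  have : (n.factorial : ℝ) ≠ 0 := by positivity
  field_simp

lemma binom_one (p : ℝ) {x : ℝ} (hx : |x| < 1) :
    HasSum (fun n : ℕ => rf p n / n.factorial * x ^ n) ((1 - x) ^ (-p)) := by
  have h := (Real.one_div_one_sub_rpow_hasFPowerSeriesOnBall_zero p).hasSum (y := x)
    (by simpa [enorm_eq_nnnorm, ← NNReal.coe_lt_coe] using hx)
  simp only [zero_add] at h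
  have h1 : 0 ≤ 1 - x := by have := (abs_lt.mp hx).2; linarith
  rw [Real.rpow_neg h1, ← one_div]
  refine h.cg (fun n => ?_) rfl
  rw [FormalMultilinearSeries.ofScalars_apply_eq, choose_rf, smul_eq_mul]

lemma binom_gen (p : ℝ) {c x : ℝ} (hx : |x| < c) :
    HasSum (fun n : ℕ => rf p n / n.factorial * c ^ (-p - n) * x ^ n) ((c - x) ^ (-p)) := by
  have hc : 0 < c := lt_of_le_of_lt (abs_nonneg _) hx
  have h := (binom_one p (x := x / c) (by rw [abs_div, abs_of_pos hc, div_lt_one hc]; exact hx)).mul_left (c ^ (-p))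
  refine h.cg (fun n => ?_) ?_
  · rw [Real.rpow_sub hc, Real.rpow_natCast]
    rw [div_pow]; ring
  · rw [← Real.mul_rpow hc.le]
    · congr 1; field_simp
    · rw [sub_nonneg, div_le_one hc]; exact (le_abs_self x).trans hx.le

lemma binom_int {X : Type*} [MeasurableSpace X] {μ : Measure X} [IsFiniteMeasure μ]
    {p : ℝ} (hp : 0 < p) {c ρ : ℝ} (hρ : ρ < c) {w : X → ℝ} (hw : ∀ x, |w x| ≤ ρ) (hm : AEStronglyMeasurable w μ) :
    HasSum (fun n : ℕ => rf p n / n.factorial * c ^ (-p - n) * ∫ x, w x ^ n ∂μ) (∫ x, (c - w x) ^ (-p) ∂μ) := by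
  by_cases hX : IsEmpty X
  · simp [integral_of_isEmpty]
  rw [not_isEmpty_iff] at hX
  have hρ0 : 0 ≤ ρ := (abs_nonneg _).trans (hw hX.some)
  have hc : 0 < c := lt_of_le_of_lt hρ0 hρ
  have hcoef : ∀ n : ℕ, 0 ≤ rf p n / n.factorial * c ^ (-p - n) := fun n => by
    have := rf_pos hp n
    positivity
  have hintg : ∀ n : ℕ, Integrable (fun x => w x ^ n) μ := fun n => by
    apply Integrable.of_bound (hm.pow n) (ρ ^ n)
    filter_upwards with x
    rw [Pi.pow_apply, norm_pow]
    exact pow_le_pow_left₀ (norm_nonneg _) (hw x) n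
  have h := hasSum_integral_of_summable_integral_norm (μ := μ)
    (F := fun n : ℕ => fun x => rf p n / n.factorial * c ^ (-p - n) * w x ^ n)
    (fun n => (hintg n).const_mul _) ?_
  · refine h.cg (fun n => ?_) ?_
    · rw [integral_const_mul]
    · apply integral_congr_ae
      filter_upwards with x
      exact (binom_gen p (lt_of_le_of_lt (hw x) hρ)).tsum_eq.symm
  · have hs := (binom_gen p (c := c) (x := ρ) (by rwa [abs_of_nonneg hρ0])).summable.mul_right (μ.real univ)
    refine Summable.of_nonneg_of_le (fun n => integral_nonneg (fun _ => norm_nonneg _)) (fun n => ?_) hs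
    have : ∀ x, ‖rf p n / n.factorial * c ^ (-p - n) * w x ^ n‖ ≤ rf p n / n.factorial * c ^ (-p - n) * ρ ^ n := by
      intro x
      rw [norm_mul, Real.norm_of_nonneg (hcoef n), norm_pow]
      exact mul_le_mul_of_nonneg_left (pow_le_pow_left₀ (norm_nonneg _) (hw x) n) (hcoef n)
    calc ∫ x, ‖rf p n / n.factorial * c ^ (-p - n) * w x ^ n‖ ∂μ
        ≤ ∫ x, rf p n / n.factorial * c ^ (-p - n) * ρ ^ n ∂μ :=
          integral_mono ((hintg n).const_mul _).norm (integrable_const _) this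
      _ = _ := by rw [integral_const, smul_eq_mul, mul_comm]

/-- `cosh (t/2) > 1` -/
lemma ch_gt {t : ℝ} (ht : 0 < t) : 1 < cosh (t / 2) := by
  rw [one_lt_cosh]; linarith

lemma ch_sub_cos_pos {t : ℝ} (ht : 0 < t) (ω : ℝ) : 0 < cosh (t / 2) - cos ω := by
  have := ch_gt ht; have := cos_le_one ω; linarith

lemma hasDerivAt_ch (t : ℝ) : HasDerivAt (fun t => cosh (t / 2)) (sinh (t / 2) / 2) t := by
  have := ((hasDerivAt_id t).div_const 2).cosh
  refine this.congr_deriv ?_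
  simp; ring

lemma hasDerivAt_sh (t : ℝ) : HasDerivAt (fun t => sinh (t / 2)) (cosh (t / 2) / 2) t := by
  have := ((hasDerivAt_id t).div_const 2).sinh
  refine this.congr_deriv ?_
  simp; ring

/-- one variable integral `I_p(t) = ∫ (ch - cos ω)^(-p) dν_κ` -/
def Iv (κ p t : ℝ) : ℝ := ∫ ω, (cosh (t / 2) - cos ω) ^ (-p) ∂(nu κ)

lemma Iv_cont {t : ℝ} (ht : 0 < t) (p : ℝ) : Continuous (fun ω => (cosh (t / 2) - cos ω) ^ p) := by
  apply Continuous.rpow_const (by fun_prop)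
  intro ω; left; exact (ch_sub_cos_pos ht ω).ne'

lemma Iv_deriv (κ p : ℝ) {t : ℝ} (ht : 0 < t) :
    HasDerivAt (Iv κ p) (-(p / 2) * sinh (t / 2) * Iv κ (p + 1) t) t := by
  have h := nu_deriv_under κ (U := Ioi 0) isOpen_Ioi
    (f := fun t ω => (cosh (t / 2) - cos ω) ^ (-p))
    (f' := fun t ω => -(p / 2) * sinh (t / 2) * (cosh (t / 2) - cos ω) ^ (-(p + 1)))
    (fun x hx => Iv_cont hx _) (fun x hx ω => ?_) ?_ (x₀ := t) ht
  · rw [integral_const_mul] at h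
    exact h
  · have h1 := ((hasDerivAt_ch x).sub_const (cos ω)).rpow_const (p := -p) (Or.inl (ch_sub_cos_pos hx ω).ne')
    refine h1.congr_deriv ?_
    rw [show -p - 1 = -(p + 1) by ring]; ring
  · apply ContinuousOn.mul (by fun_prop)
    apply ContinuousOn.rpow_const (by fun_prop)
    intro x hx; left; exact (ch_sub_cos_pos hx.1 x.2).ne'

lemma Iv_rel {κ : ℝ} (hκ : 0 < κ) {t : ℝ} (ht : 0 < t) :
    (κ + 1) * sinh (t / 2) ^ 2 * Iv κ (κ + 2) t = cosh (t / 2) * Iv κ (κ + 1) t + κ * Iv κ κ t := by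
  have h := nu_byparts hκ (F := fun ω => (cosh (t / 2) - cos ω) ^ (-(κ + 1)))
    (F' := fun ω => sin ω * (-(κ + 1)) * (cosh (t / 2) - cos ω) ^ (-(κ + 2))) (fun ω => ?_) ?_
  · have e : ∀ ω, (2 * κ + 1) * (cos ω * (cosh (t / 2) - cos ω) ^ (-(κ + 1))) +
        sin ω * (sin ω * (-(κ + 1)) * (cosh (t / 2) - cos ω) ^ (-(κ + 2))) =
        (κ + 1) * sinh (t / 2) ^ 2 * (cosh (t / 2) - cos ω) ^ (-(κ + 2)) -
        cosh (t / 2) * (cosh (t / 2) - cos ω) ^ (-(κ + 1)) - κ * (cosh (t / 2) - cos ω) ^ (-κ) := by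
      intro ω
      have hD := ch_sub_cos_pos ht ω
      have e1 : (cosh (t / 2) - cos ω) ^ (-(κ + 1)) = (cosh (t / 2) - cos ω) ^ (-(κ + 2)) * (cosh (t / 2) - cos ω) := by
        rw [← Real.rpow_add_one hD.ne']; congr 1; ring
      have e0 : (cosh (t / 2) - cos ω) ^ (-κ) = (cosh (t / 2) - cos ω) ^ (-(κ + 2)) * (cosh (t / 2) - cos ω) * (cosh (t / 2) - cos ω) := by
        rw [← Real.rpow_add_one hD.ne', ← Real.rpow_add_one hD.ne']; congr 1; ring
      rw [e0, e1]
      have hs : sin ω * sin ω = 1 - cos ω ^ 2 := by rw [← sin_sq]; ring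
      have hsh : sinh (t / 2) ^ 2 = cosh (t / 2) ^ 2 - 1 := by rw [cosh_sq]; ring
      rw [hsh, show ∀ A B : ℝ, sin ω * (sin ω * A * B) = (sin ω * sin ω) * A * B by intros; ring, hs]
      ring
    simp only [e] at h
    rw [integral_sub, integral_sub, integral_const_mul, integral_const_mul, integral_const_mul] at h
    · unfold Iv; linarith
    · exact (nu_integrable κ (Iv_cont ht _)).const_mul _
    · exact (nu_integrable κ (Iv_cont ht _)).const_mul _
    · exact ((nu_integrable κ (Iv_cont ht _)).const_mul _).sub ((nu_integrable κ (Iv_cont ht _)).const_mul _)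
    · exact (nu_integrable κ (Iv_cont ht _)).const_mul _
  · have h1 := ((hasDerivAt_cos ω).const_sub (cosh (t / 2))).rpow_const (p := -(κ + 1)) (Or.inl (ch_sub_cos_pos ht ω).ne')
    refine h1.congr_deriv ?_
    rw [show -(κ + 1) - 1 = -(κ + 2) by ring]; ring
  · have := Iv_cont ht (-(κ + 2))
    fun_prop

/-- `G_κ(t)` -/
def Gv (κ t : ℝ) : ℝ := sinh (t / 2) * Iv κ (κ + 1) t

lemma Fv_deriv (κ : ℝ) {t : ℝ} (ht : 0 < t) : HasDerivAt (Iv κ κ) (-(κ / 2) * Gv κ t) t := by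
  refine (Iv_deriv κ κ ht).congr_deriv ?_
  unfold Gv; ring

lemma Gv_deriv {κ : ℝ} (hκ : 0 < κ) {t : ℝ} (ht : 0 < t) : HasDerivAt (Gv κ) (-(κ / 2) * Iv κ κ t) t := by
  have h := (hasDerivAt_sh t).fun_mul (Iv_deriv κ (κ + 1) ht)
  refine h.congr_deriv ?_
  have := Iv_rel hκ ht
  rw [show κ + 1 + 1 = κ + 2 by ring]
  linear_combination (-1 / 2) * this

lemma Iv_bounds {κ p : ℝ} (hp : 0 ≤ p) {t : ℝ} (ht : 0 < t) :
    mz κ * (cosh (t / 2) + 1) ^ (-p) ≤ Iv κ p t ∧ Iv κ p t ≤ mz κ * (cosh (t / 2) - 1) ^ (-p) := by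
  have hch := ch_gt ht
  unfold mz Iv
  rw [← integral_mul_const, ← integral_mul_const]
  constructor
  · apply integral_mono (integrable_const _) (nu_integrable κ (Iv_cont ht _))
    intro ω
    simp only [one_mul]
    exact Real.rpow_le_rpow_of_nonpos (ch_sub_cos_pos ht ω) (by linarith [neg_one_le_cos ω]) (by linarith)
  · apply integral_mono (nu_integrable κ (Iv_cont ht _)) (integrable_const _)
    intro ω
    simp only [one_mul]
    exact Real.rpow_le_rpow_of_nonpos (by linarith) (by linarith [cos_le_one ω]) (by linarith)

lemma tendsto_ech (s : ℝ) :
    Filter.Tendsto (fun t : ℝ => exp (-(t / 2)) * (cosh (t / 2) + s)) Filter.atTop (nhds (1 / 2)) := by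
  have h1 : Filter.Tendsto (fun t : ℝ => exp (-(t / 2))) Filter.atTop (nhds 0) := by
    apply Real.tendsto_exp_neg_atTop_nhds_zero.comp
    exact Filter.tendsto_id.atTop_div_const (by norm_num)
  have h2 : Filter.Tendsto (fun t : ℝ => 1 / 2 + exp (-(t / 2)) * exp (-(t / 2)) / 2 + exp (-(t / 2)) * s) Filter.atTop
      (nhds (1 / 2 + 0 * 0 / 2 + 0 * s)) :=
    (tendsto_const_nhds.add ((h1.mul h1).div_const 2)).add (h1.mul_const s)
  simp only [mul_zero, zero_div, add_zero, zero_mul] at h2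
  refine h2.congr (fun t => ?_)
  rw [cosh_eq]
  have : exp (-(t / 2)) * exp (t / 2) = 1 := by rw [← exp_add]; simp
  linear_combination (-1 / 2) * this

lemma tendsto_Iv_aux (p s : ℝ) : Filter.Tendsto (fun t : ℝ => exp (p * t / 2) * (cosh (t / 2) + s) ^ (-p)) Filter.atTop (nhds (2 ^ p)) := by
  have h := (tendsto_ech s).rpow_const (p := -p) (Or.inl (by norm_num))
  have e : (1 / 2 : ℝ) ^ (-p) = 2 ^ p := by
    rw [one_div, Real.inv_rpow (by norm_num), Real.rpow_neg (by norm_num), inv_inv]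
  rw [e] at h
  refine h.congr' ?_
  have hpos : ∀ᶠ t in Filter.atTop, (0:ℝ) < exp (-(t / 2)) * (cosh (t / 2) + s) :=
    (tendsto_ech s).eventually_const_lt (by norm_num)
  filter_upwards [hpos] with t ht
  have h2 : 0 < cosh (t / 2) + s := by
    by_contra hcon
    push Not at hcon
    have := mul_nonpos_of_nonneg_of_nonpos (exp_pos (-(t / 2))).le hcon
    linarith
  rw [Real.mul_rpow (exp_pos _).le h2.le, ← Real.exp_mul]
  congr 2; ring

lemma tendsto_Iv {κ p : ℝ} (hp : 0 ≤ p) :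
    Filter.Tendsto (fun t : ℝ => exp (p * t / 2) * Iv κ p t) Filter.atTop (nhds (mz κ * 2 ^ p)) := by
  refine tendsto_of_tendsto_of_tendsto_of_le_of_le' ((tendsto_Iv_aux p 1).const_mul (mz κ)) ((tendsto_Iv_aux p (-1)).const_mul (mz κ)) ?_ ?_
  · filter_upwards [Filter.eventually_gt_atTop 0] with t ht
    have := mul_le_mul_of_nonneg_left (Iv_bounds (κ := κ) hp ht).1 (exp_pos (p * t / 2)).le
    linarith
  · filter_upwards [Filter.eventually_gt_atTop 0] with t ht
    have := mul_le_mul_of_nonneg_left (Iv_bounds (κ := κ) hp ht).2 (exp_pos (p * t / 2)).le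
    rw [sub_eq_add_neg] at this
    linarith

lemma const_of_deriv_zero {f : ℝ → ℝ} (h : ∀ t, 0 < t → HasDerivAt f 0 t) {s t : ℝ} (hs : 0 < s) (ht : 0 < t) :
    f s = f t := by
  have := (convex_Ioi (0:ℝ)).is_const_of_fderivWithin_eq_zero (𝕜 := ℝ) (f := f)
    (fun x hx => (h x hx).differentiableAt.differentiableWithinAt)
    (fun x hx => by
      have h1 := (h x hx).hasFDerivAt.hasFDerivWithinAt (s := Ioi 0)
      rw [h1.fderivWithin (isOpen_Ioi.uniqueDiffWithinAt hx)]
      ext; simp) hs ht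
  exact this

lemma tendsto_Gv {κ : ℝ} (hκ : 0 < κ) :
    Filter.Tendsto (fun t : ℝ => exp (κ * t / 2) * Gv κ t) Filter.atTop (nhds (mz κ * 2 ^ κ)) := by
  have h1 := tendsto_Iv (κ := κ) (p := κ + 1) (by linarith)
  have h2 : Filter.Tendsto (fun t : ℝ => exp (-(t / 2)) * sinh (t / 2)) Filter.atTop (nhds (1 / 2)) := by
    have h0 : Filter.Tendsto (fun t : ℝ => exp (-(t / 2))) Filter.atTop (nhds 0) := by
      apply Real.tendsto_exp_neg_atTop_nhds_zero.comp
      exact Filter.tendsto_id.atTop_div_const (by norm_num)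
    have h3 : Filter.Tendsto (fun t : ℝ => 1 / 2 - exp (-(t / 2)) * exp (-(t / 2)) / 2) Filter.atTop
        (nhds (1 / 2 - 0 * 0 / 2)) := tendsto_const_nhds.sub ((h0.mul h0).div_const 2)
    simp only [mul_zero, zero_div, sub_zero] at h3
    refine h3.congr (fun t => ?_)
    rw [sinh_eq]
    have : exp (-(t / 2)) * exp (t / 2) = 1 := by rw [← exp_add]; simp
    linear_combination (-1 / 2) * this
  have h3 := h2.mul h1
  have e : 1 / 2 * (mz κ * 2 ^ (κ + 1)) = mz κ * 2 ^ κ := by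
    rw [Real.rpow_add_one (by norm_num)]; ring
  rw [e] at h3
  refine h3.congr (fun t => ?_)
  unfold Gv
  have : exp ((κ + 1) * t / 2) = exp (κ * t / 2) * exp (t / 2) := by rw [← exp_add]; congr 1; ring
  have h4 : exp (-(t / 2)) * exp (t / 2) = 1 := by rw [← exp_add]; simp
  rw [this]
  linear_combination (sinh (t / 2) * exp (κ * t / 2) * Iv κ (κ + 1) t) * h4

theorem Gv_eq {κ : ℝ} (hκ : 0 < κ) {t : ℝ} (ht : 0 < t) : Gv κ t = mz κ * 2 ^ κ * exp (-(κ * t / 2)) := by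
  have hE : ∀ c t : ℝ, HasDerivAt (fun t => exp (c * t)) (c * exp (c * t)) t := fun c t => by
    have := ((hasDerivAt_id t).const_mul c).exp
    refine this.congr_deriv ?_
    simp; ring
  -- sum
  have hsum : ∀ s, 0 < s → exp (κ / 2 * s) * (Iv κ κ s + Gv κ s) = exp (κ / 2 * t) * (Iv κ κ t + Gv κ t) := by
    intro s hs
    refine const_of_deriv_zero (f := fun s => exp (κ / 2 * s) * (Iv κ κ s + Gv κ s)) (fun x hx => ?_) hs ht
    refine ((hE (κ / 2) x).fun_mul ((Fv_deriv κ hx).fun_add (Gv_deriv hκ hx))).congr_deriv ?_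
    ring
  have hdif : ∀ s, 0 < s → exp (-(κ / 2) * s) * (Iv κ κ s - Gv κ s) = exp (-(κ / 2) * t) * (Iv κ κ t - Gv κ t) := by
    intro s hs
    refine const_of_deriv_zero (f := fun s => exp (-(κ / 2) * s) * (Iv κ κ s - Gv κ s)) (fun x hx => ?_) hs ht
    refine ((hE (-(κ / 2)) x).fun_mul ((Fv_deriv κ hx).fun_sub (Gv_deriv hκ hx))).congr_deriv ?_
    ring
  have hF := tendsto_Iv (κ := κ) (p := κ) hκ.le
  have hG := tendsto_Gv hκ
  have h1 : exp (κ / 2 * t) * (Iv κ κ t + Gv κ t) = mz κ * 2 ^ κ + mz κ * 2 ^ κ := by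
    refine tendsto_nhds_unique (tendsto_const_nhds.congr' ?_) (hF.add hG)
    filter_upwards [Filter.eventually_gt_atTop 0] with s hs
    rw [← hsum s hs, show κ * s / 2 = κ / 2 * s by ring]; ring
  have h2 : exp (-(κ / 2) * t) * (Iv κ κ t - Gv κ t) = 0 := by
    have h0 : Filter.Tendsto (fun s : ℝ => exp (-(κ * s))) Filter.atTop (nhds 0) :=
      Real.tendsto_exp_neg_atTop_nhds_zero.comp (Filter.tendsto_id.const_mul_atTop hκ)
    have h3 := h0.mul (hF.sub hG)
    rw [zero_mul] at h3
    refine tendsto_nhds_unique (tendsto_const_nhds.congr' ?_) h3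
    filter_upwards [Filter.eventually_gt_atTop 0] with s hs
    rw [← hdif s hs]
    have : exp (-(κ / 2) * s) = exp (-(κ * s)) * exp (κ * s / 2) := by rw [← exp_add]; congr 1; ring
    rw [this]; ring
  have h3 : Iv κ κ t = Gv κ t := by
    rcases mul_eq_zero.mp h2 with h | h
    · exact absurd h (exp_pos _).ne'
    · linarith
  rw [h3] at h1
  have h4 : exp (κ / 2 * t) * exp (-(κ * t / 2)) = 1 := by rw [← exp_add, ← exp_zero]; congr 1; ring
  have h5 : exp (κ / 2 * t) * Gv κ t = mz κ * 2 ^ κ := by linarith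
  linear_combination exp (-(κ * t / 2)) * h5 - Gv κ t * h4

end

section

/-- the linear form `w` -/
def wf (S K : ℝ) (x : ℝ × ℝ) : ℝ := cos x.1 * S + cos x.2 * K

lemma wf_cont (S K : ℝ) : Continuous (wf S K) := by unfold wf; fun_prop

lemma wf_abs (S K : ℝ) (x : ℝ × ℝ) : |wf S K x| ≤ |S| + |K| := by
  unfold wf
  refine (abs_add_le _ _).trans ?_
  rw [abs_mul, abs_mul]
  have h1 := abs_cos_le_one x.1
  have h2 := abs_cos_le_one x.2
  nlinarith [abs_nonneg S, abs_nonneg K]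

lemma mom2 (a b S K : ℝ) (n : ℕ) : ∫ x, wf S K x ^ n ∂(nn a b) =
    ∑ m ∈ Finset.HasAntidiagonal.antidiagonal n, (n.choose m.1 : ℝ) * (S ^ m.1 * K ^ m.2) *
      ((∫ ω, cos ω ^ m.1 ∂(nu a)) * ∫ ω, cos ω ^ m.2 ∂(nu b)) := by
  have e : ∀ x, wf S K x ^ n = ∑ m ∈ Finset.HasAntidiagonal.antidiagonal n,
      (n.choose m.1 : ℝ) * (S ^ m.1 * K ^ m.2) * (cos x.1 ^ m.1 * cos x.2 ^ m.2) := by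
    intro x
    unfold wf
    rw [(Commute.all _ _).add_pow']
    apply Finset.sum_congr rfl
    intro m _
    rw [nsmul_eq_mul, mul_pow, mul_pow]; ring
  simp only [e]
  rw [integral_finsetSum]
  · apply Finset.sum_congr rfl
    intro m _
    rw [integral_const_mul]
    congr 1
    exact integral_prod_mul (μ := nu a) (ν := nu b) (fun ω => cos ω ^ m.1) (fun ω => cos ω ^ m.2)
  · intro m _
    apply nn_integrable
    fun_prop

lemma mom2_odd {a b : ℝ} (ha : 0 < a) (hb : 0 < b) (S K : ℝ) (l : ℕ) : ∫ x, wf S K x ^ (2 * l + 1) ∂(nn a b) = 0 := by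
  rw [mom2]
  apply Finset.sum_eq_zero
  intro m hm
  have h := Finset.HasAntidiagonal.mem_antidiagonal.mp hm
  rcases Nat.even_or_odd' m.1 with ⟨i, hi | hi⟩
  · have : m.2 = 2 * (l - i) + 1 := by omega
    rw [this, nu_mom_odd hb]; simp
  · rw [hi, nu_mom_odd ha]; simp

/-- the sums `B_l` -/
def Bs (a b : ℝ) (l : ℕ) (S K : ℝ) : ℝ :=
  ∑ ij ∈ Finset.HasAntidiagonal.antidiagonal l, bco a b ij.1 ij.2 * (S ^ 2) ^ ij.1 * (K ^ 2) ^ ij.2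

lemma mom2_even {a b : ℝ} (ha : 0 < a) (hb : 0 < b) (S K : ℝ) (l : ℕ) : ∫ x, wf S K x ^ (2 * l) ∂(nn a b) =
    mz a * mz b * ((2 * l).factorial / 4 ^ l) * Bs a b l S K := by
  rw [mom2, Bs, Finset.mul_sum]
  symm
  apply Finset.sum_of_injOn (fun ij : ℕ × ℕ => (2 * ij.1, 2 * ij.2))
  · intro x _ y _ h
    simp only [Prod.mk.injEq] at h
    ext <;> omega
  · intro x hx
    have h := Finset.HasAntidiagonal.mem_antidiagonal.mp (Finset.mem_coe.mp hx)
    apply Finset.mem_coe.mpr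
    apply Finset.HasAntidiagonal.mem_antidiagonal.mpr
    simp only; omega
  · intro m hm hm2
    have h := Finset.HasAntidiagonal.mem_antidiagonal.mp hm
    rcases Nat.even_or_odd' m.1 with ⟨i, hi | hi⟩
    · exfalso
      apply hm2
      refine ⟨(i, l - i), ?_, ?_⟩
      · apply Finset.mem_coe.mpr
        apply Finset.HasAntidiagonal.mem_antidiagonal.mpr
        simp only; omega
      · ext <;> simp only <;> omega
    · rw [hi, nu_mom_odd ha]; simp
  · intro ij hij
    have h := Finset.HasAntidiagonal.mem_antidiagonal.mp hij
    simp only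
    rw [nu_mom_even ha, nu_mom_even hb]
    have hch : ((2 * l).choose (2 * ij.1) : ℝ) = (2 * l).factorial / ((2 * ij.1).factorial * (2 * ij.2).factorial) := by
      rw [Nat.cast_choose ℝ (by omega), show 2 * l - 2 * ij.1 = 2 * ij.2 by omega]
    rw [hch]
    have r1 := (rf_pos (x := a + 1) (by linarith) ij.1).ne'
    have r2 := (rf_pos (x := b + 1) (by linarith) ij.2).ne'
    have f1 : ((2 * ij.1).factorial : ℝ) ≠ 0 := by positivity
    have f2 : ((2 * ij.2).factorial : ℝ) ≠ 0 := by positivity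
    have f3 : (ij.1.factorial : ℝ) ≠ 0 := by positivity
    have f4 : (ij.2.factorial : ℝ) ≠ 0 := by positivity
    unfold bco
    rw [← h, pow_add, ← pow_mul, ← pow_mul]
    field_simp

/-- `V(t,S,K)` -/
def Vk (a b t S K : ℝ) : ℝ := sinh (t / 2) * ∫ x, (cosh (t / 2) - wf S K x) ^ (-(a + b + 2)) ∂(nn a b)

/-- `E_l` -/
def El (γ t : ℝ) (l : ℕ) : ℝ := sinh (t / 2) * rf γ (2 * l) * (4 ^ l)⁻¹ * cosh (t / 2) ^ (-γ - (2 * l : ℕ))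

lemma El_nonneg {γ t : ℝ} (hγ : 0 < γ) (ht : 0 < t) (l : ℕ) : 0 ≤ El γ t l := by
  unfold El
  have h1 : 0 < sinh (t / 2) := sinh_pos_iff.mpr (by linarith)
  have h2 := rf_pos hγ (2 * l)
  have h3 : 0 < cosh (t / 2) := cosh_pos _
  positivity

lemma two_inj : Function.Injective (fun l : ℕ => 2 * l) := fun x y h => by
  simp only at h; omega

lemma not_range_two {n : ℕ} (h : n ∉ Set.range (fun l : ℕ => 2 * l)) : ∃ l, n = 2 * l + 1 := by
  rcases Nat.even_or_odd' n with ⟨i, hi | hi⟩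
  · exact absurd ⟨i, hi.symm⟩ h
  · exact ⟨i, hi⟩

lemma Vk_series {a b : ℝ} (ha : 0 < a) (hb : 0 < b) {t S K : ℝ} (ht : 0 < t) (hSK : |S| + |K| ≤ 1) :
    HasSum (fun l => El (a + b + 2) t l * Bs a b l S K) (Vk a b t S K / (mz a * mz b)) := by
  have h := binom_int (μ := nn a b) (p := a + b + 2) (by linarith) (c := cosh (t / 2)) (ρ := |S| + |K|)
    (by have := ch_gt ht; linarith) (w := wf S K) (wf_abs S K) (wf_cont S K).aestronglyMeasurable
  have h2 := (two_inj.hasSum_iff (f := fun n : ℕ => rf (a + b + 2) n / n.factorial * cosh (t / 2) ^ (-(a + b + 2) - n) *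
    ∫ x, wf S K x ^ n ∂(nn a b)) (fun n hn => by
      obtain ⟨l, rfl⟩ := not_range_two hn
      rw [mom2_odd ha hb, mul_zero])).mpr h
  have h3 := h2.mul_left (sinh (t / 2) / (mz a * mz b))
  refine h3.cg (fun l => ?_) ?_
  · simp only [Function.comp]
    rw [mom2_even ha hb]
    have := (mz_pos ha).ne'
    have := (mz_pos hb).ne'
    have : ((2 * l).factorial : ℝ) ≠ 0 := by positivity
    unfold El
    field_simp
  · unfold Vk; ring

lemma Gv_series {κ : ℝ} (hκ : 0 < κ) {t : ℝ} (ht : 0 < t) :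
    HasSum (fun i : ℕ => sinh (t / 2) * rf (κ + 1) (2 * i) * (4 ^ i)⁻¹ * cosh (t / 2) ^ (-(κ + 1) - (2 * i : ℕ)) *
      (1 / (i.factorial * rf (κ + 1) i))) (Gv κ t / mz κ) := by
  have h := binom_int (μ := nu κ) (p := κ + 1) (by linarith) (c := cosh (t / 2)) (ρ := 1)
    (ch_gt ht) (w := cos) abs_cos_le_one continuous_cos.aestronglyMeasurable
  have h2 := (two_inj.hasSum_iff (f := fun n : ℕ => rf (κ + 1) n / n.factorial * cosh (t / 2) ^ (-(κ + 1) - n) *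
    ∫ x, cos x ^ n ∂(nu κ)) (fun n hn => by
      obtain ⟨l, rfl⟩ := not_range_two hn
      rw [nu_mom_odd hκ, mul_zero])).mpr h
  have h3 := h2.mul_left (sinh (t / 2) / mz κ)
  refine h3.cg (fun l => ?_) ?_
  · simp only [Function.comp]
    rw [nu_mom_even hκ]
    have := (mz_pos hκ).ne'
    have : ((2 * l).factorial : ℝ) ≠ 0 := by positivity
    have := (rf_pos (x := κ + 1) (by linarith) l).ne'
    field_simp
  · unfold Gv Iv; ring

lemma El_sum {a b : ℝ} (ha : 0 < a) (hb : 0 < b) {t : ℝ} (ht : 0 < t) (n : ℕ) :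
    HasSum (fun m => El (a + b + 2) t (n + m) * dco a b (n + m) n)
      (rf (a + b + 2) (2 * n) * 2 ^ (a + b + 1) * exp (-t * (n + (a + b + 1) / 2))) := by
  set κ : ℝ := a + b + 1 + 2 * n with hκd
  have hκ : 0 < κ := by positivity
  have h := (Gv_series hκ ht).mul_left (rf (a + b + 2) (2 * n) * (4 ^ n)⁻¹)
  rw [Gv_eq hκ ht] at h
  refine h.cg (fun m => ?_) ?_
  · unfold El dco
    rw [show 2 * (n + m) = 2 * n + 2 * m by ring, rf_add, show n + m - n = m by omega, pow_add,
      show a + b + 2 + ((2 * n : ℕ) : ℝ) = κ + 1 by rw [hκd]; push_cast; ring,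
      show 2 * (n : ℝ) + a + b + 2 = κ + 1 by rw [hκd]; ring,
      show -(a + b + 2) - ((2 * n + 2 * m : ℕ) : ℝ) = -(κ + 1) - (2 * m : ℕ) by rw [hκd]; push_cast; ring]
    rw [mul_inv]; ring
  · have h0 := (mz_pos hκ).ne'
    have h1 : (2:ℝ) ^ κ = 2 ^ (a + b + 1) * 4 ^ n := by
      rw [hκd, Real.rpow_add (by norm_num), Real.rpow_mul (by norm_num), Real.rpow_natCast]; norm_num
    rw [h1, show -(κ * t / 2) = -t * (n + (a + b + 1) / 2) by rw [hκd]; ring]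
    field_simp

open Polynomial in
lemma Bs_eq (a b : ℝ) (l : ℕ) (x y S K : ℝ) (hS : S ^ 2 = x * y) (hK : K ^ 2 = (1 - x) * (1 - y)) :
    Bs a b l S K = (Bg a b l y (1 - y)).eval x := by
  unfold Bs Bg
  rw [eval_finsetSum]
  apply Finset.sum_congr rfl
  intro ij _
  rw [hS, hK]
  simp only [eval_mul, eval_C, eval_pow, eval_X, eval_sub, eval_one, mul_pow]
  ring

open Polynomial in
/-- double-sequence terms -/
def ft (a b t x y : ℝ) (p : ℕ × ℕ) : ℝ :=
  El (a + b + 2) t (p.1 + p.2) * dco a b (p.1 + p.2) p.1 * (cco a b p.1 * ((Jp a b p.1).eval x * (Jp a b p.1).eval y))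

open Polynomial in
lemma ft_fiber {a b : ℝ} (ha : 0 < a) (hb : 0 < b) (t x y S K : ℝ) (l : ℕ) (hS : S ^ 2 = x * y)
    (hK : K ^ 2 = (1 - x) * (1 - y)) :
    ∑ p ∈ Finset.HasAntidiagonal.antidiagonal l, ft a b t x y p = El (a + b + 2) t l * Bs a b l S K := by
  rw [Bs_eq a b l x y S K hS hK, Bg_decomp ha hb, eval_finsetSum, Finset.Nat.sum_antidiagonal_eq_sum_range_succ_mk, Finset.mul_sum]
  apply Finset.sum_congr rfl
  intro n hn
  rw [Finset.mem_range, Nat.lt_succ_iff] at hn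
  unfold ft
  simp only [eval_mul, eval_C]
  rw [show n + (l - n) = l by omega]
  ring

lemma dco_pos {a b : ℝ} (ha : 0 < a) (hb : 0 < b) (k n : ℕ) : 0 < dco a b k n := by
  unfold dco
  have := rf_pos (x := 2 * n + a + b + 2) (by positivity) (k - n)
  positivity

lemma cco_pos {a b : ℝ} (ha : 0 < a) (hb : 0 < b) (n : ℕ) : 0 < cco a b n := by
  unfold cco
  have := rf_pos (x := a + b + 1 + n) (by positivity) n
  have := rf_pos (x := a + 1) (by positivity) n
  have := rf_pos (x := b + 1) (by positivity) n
  positivity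

lemma ft_summable_diag {a b : ℝ} (ha : 0 < a) (hb : 0 < b) {t x : ℝ} (ht : 0 < t) (hx0 : 0 ≤ x) (hx1 : x ≤ 1) :
    Summable (ft a b t x x) := by
  have hnn : ∀ p, 0 ≤ ft a b t x x p := by
    intro p
    unfold ft
    have := El_nonneg (γ := a + b + 2) (by linarith) ht (p.1 + p.2)
    have := dco_pos ha hb (p.1 + p.2) p.1
    have := cco_pos ha hb p.1
    have := mul_self_nonneg ((Jp a b p.1).eval x)
    positivity
  have h := (Vk_series ha hb ht (S := x) (K := 1 - x) (by rw [abs_of_nonneg hx0, abs_of_nonneg (by linarith)]; linarith)).summable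
  rw [← Finset.HasAntidiagonal.sigmaAntidiagonalEquivProd.summable_iff]
  rw [summable_sigma_of_nonneg]
  · refine ⟨fun l => (Set.toFinite _).summable _ |>.congr (fun _ => rfl), ?_⟩
    refine h.congr (fun l => ?_)
    rw [tsum_fintype, ← ft_fiber ha hb t x x x (1 - x) l (by ring) (by ring)]
    rw [← Finset.sum_attach]
    rfl
  · intro p; exact hnn _

theorem main_series {a b : ℝ} (ha : 0 < a) (hb : 0 < b) {t x y S K : ℝ} (ht : 0 < t) (hx0 : 0 ≤ x) (hx1 : x ≤ 1)
    (hy0 : 0 ≤ y) (hy1 : y ≤ 1) (hS : S ^ 2 = x * y) (hK : K ^ 2 = (1 - x) * (1 - y)) (hSK : |S| + |K| ≤ 1) :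
    HasSum (fun n => rf (a + b + 2) (2 * n) * 2 ^ (a + b + 1) * exp (-t * (n + (a + b + 1) / 2)) *
      (cco a b n * ((Jp a b n).eval x * (Jp a b n).eval y))) (Vk a b t S K / (mz a * mz b)) := by
  have hs : Summable (ft a b t x y) := by
    refine Summable.of_norm_bounded (g := fun p => (ft a b t x x p + ft a b t y y p) / 2)
      (((ft_summable_diag ha hb ht hx0 hx1).add (ft_summable_diag ha hb ht hy0 hy1)).div_const 2) (fun p => ?_)
    unfold ft
    have h1 := El_nonneg (γ := a + b + 2) (by linarith) ht (p.1 + p.2)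
    have h2 := dco_pos ha hb (p.1 + p.2) p.1
    have h3 := cco_pos ha hb p.1
    have h4 : 0 ≤ El (a + b + 2) t (p.1 + p.2) * dco a b (p.1 + p.2) p.1 * cco a b p.1 := by positivity
    set A := (Jp a b p.1).eval x
    set B := (Jp a b p.1).eval y
    rw [← mul_assoc, norm_mul, Real.norm_of_nonneg h4, Real.norm_eq_abs, abs_mul]
    have h5 : |A| * |B| ≤ (A * A + B * B) / 2 := by
      nlinarith [sq_nonneg (|A| - |B|), abs_mul_abs_self A, abs_mul_abs_self B]
    calc _ ≤ El (a + b + 2) t (p.1 + p.2) * dco a b (p.1 + p.2) p.1 * cco a b p.1 * ((A * A + B * B) / 2) :=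
          mul_le_mul_of_nonneg_left h5 h4
      _ = _ := by ring
  have hV := Vk_series ha hb ht hSK
  have h1 : HasSum (ft a b t x y) (Vk a b t S K / (mz a * mz b)) := by
    have h2 := (Finset.HasAntidiagonal.sigmaAntidiagonalEquivProd.hasSum_iff (f := ft a b t x y)).mpr hs.hasSum
    have h3 := h2.sigma (fun l => hasSum_fintype _)
    have h4 : HasSum (fun l => El (a + b + 2) t l * Bs a b l S K) (∑' p, ft a b t x y p) := by
      refine h3.cg (fun l => ?_) rfl
      rw [← ft_fiber ha hb t x y S K l hS hK, ← Finset.sum_attach]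
      rfl
    rw [hV.unique h4]
    exact hs.hasSum
  have h5 := h1.prod_fiberwise (fun n => (El_sum ha hb ht n).mul_right (cco a b n * ((Jp a b n).eval x * (Jp a b n).eval y)))
  exact h5

end

section

lemma half_mem {θ : ℝ} (h : θ ∈ Icc 0 π) : 0 ≤ sin (θ / 2) ∧ 0 ≤ cos (θ / 2) := by
  constructor
  · exact sin_nonneg_of_nonneg_of_le_pi (by linarith [h.1]) (by linarith [h.2, pi_pos])
  · exact cos_nonneg_of_mem_Icc ⟨by linarith [h.1, pi_pos], by linarith [h.2]⟩

lemma halfang_pos {θ : ℝ} (h : θ ∈ Ioo 0 π) : 0 < sin (θ / 2) ∧ 0 < cos (θ / 2) := by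
  constructor
  · exact sin_pos_of_pos_of_lt_pi (by linarith [h.1]) (by linarith [h.2, pi_pos])
  · exact cos_pos_of_mem_Ioo ⟨by linarith [h.1, pi_pos], by linarith [h.2]⟩

/-- the weight -/
def Ww (a b θ : ℝ) : ℝ := sin (θ / 2) ^ (2 * a + 1) * cos (θ / 2) ^ (2 * b + 1)

lemma jPsi_sq (a b : ℝ) {θ : ℝ} (h : θ ∈ Ioo 0 π) : jPsi a b θ ^ 2 = Ww a b θ := by
  obtain ⟨h1, h2⟩ := halfang_pos h
  unfold jPsi Ww
  rw [abs_of_pos h1, mul_pow, ← Real.rpow_natCast, ← Real.rpow_natCast, ← Real.rpow_mul h1.le, ← Real.rpow_mul h2.le]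
  congr 2 <;> (push_cast; ring)

lemma jPsi_meas (a b : ℝ) : Measurable (fun θ => ENNReal.ofReal (jPsi a b θ ^ 2)) := by
  unfold jPsi
  fun_prop

lemma jplus_eq (a b : ℝ) : jacobiMeasurePlus a b =
    (volume.restrict (Ioo 0 π)).withDensity (fun θ => ENNReal.ofReal (jPsi a b θ ^ 2)) := by
  unfold jacobiMeasurePlus jacobiMeasure
  rw [restrict_withDensity measurableSet_Ioo, Measure.restrict_restrict measurableSet_Ioo]
  congr 2
  apply inter_eq_left.mpr
  exact Ioo_subset_Ioo (by linarith [pi_pos]) le_rfl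

lemma jplus_int (a b : ℝ) (f : ℝ → ℝ) : ∫ θ, f θ ∂(jacobiMeasurePlus a b) = ∫ θ in 0..π, Ww a b θ * f θ := by
  rw [jplus_eq, integral_withDensity_eq_integral_toReal_smul (jPsi_meas a b) (Filter.Eventually.of_forall (fun _ => ENNReal.ofReal_lt_top)),
    intervalIntegral.integral_of_le pi_pos.le, integral_Ioc_eq_integral_Ioo]
  apply setIntegral_congr_fun measurableSet_Ioo
  intro θ hθ
  simp only [smul_eq_mul]
  rw [ENNReal.toReal_ofReal (sq_nonneg _), jPsi_sq a b hθ]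

open Polynomial in
/-- integration of a polynomial in `sin^2(θ/2)` -/
def ip (a b : ℝ) (f : ℝ[X]) : ℝ := ∫ θ in 0..π, Ww a b θ * f.eval (sin (θ / 2) ^ 2)

lemma Ww_cont {a b : ℝ} (ha : 0 < a) (hb : 0 < b) : Continuous (Ww a b) := by
  unfold Ww
  have c1 : Continuous (fun θ : ℝ => sin (θ / 2) ^ (2 * a + 1)) :=
    (by fun_prop : Continuous (fun θ : ℝ => sin (θ / 2))).rpow_const (fun _ => Or.inr (by positivity))
  have c2 : Continuous (fun θ : ℝ => cos (θ / 2) ^ (2 * b + 1)) :=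
    (by fun_prop : Continuous (fun θ : ℝ => cos (θ / 2))).rpow_const (fun _ => Or.inr (by positivity))
  exact c1.mul c2

open Polynomial in
lemma ip_cont {a b : ℝ} (ha : 0 < a) (hb : 0 < b) (f : ℝ[X]) :
    Continuous (fun θ => Ww a b θ * f.eval (sin (θ / 2) ^ 2)) := by
  have := Ww_cont ha hb
  have := f.continuous
  exact (Ww_cont ha hb).mul (f.continuous.comp (by fun_prop))

open Polynomial in
lemma ip_add {a b : ℝ} (ha : 0 < a) (hb : 0 < b) (f g : ℝ[X]) : ip a b (f + g) = ip a b f + ip a b g := by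
  unfold ip
  rw [← intervalIntegral.integral_add ((ip_cont ha hb f).intervalIntegrable _ _) ((ip_cont ha hb g).intervalIntegrable _ _)]
  congr 1; ext θ; rw [eval_add]; ring

open Polynomial in
lemma ip_C_mul (a b c : ℝ) (f : ℝ[X]) : ip a b (C c * f) = c * ip a b f := by
  unfold ip
  rw [← intervalIntegral.integral_const_mul]
  congr 1; ext θ; rw [eval_mul, eval_C]; ring

open Polynomial in
lemma ip_byparts {a b : ℝ} (ha : 0 < a) (hb : 0 < b) (g : ℝ[X]) :
    ip a b ((C (a + 1) * (1 - X) - C (b + 1) * X) * g + X * (1 - X) * derivative g) = 0 := by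
  have h := intervalIntegral.integral_eq_sub_of_hasDerivAt (a := 0) (b := π)
    (f := fun θ => (sin (θ / 2) ^ (2 * a + 2) * cos (θ / 2) ^ (2 * b + 2)) * g.eval (sin (θ / 2) ^ 2))
    (f' := fun θ => ((a + 1) * sin (θ / 2) ^ (2 * a + 1) * cos (θ / 2) * cos (θ / 2) ^ (2 * b + 2) -
      sin (θ / 2) ^ (2 * a + 2) * ((b + 1) * cos (θ / 2) ^ (2 * b + 1) * sin (θ / 2))) * g.eval (sin (θ / 2) ^ 2) +
      (sin (θ / 2) ^ (2 * a + 2) * cos (θ / 2) ^ (2 * b + 2)) * ((derivative g).eval (sin (θ / 2) ^ 2) * (sin (θ / 2) * cos (θ / 2)))) ?_ ?_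
  · simp only [sin_zero, zero_div, cos_pi_div_two] at h
    rw [Real.zero_rpow (by linarith), Real.zero_rpow (by linarith)] at h
    simp only [zero_mul, mul_zero, sub_zero] at h
    refine Eq.trans ?_ h
    apply intervalIntegral.integral_congr
    intro θ hθ
    rw [uIcc_of_le pi_pos.le] at hθ
    obtain ⟨h1, h2⟩ := half_mem hθ
    simp only [Ww, eval_add, eval_mul, eval_sub, eval_C, eval_X, eval_one]
    have p1 : sin (θ / 2) ^ (2 * a + 2) = sin (θ / 2) ^ (2 * a + 1) * sin (θ / 2) := by
      rw [← Real.rpow_add_one' h1 (by linarith)]; congr 1; ring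
    have p2 : cos (θ / 2) ^ (2 * b + 2) = cos (θ / 2) ^ (2 * b + 1) * cos (θ / 2) := by
      rw [← Real.rpow_add_one' h2 (by linarith)]; congr 1; ring
    rw [p1, p2]
    have hc : 1 - sin (θ / 2) ^ 2 = cos (θ / 2) ^ 2 := by rw [cos_sq']
    rw [hc]
    ring
  · intro θ _
    have hsin : HasDerivAt (fun θ : ℝ => sin (θ / 2)) (cos (θ / 2) / 2) θ := by
      refine (((hasDerivAt_id θ).div_const 2).sin).congr_deriv ?_
      simp; ring
    have hcos : HasDerivAt (fun θ : ℝ => cos (θ / 2)) (-sin (θ / 2) / 2) θ := by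
      refine (((hasDerivAt_id θ).div_const 2).cos).congr_deriv ?_
      simp; ring
    have h1 := hsin.rpow_const (p := 2 * a + 2) (Or.inr (by linarith))
    have h2 := hcos.rpow_const (p := 2 * b + 2) (Or.inr (by linarith))
    have h3 := (g.hasDerivAt (sin (θ / 2) ^ 2)).comp θ (hsin.fun_pow 2)
    refine ((h1.fun_mul h2).fun_mul h3).congr_deriv ?_
    rw [show 2 * a + 2 - 1 = 2 * a + 1 by ring, show 2 * b + 2 - 1 = 2 * b + 1 by ring]
    simp
    ring
  · apply Continuous.intervalIntegrable
    have c0 : Continuous (fun θ : ℝ => sin (θ / 2)) := by fun_prop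
    have d0 : Continuous (fun θ : ℝ => cos (θ / 2)) := by fun_prop
    have c1 : Continuous (fun θ : ℝ => sin (θ / 2) ^ (2 * a + 1)) := c0.rpow_const (fun _ => Or.inr (by positivity))
    have c2 : Continuous (fun θ : ℝ => cos (θ / 2) ^ (2 * b + 1)) := d0.rpow_const (fun _ => Or.inr (by positivity))
    have c3 : Continuous (fun θ : ℝ => sin (θ / 2) ^ (2 * a + 2)) := c0.rpow_const (fun _ => Or.inr (by positivity))
    have c4 : Continuous (fun θ : ℝ => cos (θ / 2) ^ (2 * b + 2)) := d0.rpow_const (fun _ => Or.inr (by positivity))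
    have c5 : Continuous (fun θ : ℝ => g.eval (sin (θ / 2) ^ 2)) := g.continuous.comp (by fun_prop)
    have c6 : Continuous (fun θ : ℝ => (derivative g).eval (sin (θ / 2) ^ 2)) := (derivative g).continuous.comp (by fun_prop)
    fun_prop

open Polynomial in
lemma ip_shift {a b : ℝ} (ha : 0 < a) (hb : 0 < b) (f : ℝ[X]) : ip (a + 1) (b + 1) f = ip a b (X * (1 - X) * f) := by
  unfold ip
  apply intervalIntegral.integral_congr
  intro θ hθ
  rw [uIcc_of_le pi_pos.le] at hθ
  obtain ⟨h1, h2⟩ := half_mem hθ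
  simp only [Ww, eval_mul, eval_sub, eval_X, eval_one]
  rw [show 2 * (a + 1) + 1 = (2 * a + 1) + 1 + 1 by ring, Real.rpow_add_one' h1 (by linarith), Real.rpow_add_one' h1 (by linarith),
      show 2 * (b + 1) + 1 = (2 * b + 1) + 1 + 1 by ring, Real.rpow_add_one' h2 (by linarith), Real.rpow_add_one' h2 (by linarith)]
  have hc : 1 - sin (θ / 2) ^ 2 = cos (θ / 2) ^ 2 := by rw [cos_sq']
  rw [hc]
  ring

open Polynomial in
lemma ip_norm_rec {a b : ℝ} (ha : 0 < a) (hb : 0 < b) (n : ℕ) :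
    (n + 1) * ip a b (Jp a b (n + 1) ^ 2) = (n + a + b + 2) * ip (a + 1) (b + 1) (Jp (a + 1) (b + 1) n ^ 2) := by
  have h := ip_byparts ha hb (Jp a b (n + 1) * derivative (Jp a b (n + 1)))
  have e : (C (a + 1) * (1 - X) - C (b + 1) * X) * (Jp a b (n + 1) * derivative (Jp a b (n + 1))) +
      X * (1 - X) * derivative (Jp a b (n + 1) * derivative (Jp a b (n + 1))) =
      C (-(((n + 1 : ℕ) : ℝ) * ((n + 1 : ℕ) + a + b + 1))) * Jp a b (n + 1) ^ 2 +
      C (((n : ℝ) + 1 + a + b + 1) ^ 2) * (X * (1 - X) * Jp (a + 1) (b + 1) n ^ 2) := by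
    have h1 := Jp_eigen ha hb (n + 1)
    have h2 := Jp_deriv ha hb n
    rw [derivative_mul]
    have h3 : (C (a + 1) * (1 - X) - C (b + 1) * X) * (Jp a b (n + 1) * derivative (Jp a b (n + 1))) +
      X * (1 - X) * (derivative (Jp a b (n + 1)) * derivative (Jp a b (n + 1)) + Jp a b (n + 1) * derivative (derivative (Jp a b (n + 1))))
      = Jp a b (n + 1) * LL a b (Jp a b (n + 1)) + X * (1 - X) * (derivative (Jp a b (n + 1))) ^ 2 := by
      unfold LL; ring
    rw [h3, h1, h2, C_neg, mul_pow, C_pow, C_neg]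
    ring
  rw [e, ip_add ha hb, ip_C_mul, ip_C_mul, ← ip_shift ha hb] at h
  have hp : (n : ℝ) + a + b + 2 ≠ 0 := by positivity
  apply mul_left_cancel₀ hp
  push_cast at h
  linear_combination -h

open Polynomial in
lemma ip_zero_rec {a b : ℝ} (ha : 0 < a) (hb : 0 < b) :
    (a + b + 2) * (a + b + 3) * ip (a + 1) (b + 1) 1 = (a + 1) * (b + 1) * ip a b 1 := by
  rw [ip_shift ha hb]
  have h1 := ip_byparts ha hb 1
  have h2 := ip_byparts ha hb X
  have e1 : (C (a + 1) * (1 - X) - C (b + 1) * X) * 1 + X * (1 - X) * derivative (1 : ℝ[X]) =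
    C (a + 1) * 1 + C (-(a + b + 2)) * X := by
    simp only [derivative_one, C_add, C_neg, C_1, show (C 2 : ℝ[X]) = 2 from rfl]; ring
  have e2 : (C (a + 1) * (1 - X) - C (b + 1) * X) * X + X * (1 - X) * derivative (X : ℝ[X]) =
    C (a + b + 3) * (X * (1 - X) * 1) + C (-(b + 1)) * X := by
    simp only [derivative_X, C_add, C_neg, C_1, show (C 3 : ℝ[X]) = 3 from rfl]; ring
  rw [e1, ip_add ha hb, ip_C_mul, ip_C_mul] at h1
  rw [e2, ip_add ha hb, ip_C_mul, ip_C_mul] at h2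
  linear_combination (a + b + 2) * h2 - (b + 1) * h1

open Polynomial in
lemma Jp_zero {a b : ℝ} (ha : 0 < a) (hb : 0 < b) : Jp a b 0 = 1 := by
  simp [Jp, jco_zero ha hb, rf_zero]

open Polynomial in
lemma ip_norm (n : ℕ) : ∀ {a b : ℝ} (_ : 0 < a) (_ : 0 < b),
    ip a b (Jp a b n ^ 2) * (rf (a + b + 2) (2 * n) * cco a b n) = ip a b 1 := by
  induction n with
  | zero => intro a b ha hb; rw [Jp_zero ha hb]; simp [rf_zero, cco]
  | succ n ih =>
    intro a b ha hb
    have h1 := ih (a := a + 1) (b := b + 1) (by linarith) (by linarith)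
    have h2 := ip_norm_rec ha hb n
    have h3 := ip_zero_rec ha hb
    have r1 : rf (a + b + 2) (2 * (n + 1)) = (a + b + 2) * (a + b + 3) * rf (a + b + 4) (2 * n) := by
      rw [show 2 * (n + 1) = 2 * n + 1 + 1 by ring, rf_succ', rf_succ', show a + b + 2 + 1 = a + b + 3 by ring, show a + b + 3 + 1 = a + b + 4 by ring]; ring
    have c1 : cco a b (n + 1) * ((a + 1) * (b + 1) * (n + a + b + 2)) = (n + 1) * cco (a + 1) (b + 1) n := by
      unfold cco
      rw [rf_succ' (a + 1), rf_succ' (b + 1), rf_succ', Nat.factorial_succ]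
      have g1 := (rf_pos (x := a + 1 + 1) (by positivity) n).ne'
      have g2 := (rf_pos (x := b + 1 + 1) (by positivity) n).ne'
      have g3 := (rf_pos (x := n + a + b + 2 + 1) (by positivity) n).ne'
      have e1 : a + b + 1 + ((n + 1 : ℕ) : ℝ) = n + a + b + 2 := by push_cast; ring
      have e2 : a + 1 + (b + 1) + 1 + (n : ℝ) = n + a + b + 2 + 1 := by ring
      have g4 : (n : ℝ) + a + b + 2 ≠ 0 := by positivity
      rw [e1, e2]
      push_cast
      field_simp
    rw [show a + 1 + (b + 1) + 2 = a + b + 4 by ring] at h1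
    have q1 : (n : ℝ) + a + b + 2 ≠ 0 := by positivity
    have q2 : (n : ℝ) + 1 ≠ 0 := by positivity
    have q3 : (a + 1) * (b + 1) ≠ 0 := by positivity
    have e3 : ip a b (Jp a b (n + 1) ^ 2) = (n + a + b + 2) * ip (a + 1) (b + 1) (Jp (a + 1) (b + 1) n ^ 2) / (n + 1) := by
      rw [eq_div_iff q2, ← h2]; ring
    have e4 : cco a b (n + 1) = (n + 1) * cco (a + 1) (b + 1) n / ((a + 1) * (b + 1) * (n + a + b + 2)) := by
      rw [eq_div_iff (mul_ne_zero q3 q1), ← c1]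
    apply mul_left_cancel₀ q3
    rw [← h3, ← h1, r1, e3, e4]
    field_simp

open Polynomial in
lemma ip_one_pos {a b : ℝ} (ha : 0 < a) (hb : 0 < b) : 0 < ip a b 1 := by
  unfold ip
  apply intervalIntegral.intervalIntegral_pos_of_pos_on
  · exact (ip_cont ha hb 1).intervalIntegrable _ _
  · intro θ hθ
    obtain ⟨h1, h2⟩ := halfang_pos hθ
    simp only [eval_one, mul_one, Ww]
    positivity
  · exact pi_pos

lemma half_cos (θ : ℝ) : (1 - cos θ) / 2 = sin (θ / 2) ^ 2 := by
  have := cos_two_mul (θ / 2)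
  rw [show 2 * (θ / 2) = θ by ring] at this
  rw [this, cos_sq']; ring

lemma cJ_sq {a b : ℝ} (ha : 0 < a) (hb : 0 < b) (n : ℕ) :
    cJ a b n * cJ a b n = rf (a + b + 2) (2 * n) * cco a b n / ip a b 1 := by
  have e : ∫ θ, jacobiP a b n (Real.cos θ) ^ 2 ∂(jacobiMeasurePlus a b) = ip a b (Jp a b n ^ 2) := by
    rw [jplus_int, ip]
    congr 1; ext θ
    rw [Jp_eval, half_cos, Polynomial.eval_pow]
  have h := ip_norm n ha hb
  have h0 := ip_one_pos ha hb
  have hp : 0 < rf (a + b + 2) (2 * n) * cco a b n := mul_pos (rf_pos (by linarith) _) (cco_pos ha hb n)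
  have h1 : 0 < ip a b (Jp a b n ^ 2) := by
    by_contra hc
    push Not at hc
    have := mul_nonpos_of_nonpos_of_nonneg hc hp.le
    linarith
  unfold cJ
  rw [e, ← Real.rpow_add h1, show -(1 / 2 : ℝ) + -(1 / 2) = -1 by norm_num, Real.rpow_neg_one, eq_div_iff h0.ne', ← h]
  field_simp

lemma sqrt_jLam {α β : ℝ} (hα : -1 < α) (hβ : -1 < β) (n : ℕ) :
    Real.sqrt (jLam α β (n + 1)) = n + ((α + 1) + (β + 1) + 1) / 2 := by
  unfold jLam
  rw [Real.sqrt_sq]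
  · push_cast; ring
  · push_cast; have : (0:ℝ) ≤ n := n.cast_nonneg
    linarith

lemma SK_le (θ φ : ℝ) : |sin (θ / 2) * sin (φ / 2)| + |cos (θ / 2) * cos (φ / 2)| ≤ 1 := by
  rw [abs_mul, abs_mul]
  have h1 := sin_sq_add_cos_sq (θ / 2)
  have h2 := sin_sq_add_cos_sq (φ / 2)
  rw [← sq_abs (sin _), ← sq_abs (cos _)] at h1 h2
  nlinarith [sq_nonneg (|sin (θ / 2)| - |sin (φ / 2)|), sq_nonneg (|cos (θ / 2)| - |cos (φ / 2)|)]

/-- the constant -/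
def c0 (a b : ℝ) : ℝ := 1 / (8 * ip a b 1 * mz a * mz b * 2 ^ (a + b + 1))

theorem jHtil_eq {α β : ℝ} (hα : -1 < α) (hβ : -1 < β) {t : ℝ} (ht : 0 < t) (θ φ : ℝ) :
    jHtil α β t θ φ = c0 (α + 1) (β + 1) * (sin θ * sin φ *
      Vk (α + 1) (β + 1) t (sin (θ / 2) * sin (φ / 2)) (cos (θ / 2) * cos (φ / 2))) := by
  have ha : 0 < α + 1 := by linarith
  have hb : 0 < β + 1 := by linarith
  set a := α + 1 with had
  set b := β + 1 with hbd
  have h := main_series ha hb (t := t) (x := sin (θ / 2) ^ 2) (y := sin (φ / 2) ^ 2)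
    (S := sin (θ / 2) * sin (φ / 2)) (K := cos (θ / 2) * cos (φ / 2)) ht (sq_nonneg _) (sin_sq_le_one _) (sq_nonneg _) (sin_sq_le_one _)
    (by ring) (by rw [← cos_sq', ← cos_sq']; ring) (SK_le θ φ)
  have h2 := h.mul_left (1 / (ip a b 1 * 2 ^ (a + b + 1)))
  have h3 : HasSum (fun n : ℕ => Real.exp (-t * Real.sqrt (jLam α β (n + 1))) * trigP a b n θ * trigP a b n φ)
      (1 / (ip a b 1 * 2 ^ (a + b + 1)) * (Vk a b t (sin (θ / 2) * sin (φ / 2)) (cos (θ / 2) * cos (φ / 2)) / (mz a * mz b))) := by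
    refine h2.cg (fun n => ?_) rfl
    rw [sqrt_jLam hα hβ, ← had, ← hbd]
    unfold trigP
    rw [Jp_eval, Jp_eval, half_cos, half_cos]
    have hc := cJ_sq ha hb n
    have h0 := (ip_one_pos ha hb).ne'
    have hpow : (2:ℝ) ^ (a + b + 1) ≠ 0 := by positivity
    rw [eq_div_iff h0] at hc
    field_simp
    linear_combination (Polynomial.eval (sin (θ / 2) ^ 2) (Jp a b n) * Polynomial.eval (sin (φ / 2) ^ 2) (Jp a b n)) * hc
  unfold jHtil
  rw [← had, ← hbd, h3.tsum_eq]
  unfold c0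
  field_simp

end

section

/-- `t`-derivatives of `sh^i ch^j (ch - w)^(-γ-l)` -/
def Gd (γ : ℝ) : ℕ → ℕ → ℕ → ℕ → ℝ → ℝ → ℝ
  | 0, i, j, l, t, w => sinh (t / 2) ^ i * cosh (t / 2) ^ j * (cosh (t / 2) - w) ^ (-γ - l)
  | k + 1, i, j, l, t, w => (i : ℝ) / 2 * Gd γ k (i - 1) (j + 1) l t w +
      (j : ℝ) / 2 * Gd γ k (i + 1) (j - 1) l t w - (γ + l) / 2 * Gd γ k (i + 1) j (l + 1) t w

lemma Gd_dt (γ : ℝ) (k : ℕ) : ∀ (i j l : ℕ) {t w : ℝ} (_ : 0 < cosh (t / 2) - w),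
    HasDerivAt (fun t => Gd γ k i j l t w) (Gd γ (k + 1) i j l t w) t := by
  induction k with
  | zero =>
    intro i j l t w h
    have h1 := (hasDerivAt_sh t).fun_pow i
    have h2 := (hasDerivAt_ch t).fun_pow j
    have h3 := ((hasDerivAt_ch t).sub_const w).rpow_const (p := -γ - l) (Or.inl h.ne')
    refine ((h1.fun_mul h2).fun_mul h3).congr_deriv ?_
    simp only [Gd]
    rw [show -γ - ((l + 1 : ℕ) : ℝ) = -γ - l - 1 by push_cast; ring]
    ring
  | succ k ih =>
    intro i j l t w h
    exact (((ih (i - 1) (j + 1) l h).const_mul _).fun_add ((ih (i + 1) (j - 1) l h).const_mul _)).fun_sub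
      ((ih (i + 1) j (l + 1) h).const_mul _)

lemma Gd_dw (γ : ℝ) (k : ℕ) : ∀ (i j l : ℕ) {t w : ℝ} (_ : 0 < cosh (t / 2) - w),
    HasDerivAt (fun w => Gd γ k i j l t w) ((γ + l) * Gd γ k i j (l + 1) t w) w := by
  induction k with
  | zero =>
    intro i j l t w h
    have h3 := ((hasDerivAt_id w).const_sub (cosh (t / 2))).rpow_const (p := -γ - l) (Or.inl h.ne')
    refine (h3.const_mul (sinh (t / 2) ^ i * cosh (t / 2) ^ j)).congr_deriv ?_
    simp only [Gd, id]
    rw [show -γ - ((l + 1 : ℕ) : ℝ) = -γ - l - 1 by push_cast; ring]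
    ring
  | succ k ih =>
    intro i j l t w h
    refine ((((ih (i - 1) (j + 1) l h).const_mul _).fun_add ((ih (i + 1) (j - 1) l h).const_mul _)).fun_sub
      ((ih (i + 1) j (l + 1) h).const_mul _)).congr_deriv ?_
    simp only [Gd]
    push_cast
    ring

lemma Gd_cont (γ : ℝ) (k : ℕ) : ∀ (i j l : ℕ),
    ContinuousOn (fun p : ℝ × ℝ => Gd γ k i j l p.1 p.2) {p | 0 < cosh (p.1 / 2) - p.2} := by
  induction k with
  | zero =>
    intro i j l
    simp only [Gd]
    apply ContinuousOn.mul (by fun_prop)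
    apply ContinuousOn.rpow_const (by fun_prop)
    intro p hp; left; exact (ne_of_gt hp)
  | succ k ih =>
    intro i j l
    simp only [Gd]
    exact ((continuousOn_const.mul (ih _ _ _)).add (continuousOn_const.mul (ih _ _ _))).sub (continuousOn_const.mul (ih _ _ _))

lemma Gd_bound_small {γ : ℝ} (k : ℕ) : ∀ (i j l : ℕ), ∃ C : ℝ, 0 ≤ C ∧ ∀ t w : ℝ, 0 < t → t ≤ 2 → |w| ≤ 1 →
    |Gd γ k i j l t w| ≤ C * (cosh (t / 2) - w) ^ (-γ - l + ((i : ℝ) - k) / 2) := by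
  have hD : ∀ t w : ℝ, 0 < t → |w| ≤ 1 → 0 < cosh (t / 2) - w := by
    intro t w ht hw
    have := ch_gt ht; have := (abs_le.mp hw).2; linarith
  have hch : ∀ t : ℝ, 0 < t → t ≤ 2 → cosh (t / 2) ≤ cosh 1 := by
    intro t h0 h2
    rw [cosh_le_cosh, abs_of_pos (by linarith), abs_of_pos (by norm_num)]; linarith
  induction k with
  | zero =>
    intro i j l
    refine ⟨(cosh 1 + 1) ^ ((i : ℝ) / 2) * cosh 1 ^ j, by have := cosh_pos 1; positivity, ?_⟩
    intro t w h0 h2 hw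
    have hDp := hD t w h0 hw
    have hsh : 0 < sinh (t / 2) := sinh_pos_iff.mpr (by linarith)
    have hcp : 0 < cosh (t / 2) := cosh_pos _
    have hc1 := ch_gt h0
    have hcle := hch t h0 h2
    simp only [Gd]
    rw [abs_of_pos (by positivity)]
    have e1 : sinh (t / 2) ^ i ≤ (cosh 1 + 1) ^ ((i : ℝ) / 2) * (cosh (t / 2) - w) ^ ((i : ℝ) / 2) := by
      rw [← Real.mul_rpow (by linarith) hDp.le]
      have : sinh (t / 2) ^ i = (sinh (t / 2) ^ 2) ^ ((i : ℝ) / 2) := by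
        rw [← Real.rpow_natCast (sinh (t / 2)) 2, ← Real.rpow_mul hsh.le, ← Real.rpow_natCast]; congr 1; push_cast; ring
      rw [this]
      apply Real.rpow_le_rpow (by positivity) _ (by positivity)
      have h3 : sinh (t / 2) ^ 2 = (cosh (t / 2) + 1) * (cosh (t / 2) - 1) := by
        have := cosh_sq (t / 2); linarith [sq_nonneg (cosh (t/2)), this, (by ring : (cosh (t / 2) + 1) * (cosh (t / 2) - 1) = cosh (t / 2) ^ 2 - 1)]
      rw [h3]
      have := (abs_le.mp hw).2
      exact mul_le_mul (by linarith) (by linarith) (by linarith) (by linarith)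
    have e2 : cosh (t / 2) ^ j ≤ cosh 1 ^ j := pow_le_pow_left₀ hcp.le hcle j
    have e3 : (cosh (t / 2) - w) ^ (-γ - l + ((i : ℝ) - (0 : ℕ)) / 2) = (cosh (t / 2) - w) ^ ((i : ℝ) / 2) * (cosh (t / 2) - w) ^ (-γ - l) := by
      rw [← Real.rpow_add hDp]; congr 1; push_cast; ring
    rw [e3]
    calc sinh (t / 2) ^ i * cosh (t / 2) ^ j * (cosh (t / 2) - w) ^ (-γ - l)
        ≤ ((cosh 1 + 1) ^ ((i : ℝ) / 2) * (cosh (t / 2) - w) ^ ((i : ℝ) / 2)) * cosh 1 ^ j * (cosh (t / 2) - w) ^ (-γ - l) := by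
          gcongr
      _ = _ := by ring
  | succ k ih =>
    intro i j l
    obtain ⟨C1, hC1, h1⟩ := ih (i - 1) (j + 1) l
    obtain ⟨C2, hC2, h2⟩ := ih (i + 1) (j - 1) l
    obtain ⟨C3, hC3, h3⟩ := ih (i + 1) j (l + 1)
    refine ⟨(i : ℝ) / 2 * C1 + (j : ℝ) / 2 * (C2 * (cosh 1 + 1)) + |(γ + l) / 2| * C3, by have := cosh_pos 1; positivity, ?_⟩
    intro t w ht0 ht2 hw
    have hDp := hD t w ht0 hw
    have hDle : cosh (t / 2) - w ≤ cosh 1 + 1 := by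
      have := hch t ht0 ht2; have := (abs_le.mp hw).1; linarith
    set D := cosh (t / 2) - w with hDdef
    set E := D ^ (-γ - l + ((i : ℝ) - (k + 1 : ℕ)) / 2) with hE
    have hEp : 0 < E := Real.rpow_pos_of_pos hDp _
    have t1 : |(i : ℝ) / 2 * Gd γ k (i - 1) (j + 1) l t w| ≤ (i : ℝ) / 2 * C1 * E := by
      rcases Nat.eq_zero_or_pos i with hi | hi
      · subst hi; simp
      · rw [abs_mul, abs_of_nonneg (by positivity), mul_assoc]
        apply mul_le_mul_of_nonneg_left _ (by positivity)
        refine (h1 t w ht0 ht2 hw).trans (le_of_eq ?_)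
        congr 2
        rw [Nat.cast_sub hi]; push_cast; ring
    have t2 : |(j : ℝ) / 2 * Gd γ k (i + 1) (j - 1) l t w| ≤ (j : ℝ) / 2 * (C2 * (cosh 1 + 1)) * E := by
      rw [abs_mul, abs_of_nonneg (by positivity), mul_assoc]
      apply mul_le_mul_of_nonneg_left _ (by positivity)
      refine (h2 t w ht0 ht2 hw).trans ?_
      rw [mul_assoc]
      apply mul_le_mul_of_nonneg_left _ hC2
      have : D ^ (-γ - l + (((i + 1 : ℕ) : ℝ) - k) / 2) = D * E := by
        rw [hE, mul_comm, ← Real.rpow_add_one hDp.ne']; congr 1; push_cast; ring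
      rw [← hDdef, this]
      exact mul_le_mul_of_nonneg_right hDle hEp.le
    have t3 : |(γ + l) / 2 * Gd γ k (i + 1) j (l + 1) t w| ≤ |(γ + l) / 2| * C3 * E := by
      rw [abs_mul, mul_assoc]
      apply mul_le_mul_of_nonneg_left _ (abs_nonneg _)
      refine (h3 t w ht0 ht2 hw).trans (le_of_eq ?_)
      congr 2
      push_cast; ring
    simp only [Gd]
    calc _ ≤ |(i : ℝ) / 2 * Gd γ k (i - 1) (j + 1) l t w + (j : ℝ) / 2 * Gd γ k (i + 1) (j - 1) l t w| +
          |(γ + l) / 2 * Gd γ k (i + 1) j (l + 1) t w| := abs_sub _ _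
      _ ≤ |(i : ℝ) / 2 * Gd γ k (i - 1) (j + 1) l t w| + |(j : ℝ) / 2 * Gd γ k (i + 1) (j - 1) l t w| +
          |(γ + l) / 2 * Gd γ k (i + 1) j (l + 1) t w| := by gcongr; exact abs_add_le _ _
      _ ≤ _ := by linarith

lemma ch_sub_one_ge {t : ℝ} (ht : 2 ≤ t) : exp (t / 2) / 8 ≤ cosh (t / 2) - 1 := by
  have h1 : (8:ℝ) / 3 ≤ exp (t / 2) := by
    have : exp 1 ≤ exp (t / 2) := exp_le_exp.mpr (by linarith)
    have := exp_one_gt_d9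
    linarith
  rw [cosh_eq]
  have := exp_pos (-(t / 2))
  linarith

lemma Gd_bound_large {γ : ℝ} (hγ : 0 < γ) (k : ℕ) : ∀ (i j l : ℕ), ∃ C : ℝ, 0 ≤ C ∧ ∀ t w : ℝ, 2 ≤ t → |w| ≤ 1 →
    |Gd γ k i j l t w| ≤ C * exp (t / 2 * (i + j - γ - l)) := by
  induction k with
  | zero =>
    intro i j l
    refine ⟨(1 / 8 : ℝ) ^ (-γ - l), by positivity, ?_⟩
    intro t w ht hw
    have hDge : exp (t / 2) / 8 ≤ cosh (t / 2) - w := by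
      have := ch_sub_one_ge ht; have := (abs_le.mp hw).2; linarith
    have hDp : 0 < cosh (t / 2) - w := lt_of_lt_of_le (by positivity) hDge
    have hsh : 0 < sinh (t / 2) := sinh_pos_iff.mpr (by linarith)
    have hcp : 0 < cosh (t / 2) := cosh_pos _
    have hex : exp (-(t / 2)) ≤ exp (t / 2) := exp_le_exp.mpr (by linarith)
    have s1 : sinh (t / 2) ≤ exp (t / 2) := by
      rw [sinh_eq]; have := exp_pos (-(t / 2)); have := exp_pos (t / 2); linarith
    have s2 : cosh (t / 2) ≤ exp (t / 2) := by rw [cosh_eq]; linarith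
    simp only [Gd]
    rw [abs_of_pos (by positivity)]
    have e3 : (cosh (t / 2) - w) ^ (-γ - l) ≤ (exp (t / 2) * (1 / 8)) ^ (-γ - l) := by
      apply Real.rpow_le_rpow_of_nonpos (by positivity) (by linarith)
      have : (0:ℝ) ≤ l := l.cast_nonneg
      linarith
    rw [Real.mul_rpow (exp_pos _).le (by norm_num), ← Real.exp_mul] at e3
    have e4 : exp (t / 2 * (i + j - γ - l)) = exp (t / 2) ^ i * exp (t / 2) ^ j * exp (t / 2 * (-γ - l)) := by
      rw [← Real.exp_nat_mul, ← Real.exp_nat_mul, ← exp_add, ← exp_add]; congr 1; ring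
    rw [e4]
    calc sinh (t / 2) ^ i * cosh (t / 2) ^ j * (cosh (t / 2) - w) ^ (-γ - l)
        ≤ exp (t / 2) ^ i * exp (t / 2) ^ j * (exp (t / 2 * (-γ - l)) * (1 / 8) ^ (-γ - l)) := by
          gcongr
      _ = _ := by ring
  | succ k ih =>
    intro i j l
    obtain ⟨C1, hC1, h1⟩ := ih (i - 1) (j + 1) l
    obtain ⟨C2, hC2, h2⟩ := ih (i + 1) (j - 1) l
    obtain ⟨C3, hC3, h3⟩ := ih (i + 1) j (l + 1)
    refine ⟨(i : ℝ) / 2 * C1 + (j : ℝ) / 2 * C2 + |(γ + l) / 2| * C3, by positivity, ?_⟩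
    intro t w ht hw
    set E := exp (t / 2 * (i + j - γ - l)) with hE
    have t1 : |(i : ℝ) / 2 * Gd γ k (i - 1) (j + 1) l t w| ≤ (i : ℝ) / 2 * C1 * E := by
      rcases Nat.eq_zero_or_pos i with hi | hi
      · subst hi; simp
      · rw [abs_mul, abs_of_nonneg (by positivity), mul_assoc]
        apply mul_le_mul_of_nonneg_left _ (by positivity)
        refine (h1 t w ht hw).trans (le_of_eq ?_)
        congr 3
        rw [Nat.cast_sub hi]; push_cast; ring
    have t2 : |(j : ℝ) / 2 * Gd γ k (i + 1) (j - 1) l t w| ≤ (j : ℝ) / 2 * C2 * E := by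
      rcases Nat.eq_zero_or_pos j with hi | hi
      · subst hi; simp
      · rw [abs_mul, abs_of_nonneg (by positivity), mul_assoc]
        apply mul_le_mul_of_nonneg_left _ (by positivity)
        refine (h2 t w ht hw).trans (le_of_eq ?_)
        congr 3
        rw [Nat.cast_sub hi]; push_cast; ring
    have t3 : |(γ + l) / 2 * Gd γ k (i + 1) j (l + 1) t w| ≤ |(γ + l) / 2| * C3 * E := by
      rw [abs_mul, mul_assoc]
      apply mul_le_mul_of_nonneg_left _ (abs_nonneg _)
      refine (h3 t w ht hw).trans (le_of_eq ?_)
      congr 3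
      push_cast; ring
    simp only [Gd]
    calc _ ≤ |(i : ℝ) / 2 * Gd γ k (i - 1) (j + 1) l t w + (j : ℝ) / 2 * Gd γ k (i + 1) (j - 1) l t w| +
          |(γ + l) / 2 * Gd γ k (i + 1) j (l + 1) t w| := abs_sub _ _
      _ ≤ |(i : ℝ) / 2 * Gd γ k (i - 1) (j + 1) l t w| + |(j : ℝ) / 2 * Gd γ k (i + 1) (j - 1) l t w| +
          |(γ + l) / 2 * Gd γ k (i + 1) j (l + 1) t w| := by gcongr; exact abs_add_le _ _
      _ ≤ _ := by linarith

lemma Gd_pde (γ : ℝ) (k : ℕ) : ∀ {t w : ℝ} (_ : 0 < t) (_ : |w| ≤ 1),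
    Gd γ (k + 2) 1 0 0 t w - ((γ - 1) / 2) ^ 2 * Gd γ k 1 0 0 t w =
      -(1 / 4) * ((1 - w ^ 2) * (γ * (γ + 1) * Gd γ k 1 0 2 t w) - (2 * γ - 1) * w * (γ * Gd γ k 1 0 1 t w)) := by
  have hD : ∀ t w : ℝ, 0 < t → |w| ≤ 1 → 0 < cosh (t / 2) - w := by
    intro t w ht hw
    have := ch_gt ht; have := (abs_le.mp hw).2; linarith
  induction k with
  | zero =>
    intro t w ht hw
    have h := hD t w ht hw
    simp only [Gd]
    norm_num
    have e1 : (cosh (t / 2) - w) ^ (-γ - 1) = (cosh (t / 2) - w) ^ (-γ - 2) * (cosh (t / 2) - w) := by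
      rw [← Real.rpow_add_one h.ne']; congr 1; ring
    have e0 : (cosh (t / 2) - w) ^ (-γ) = (cosh (t / 2) - w) ^ (-γ - 2) * (cosh (t / 2) - w) * (cosh (t / 2) - w) := by
      rw [← Real.rpow_add_one h.ne', ← Real.rpow_add_one h.ne']; congr 1; ring
    rw [e0, e1]
    have hsh : sinh (t / 2) ^ 2 = cosh (t / 2) ^ 2 - 1 := by rw [cosh_sq]; ring
    linear_combination ((γ + γ ^ 2) / 4 * sinh (t / 2) * (cosh (t / 2) - w) ^ (-γ - 2)) * hsh
  | succ k ih =>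
    intro t w ht hw
    have h := hD t w ht hw
    have h1 := (Gd_dt γ (k + 2) 1 0 0 h).fun_sub ((Gd_dt γ k 1 0 0 h).const_mul (((γ - 1) / 2) ^ 2))
    have h2 := ((((Gd_dt γ k 1 0 2 h).const_mul (γ * (γ + 1))).const_mul (1 - w ^ 2)).fun_sub
      (((Gd_dt γ k 1 0 1 h).const_mul γ).const_mul ((2 * γ - 1) * w))).const_mul (-(1 / 4))
    refine (h1.congr_of_eventuallyEq ?_).unique h2
    filter_upwards [lt_mem_nhds ht] with s hs
    exact (ih hs hw).symm

end

section

def ww (θ φ : ℝ) (x : ℝ × ℝ) : ℝ := wf (sin (θ / 2) * sin (φ / 2)) (cos (θ / 2) * cos (φ / 2)) x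
def wT (θ φ : ℝ) (x : ℝ × ℝ) : ℝ :=
  1 / 2 * (cos x.1 * (cos (θ / 2) * sin (φ / 2)) - cos x.2 * (sin (θ / 2) * cos (φ / 2)))
def wP (θ φ : ℝ) (x : ℝ × ℝ) : ℝ :=
  1 / 2 * (cos x.1 * (sin (θ / 2) * cos (φ / 2)) - cos x.2 * (cos (θ / 2) * sin (φ / 2)))
def wTP (θ φ : ℝ) (x : ℝ × ℝ) : ℝ :=
  1 / 4 * (cos x.1 * (cos (θ / 2) * cos (φ / 2)) + cos x.2 * (sin (θ / 2) * sin (φ / 2)))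

lemma ww_abs (θ φ : ℝ) (x : ℝ × ℝ) : |ww θ φ x| ≤ 1 := (wf_abs _ _ x).trans (SK_le θ φ)

lemma ww_D {t : ℝ} (ht : 0 < t) (θ φ : ℝ) (x : ℝ × ℝ) : 0 < cosh (t / 2) - ww θ φ x := by
  have := ch_gt ht; have := (abs_le.mp (ww_abs θ φ x)).2; linarith

lemma hd_sin2 (t : ℝ) : HasDerivAt (fun t => sin (t / 2)) (cos (t / 2) / 2) t := by
  refine (((hasDerivAt_id t).div_const 2).sin).congr_deriv ?_
  simp only [id]; ring

lemma hd_cos2 (t : ℝ) : HasDerivAt (fun t => cos (t / 2)) (-sin (t / 2) / 2) t := by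
  refine (((hasDerivAt_id t).div_const 2).cos).congr_deriv ?_
  simp only [id]; ring

lemma ww_dT (θ φ : ℝ) (x : ℝ × ℝ) : HasDerivAt (fun θ => ww θ φ x) (wT θ φ x) θ := by
  refine ((((hd_sin2 θ).mul_const (sin (φ / 2))).const_mul (cos x.1)).fun_add
    (((hd_cos2 θ).mul_const (cos (φ / 2))).const_mul (cos x.2))).congr_deriv ?_
  unfold wT; ring

lemma ww_dP (θ φ : ℝ) (x : ℝ × ℝ) : HasDerivAt (fun φ => ww θ φ x) (wP θ φ x) φ := by
  refine ((((hd_sin2 φ).const_mul (sin (θ / 2))).const_mul (cos x.1)).fun_add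
    (((hd_cos2 φ).const_mul (cos (θ / 2))).const_mul (cos x.2))).congr_deriv ?_
  unfold wP; ring

lemma wT_dT (θ φ : ℝ) (x : ℝ × ℝ) : HasDerivAt (fun θ => wT θ φ x) (-(1 / 4) * ww θ φ x) θ := by
  refine (((((hd_cos2 θ).mul_const (sin (φ / 2))).const_mul (cos x.1)).fun_sub
    (((hd_sin2 θ).mul_const (cos (φ / 2))).const_mul (cos x.2))).const_mul (1 / 2)).congr_deriv ?_
  unfold ww wf; ring

lemma wT_dP (θ φ : ℝ) (x : ℝ × ℝ) : HasDerivAt (fun φ => wT θ φ x) (wTP θ φ x) φ := by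
  refine (((((hd_sin2 φ).const_mul (cos (θ / 2))).const_mul (cos x.1)).fun_sub
    (((hd_cos2 φ).const_mul (sin (θ / 2))).const_mul (cos x.2))).const_mul (1 / 2)).congr_deriv ?_
  unfold wTP; ring

lemma Gw_cont (γ : ℝ) (k l : ℕ) :
    ContinuousOn (fun p : (ℝ × ℝ × ℝ) × (ℝ × ℝ) => Gd γ k 1 0 l p.1.1 (ww p.1.2.1 p.1.2.2 p.2)) {p | 0 < p.1.1} := by
  have h := (Gd_cont γ k 1 0 l).comp (f := fun p : (ℝ × ℝ × ℝ) × (ℝ × ℝ) => (p.1.1, ww p.1.2.1 p.1.2.2 p.2))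
    (s := {p | 0 < p.1.1}) (by unfold ww wf; fun_prop) (fun p hp => ww_D hp _ _ _)
  exact h

lemma Gw_c1 (γ : ℝ) (k l : ℕ) {t : ℝ} (ht : 0 < t) (θ φ : ℝ) : Continuous (fun x => Gd γ k 1 0 l t (ww θ φ x)) := by
  have := (Gw_cont γ k l).comp (f := fun x : ℝ × ℝ => ((t, θ, φ), x)) (s := univ) (by fun_prop) (fun x _ => ht)
  exact continuousOn_univ.mp this

lemma Gw_ct (γ : ℝ) (k l : ℕ) (θ φ : ℝ) :
    ContinuousOn (fun p : ℝ × (ℝ × ℝ) => Gd γ k 1 0 l p.1 (ww θ φ p.2)) (Ioi 0 ×ˢ univ) :=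
  (Gw_cont γ k l).comp (f := fun p : ℝ × (ℝ × ℝ) => ((p.1, θ, φ), p.2)) (by fun_prop) (fun p hp => hp.1)

lemma Gw_cT (γ : ℝ) (k l : ℕ) {t : ℝ} (ht : 0 < t) (φ : ℝ) :
    ContinuousOn (fun p : ℝ × (ℝ × ℝ) => Gd γ k 1 0 l t (ww p.1 φ p.2)) (univ ×ˢ univ) :=
  (Gw_cont γ k l).comp (f := fun p : ℝ × (ℝ × ℝ) => ((t, p.1, φ), p.2)) (by fun_prop) (fun p _ => ht)

lemma Gw_cP (γ : ℝ) (k l : ℕ) {t : ℝ} (ht : 0 < t) (θ : ℝ) :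
    ContinuousOn (fun p : ℝ × (ℝ × ℝ) => Gd γ k 1 0 l t (ww θ p.1 p.2)) (univ ×ˢ univ) :=
  (Gw_cont γ k l).comp (f := fun p : ℝ × (ℝ × ℝ) => ((t, θ, p.1), p.2)) (by fun_prop) (fun p _ => ht)

def Jf (a b : ℝ) (k : ℕ) (t θ φ : ℝ) : ℝ := ∫ x, Gd (a + b + 2) k 1 0 0 t (ww θ φ x) ∂(nn a b)
def JT (a b : ℝ) (k : ℕ) (t θ φ : ℝ) : ℝ :=
  ∫ x, wT θ φ x * ((a + b + 2) * Gd (a + b + 2) k 1 0 1 t (ww θ φ x)) ∂(nn a b)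
def JP (a b : ℝ) (k : ℕ) (t θ φ : ℝ) : ℝ :=
  ∫ x, wP θ φ x * ((a + b + 2) * Gd (a + b + 2) k 1 0 1 t (ww θ φ x)) ∂(nn a b)
def JTP (a b : ℝ) (k : ℕ) (t θ φ : ℝ) : ℝ :=
  ∫ x, (wTP θ φ x * ((a + b + 2) * Gd (a + b + 2) k 1 0 1 t (ww θ φ x)) +
    wT θ φ x * ((a + b + 2) * ((a + b + 3) * Gd (a + b + 2) k 1 0 2 t (ww θ φ x) * wP θ φ x))) ∂(nn a b)
def JTT (a b : ℝ) (k : ℕ) (t θ φ : ℝ) : ℝ :=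
  ∫ x, (-(1 / 4) * ww θ φ x * ((a + b + 2) * Gd (a + b + 2) k 1 0 1 t (ww θ φ x)) +
    wT θ φ x * ((a + b + 2) * ((a + b + 3) * Gd (a + b + 2) k 1 0 2 t (ww θ φ x) * wT θ φ x))) ∂(nn a b)

lemma Jf_zero (a b : ℝ) (t θ φ : ℝ) : Jf a b 0 t θ φ =
    Vk a b t (sin (θ / 2) * sin (φ / 2)) (cos (θ / 2) * cos (φ / 2)) := by
  unfold Jf Vk
  rw [← integral_const_mul]
  refine integral_congr_ae (ae_of_all _ (fun x => ?_))
  simp only [Gd, ww]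
  norm_num

lemma wT_c (θ φ : ℝ) : Continuous (wT θ φ) := by unfold wT; fun_prop

lemma Jf_dt (a b : ℝ) (k : ℕ) {t : ℝ} (ht : 0 < t) (θ φ : ℝ) :
    HasDerivAt (fun t => Jf a b k t θ φ) (Jf a b (k + 1) t θ φ) t :=
  nn_deriv_under a b isOpen_Ioi (fun _ hs => Gw_c1 _ k 0 hs θ φ) (fun _ hs x => Gd_dt _ k 1 0 0 (ww_D hs θ φ x))
    (Gw_ct _ (k + 1) 0 θ φ) ht

lemma JT_dt (a b : ℝ) (k : ℕ) {t : ℝ} (ht : 0 < t) (θ φ : ℝ) :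
    HasDerivAt (fun t => JT a b k t θ φ) (JT a b (k + 1) t θ φ) t :=
  nn_deriv_under a b isOpen_Ioi (fun _ hs => (wT_c θ φ).mul (continuous_const.mul (Gw_c1 _ k 1 hs θ φ)))
    (fun _ hs x => ((Gd_dt _ k 1 0 1 (ww_D hs θ φ x)).const_mul _).const_mul _)
    (((wT_c θ φ).comp continuous_snd).continuousOn.mul (continuousOn_const.mul (Gw_ct _ (k + 1) 1 θ φ))) ht

lemma JP_dt (a b : ℝ) (k : ℕ) {t : ℝ} (ht : 0 < t) (θ φ : ℝ) :
    HasDerivAt (fun t => JP a b k t θ φ) (JP a b (k + 1) t θ φ) t := by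
  have hc : Continuous (wP θ φ) := by unfold wP; fun_prop
  exact nn_deriv_under a b isOpen_Ioi (fun _ hs => hc.mul (continuous_const.mul (Gw_c1 _ k 1 hs θ φ)))
    (fun _ hs x => ((Gd_dt _ k 1 0 1 (ww_D hs θ φ x)).const_mul _).const_mul _)
    ((hc.comp continuous_snd).continuousOn.mul (continuousOn_const.mul (Gw_ct _ (k + 1) 1 θ φ))) ht

lemma Jf_dT (a b : ℝ) (k : ℕ) {t : ℝ} (ht : 0 < t) (θ φ : ℝ) :
    HasDerivAt (fun θ => Jf a b k t θ φ) (JT a b k t θ φ) θ := by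
  refine nn_deriv_under a b isOpen_univ
    (f := fun θ x => Gd (a + b + 2) k 1 0 0 t (ww θ φ x))
    (f' := fun θ x => wT θ φ x * ((a + b + 2) * Gd (a + b + 2) k 1 0 1 t (ww θ φ x))) (fun θ _ => Gw_c1 _ k 0 ht θ φ) (fun θ _ x => ?_) ?_ (mem_univ θ)
  · refine ((Gd_dw _ k 1 0 0 (ww_D ht θ φ x)).comp θ (ww_dT θ φ x)).congr_deriv ?_
    push_cast; ring_nf
  · exact ContinuousOn.mul (by unfold wT; fun_prop) (continuousOn_const.mul (Gw_cT _ k 1 ht φ))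

lemma Jf_dP (a b : ℝ) (k : ℕ) {t : ℝ} (ht : 0 < t) (θ φ : ℝ) :
    HasDerivAt (fun φ => Jf a b k t θ φ) (JP a b k t θ φ) φ := by
  refine nn_deriv_under a b isOpen_univ
    (f := fun φ x => Gd (a + b + 2) k 1 0 0 t (ww θ φ x))
    (f' := fun φ x => wP θ φ x * ((a + b + 2) * Gd (a + b + 2) k 1 0 1 t (ww θ φ x))) (fun φ _ => Gw_c1 _ k 0 ht θ φ) (fun φ _ x => ?_) ?_ (mem_univ φ)
  · refine ((Gd_dw _ k 1 0 0 (ww_D ht θ φ x)).comp φ (ww_dP θ φ x)).congr_deriv ?_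
    push_cast; ring_nf
  · exact ContinuousOn.mul (by unfold wP; fun_prop) (continuousOn_const.mul (Gw_cP _ k 1 ht θ))

lemma JT_dP (a b : ℝ) (k : ℕ) {t : ℝ} (ht : 0 < t) (θ φ : ℝ) :
    HasDerivAt (fun φ => JT a b k t θ φ) (JTP a b k t θ φ) φ := by
  refine nn_deriv_under a b isOpen_univ
    (f := fun φ x => wT θ φ x * ((a + b + 2) * Gd (a + b + 2) k 1 0 1 t (ww θ φ x)))
    (f' := fun φ x => wTP θ φ x * ((a + b + 2) * Gd (a + b + 2) k 1 0 1 t (ww θ φ x)) +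
    wT θ φ x * ((a + b + 2) * ((a + b + 3) * Gd (a + b + 2) k 1 0 2 t (ww θ φ x) * wP θ φ x)))
    (fun φ _ => (wT_c θ φ).mul (continuous_const.mul (Gw_c1 _ k 1 ht θ φ))) (fun φ _ x => ?_) ?_ (mem_univ φ)
  · have h := (Gd_dw (a + b + 2) k 1 0 1 (ww_D ht θ φ x)).comp φ (ww_dP θ φ x)
    refine ((wT_dP θ φ x).fun_mul (h.const_mul (a + b + 2))).congr_deriv ?_
    simp only [Function.comp]
    push_cast
    ring_nf
  · refine ContinuousOn.add ?_ ?_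
    · exact ContinuousOn.mul (by unfold wTP; fun_prop) (continuousOn_const.mul (Gw_cP _ k 1 ht θ))
    · exact ContinuousOn.mul (by unfold wT; fun_prop) (continuousOn_const.mul
        ((continuousOn_const.mul (Gw_cP _ k 2 ht θ)).mul (by unfold wP; fun_prop)))

lemma JT_dT (a b : ℝ) (k : ℕ) {t : ℝ} (ht : 0 < t) (θ φ : ℝ) :
    HasDerivAt (fun θ => JT a b k t θ φ) (JTT a b k t θ φ) θ := by
  refine nn_deriv_under a b isOpen_univ
    (f := fun θ x => wT θ φ x * ((a + b + 2) * Gd (a + b + 2) k 1 0 1 t (ww θ φ x)))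
    (f' := fun θ x => -(1 / 4) * ww θ φ x * ((a + b + 2) * Gd (a + b + 2) k 1 0 1 t (ww θ φ x)) +
    wT θ φ x * ((a + b + 2) * ((a + b + 3) * Gd (a + b + 2) k 1 0 2 t (ww θ φ x) * wT θ φ x)))
    (fun θ _ => (wT_c θ φ).mul (continuous_const.mul (Gw_c1 _ k 1 ht θ φ))) (fun θ _ x => ?_) ?_ (mem_univ θ)
  · have h := (Gd_dw (a + b + 2) k 1 0 1 (ww_D ht θ φ x)).comp θ (ww_dT θ φ x)
    refine ((wT_dT θ φ x).fun_mul (h.const_mul (a + b + 2))).congr_deriv ?_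
    simp only [Function.comp]
    push_cast
    ring_nf
  · refine ContinuousOn.add ?_ ?_
    · exact ContinuousOn.mul (by unfold ww wf; fun_prop) (continuousOn_const.mul (Gw_cT _ k 1 ht φ))
    · exact ContinuousOn.mul (by unfold wT; fun_prop) (continuousOn_const.mul
        ((continuousOn_const.mul (Gw_cT _ k 2 ht φ)).mul (by unfold wT; fun_prop)))

/-- integration by parts in the first variable -/
lemma bp1 {a : ℝ} (b : ℝ) (ha : 0 < a) (k : ℕ) {t : ℝ} (ht : 0 < t) (θ φ : ℝ) :
    (2 * a + 1) * ∫ x, cos x.1 * Gd (a + b + 2) k 1 0 1 t (ww θ φ x) ∂(nn a b) =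
      (a + b + 3) * (sin (θ / 2) * sin (φ / 2)) *
        ∫ x, (1 - cos x.1 ^ 2) * Gd (a + b + 2) k 1 0 2 t (ww θ φ x) ∂(nn a b) := by
  have g1 := Gw_c1 (a + b + 2) k 1 ht θ φ
  have g2 := Gw_c1 (a + b + 2) k 2 ht θ φ
  have key : ∫ x, ((2 * a + 1) * (cos x.1 * Gd (a + b + 2) k 1 0 1 t (ww θ φ x)) +
      sin x.1 * ((a + b + 3) * Gd (a + b + 2) k 1 0 2 t (ww θ φ x) * (-sin x.1 * (sin (θ / 2) * sin (φ / 2))))) ∂(nn a b) = 0 := by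
    unfold nn
    rw [integral_prod_symm _ (nn_integrable a b (by fun_prop))]
    rw [integral_eq_zero_of_ae]
    refine ae_of_all _ (fun η => ?_)
    refine nu_byparts ha (F := fun ω => Gd (a + b + 2) k 1 0 1 t (ww θ φ (ω, η))) (fun ω => ?_) ?_
    · have h1 : HasDerivAt (fun ω => ww θ φ (ω, η)) (-sin ω * (sin (θ / 2) * sin (φ / 2))) ω :=
        by simp only [ww, wf]; exact ((hasDerivAt_cos ω).mul_const _).add_const _
      refine ((Gd_dw (a + b + 2) k 1 0 1 (ww_D ht θ φ (ω, η))).comp ω h1).congr_deriv ?_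
      push_cast; ring_nf
    · have : Continuous (fun ω => Gd (a + b + 2) k 1 0 2 t (ww θ φ (ω, η))) := g2.comp (by fun_prop)
      fun_prop
  rw [integral_add (nn_integrable a b (by fun_prop)) (nn_integrable a b (by fun_prop)), integral_const_mul] at key
  have e : ∫ x, sin x.1 * ((a + b + 3) * Gd (a + b + 2) k 1 0 2 t (ww θ φ x) * (-sin x.1 * (sin (θ / 2) * sin (φ / 2)))) ∂(nn a b)
      = -((a + b + 3) * (sin (θ / 2) * sin (φ / 2)) *
        ∫ x, (1 - cos x.1 ^ 2) * Gd (a + b + 2) k 1 0 2 t (ww θ φ x) ∂(nn a b)) := by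
    rw [← integral_const_mul, ← integral_neg]
    refine integral_congr_ae (ae_of_all _ (fun x => ?_))
    simp only
    rw [← sin_sq]; ring
  rw [e] at key
  linarith

lemma bp2 (a : ℝ) {b : ℝ} (hb : 0 < b) (k : ℕ) {t : ℝ} (ht : 0 < t) (θ φ : ℝ) :
    (2 * b + 1) * ∫ x, cos x.2 * Gd (a + b + 2) k 1 0 1 t (ww θ φ x) ∂(nn a b) =
      (a + b + 3) * (cos (θ / 2) * cos (φ / 2)) *
        ∫ x, (1 - cos x.2 ^ 2) * Gd (a + b + 2) k 1 0 2 t (ww θ φ x) ∂(nn a b) := by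
  have g1 := Gw_c1 (a + b + 2) k 1 ht θ φ
  have g2 := Gw_c1 (a + b + 2) k 2 ht θ φ
  have key : ∫ x, ((2 * b + 1) * (cos x.2 * Gd (a + b + 2) k 1 0 1 t (ww θ φ x)) +
      sin x.2 * ((a + b + 3) * Gd (a + b + 2) k 1 0 2 t (ww θ φ x) * (-sin x.2 * (cos (θ / 2) * cos (φ / 2))))) ∂(nn a b) = 0 := by
    unfold nn
    rw [integral_prod _ (nn_integrable a b (by fun_prop))]
    rw [integral_eq_zero_of_ae]
    refine ae_of_all _ (fun η => ?_)
    refine nu_byparts hb (F := fun ω => Gd (a + b + 2) k 1 0 1 t (ww θ φ (η, ω))) (fun ω => ?_) ?_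
    · have h1 : HasDerivAt (fun ω => ww θ φ (η, ω)) (-sin ω * (cos (θ / 2) * cos (φ / 2))) ω :=
        by simp only [ww, wf]; exact ((hasDerivAt_cos ω).mul_const _).const_add _
      refine ((Gd_dw (a + b + 2) k 1 0 1 (ww_D ht θ φ (η, ω))).comp ω h1).congr_deriv ?_
      push_cast; ring_nf
    · have : Continuous (fun ω => Gd (a + b + 2) k 1 0 2 t (ww θ φ (η, ω))) := g2.comp (by fun_prop)
      fun_prop
  rw [integral_add (nn_integrable a b (by fun_prop)) (nn_integrable a b (by fun_prop)), integral_const_mul] at key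
  have e : ∫ x, sin x.2 * ((a + b + 3) * Gd (a + b + 2) k 1 0 2 t (ww θ φ x) * (-sin x.2 * (cos (θ / 2) * cos (φ / 2)))) ∂(nn a b)
      = -((a + b + 3) * (cos (θ / 2) * cos (φ / 2)) *
        ∫ x, (1 - cos x.2 ^ 2) * Gd (a + b + 2) k 1 0 2 t (ww θ φ x) ∂(nn a b)) := by
    rw [← integral_const_mul, ← integral_neg]
    refine integral_congr_ae (ae_of_all _ (fun x => ?_))
    simp only
    rw [← sin_sq]; ring
  rw [e] at key
  linarith

lemma lin2 (a b : ℝ) {f g : ℝ × ℝ → ℝ} (hf : Continuous f) (hg : Continuous g) (c d : ℝ) :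
    ∫ x, (c * f x + d * g x) ∂(nn a b) = c * ∫ x, f x ∂(nn a b) + d * ∫ x, g x ∂(nn a b) := by
  rw [integral_add (nn_integrable a b (by fun_prop)) (nn_integrable a b (by fun_prop)), integral_const_mul, integral_const_mul]

lemma J_pde {a b : ℝ} (ha : 0 < a) (hb : 0 < b) (k : ℕ) {t : ℝ} (ht : 0 < t) {θ : ℝ} (hθ : θ ∈ Ioo 0 π) (φ : ℝ) :
    JTT a b k t θ φ + ((a + 1 / 2) * (cos (θ / 2) / sin (θ / 2)) - (b + 1 / 2) * (sin (θ / 2) / cos (θ / 2))) * JT a b k t θ φ =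
      ((a + b + 1) / 2) ^ 2 * Jf a b k t θ φ - Jf a b (k + 2) t θ φ := by
  obtain ⟨hs, hc⟩ := halfang_pos hθ
  have g0 := Gw_c1 (a + b + 2) k 0 ht θ φ
  have g02 := Gw_c1 (a + b + 2) (k + 2) 0 ht θ φ
  have g1 := Gw_c1 (a + b + 2) k 1 ht θ φ
  have g2 := Gw_c1 (a + b + 2) k 2 ht θ φ
  have hw : Continuous (ww θ φ) := wf_cont _ _
  have hwT := wT_c θ φ
  have b1 := bp1 b ha k ht θ φ
  have b2 := bp2 a hb k ht θ φ
  set γ := a + b + 2 with hγ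
  set U := ∫ x, cos x.1 * Gd γ k 1 0 1 t (ww θ φ x) ∂(nn a b) with hU
  set V := ∫ x, cos x.2 * Gd γ k 1 0 1 t (ww θ φ x) ∂(nn a b) with hV
  set UU := ∫ x, (1 - cos x.1 ^ 2) * Gd γ k 1 0 2 t (ww θ φ x) ∂(nn a b) with hUU
  set VV := ∫ x, (1 - cos x.2 ^ 2) * Gd γ k 1 0 2 t (ww θ φ x) ∂(nn a b) with hVV
  have eT : JT a b k t θ φ = (γ / 2 * (cos (θ / 2) * sin (φ / 2))) * U + (-(γ / 2 * (sin (θ / 2) * cos (φ / 2)))) * V := by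
    rw [hU, hV, ← lin2 a b (by fun_prop) (by fun_prop)]
    unfold JT
    refine integral_congr_ae (ae_of_all _ (fun x => ?_))
    simp only [wT]; ring
  have e3 : (γ * (γ + 1) * sin (φ / 2) ^ 2) * UU + (γ * (γ + 1) * cos (φ / 2) ^ 2) * VV =
      ∫ x, γ * (γ + 1) * ((1 - cos x.1 ^ 2 * sin (φ / 2) ^ 2 - cos x.2 ^ 2 * cos (φ / 2) ^ 2) * Gd γ k 1 0 2 t (ww θ φ x)) ∂(nn a b) := by
    rw [hUU, hVV, ← lin2 a b (by fun_prop) (by fun_prop)]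
    refine integral_congr_ae (ae_of_all _ (fun x => ?_))
    simp only
    linear_combination (γ * (γ + 1) * Gd γ k 1 0 2 t (ww θ φ x)) * (sin_sq_add_cos_sq (φ / 2))
  have e4 : (γ * (sin (θ / 2) * sin (φ / 2))) * U + (γ * (cos (θ / 2) * cos (φ / 2))) * V =
      ∫ x, γ * (ww θ φ x * Gd γ k 1 0 1 t (ww θ φ x)) ∂(nn a b) := by
    rw [hU, hV, ← lin2 a b (by fun_prop) (by fun_prop)]
    refine integral_congr_ae (ae_of_all _ (fun x => ?_))
    simp only [ww, wf]; ring
  have e5 : JTT a b k t θ φ + (1 * Jf a b (k + 2) t θ φ + (-((a + b + 1) / 2) ^ 2) * Jf a b k t θ φ) =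
      (-(1 / 4)) * ((γ * (γ + 1) * sin (φ / 2) ^ 2) * UU + (γ * (γ + 1) * cos (φ / 2) ^ 2) * VV) +
      ((γ - 1) / 2) * ((γ * (sin (θ / 2) * sin (φ / 2))) * U + (γ * (cos (θ / 2) * cos (φ / 2))) * V) := by
    rw [e3, e4, ← lin2 a b (by fun_prop) (by fun_prop)]
    unfold JTT Jf
    rw [← hγ, ← lin2 a b (by fun_prop) (by fun_prop), ← integral_add (nn_integrable a b (by fun_prop)) (nn_integrable a b (by fun_prop))]
    refine integral_congr_ae (ae_of_all _ (fun x => ?_))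
    simp only
    have hp := Gd_pde γ k ht (ww_abs θ φ x)
    have h4 : 4 * wT θ φ x ^ 2 = cos x.1 ^ 2 * sin (φ / 2) ^ 2 + cos x.2 ^ 2 * cos (φ / 2) ^ 2 - ww θ φ x ^ 2 := by
      unfold wT ww wf
      linear_combination (cos x.1 ^ 2 * sin (φ / 2) ^ 2 + cos x.2 ^ 2 * cos (φ / 2) ^ 2) * (sin_sq_add_cos_sq (θ / 2))
    have h5 : a + b + 1 = γ - 1 := by rw [hγ]; ring
    have h6 : a + b + 3 = γ + 1 := by rw [hγ]; ring
    rw [h5, h6]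
    linear_combination hp + (γ * (γ + 1) * Gd γ k 1 0 2 t (ww θ φ x) / 4) * h4
  have hsc := sin_sq_add_cos_sq (θ / 2)
  have h6 : a + b + 3 = γ + 1 := by rw [hγ]; ring
  rw [h6] at b1 b2
  set s := sin (θ / 2)
  set c := cos (θ / 2)
  set σ := sin (φ / 2)
  set χ := cos (φ / 2)
  have e6 : ((a + 1 / 2) * (c / s) - (b + 1 / 2) * (s / c)) * JT a b k t θ φ =
      γ / 4 * (c ^ 2 * σ / s * ((2 * a + 1) * U) - c * χ * ((2 * a + 1) * V) - s * σ * ((2 * b + 1) * U) + s ^ 2 * χ / c * ((2 * b + 1) * V)) := by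
    rw [eT]; field_simp; ring
  have e7 : c ^ 2 * σ / s * ((2 * a + 1) * U) = (γ + 1) * σ ^ 2 * UU - s * σ * ((2 * a + 1) * U) := by
    rw [b1]; field_simp; linear_combination (σ^2*(γ+1)*UU) * hsc
  have e8 : s ^ 2 * χ / c * ((2 * b + 1) * V) = (γ + 1) * χ ^ 2 * VV - c * χ * ((2 * b + 1) * V) := by
    rw [b2]; field_simp; linear_combination (χ^2*(γ+1)*VV) * hsc
  rw [e6, e7, e8]
  have h7 : γ - 1 = a + b + 1 := by rw [hγ]; ring
  rw [h7] at e5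
  linear_combination e5

end

section

def Lop (μ : ℝ) (F : ℕ → ℝ) : ℕ → ℕ → ℝ
  | 0, k => F k
  | l + 1, k => Lop μ F l (k + 2) - μ * Lop μ F l k

lemma Lop_deriv (μ : ℝ) {F : ℝ → ℕ → ℝ} {F' : ℕ → ℝ} {x : ℝ} (h : ∀ k, HasDerivAt (fun y => F y k) (F' k) x) (l : ℕ) :
    ∀ k, HasDerivAt (fun y => Lop μ (F y) l k) (Lop μ F' l k) x := by
  induction l with
  | zero => exact h
  | succ l ih => intro k; exact (ih (k + 2)).fun_sub ((ih k).const_mul μ)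

lemma Lop_shift (μ : ℝ) (F : ℕ → ℝ) (l : ℕ) : ∀ k, Lop μ (fun k => F (k + 1)) l k = Lop μ F l (k + 1) := by
  induction l with
  | zero => intro k; rfl
  | succ l ih => intro k; simp only [Lop, ih]

lemma Lop_lin (μ c d : ℝ) (F G : ℕ → ℝ) (l : ℕ) :
    ∀ k, Lop μ (fun k => c * F k + d * G k) l k = c * Lop μ F l k + d * Lop μ G l k := by
  induction l with
  | zero => intro k; rfl
  | succ l ih => intro k; simp only [Lop, ih]; ring

lemma Lop_step (μ : ℝ) (F : ℕ → ℝ) (l : ℕ) :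
    ∀ k, Lop μ (fun k => F (k + 2) - μ * F k) l k = Lop μ F (l + 1) k := by
  induction l with
  | zero => intro k; rfl
  | succ l ih => intro k; simp only [Lop, ih]

section
variable (α β : ℝ)

def Kf (k : ℕ) (t θ φ : ℝ) : ℝ := c0 (α + 1) (β + 1) * (sin θ * sin φ * Jf (α + 1) (β + 1) k t θ φ)
def KT (k : ℕ) (t θ φ : ℝ) : ℝ :=
  c0 (α + 1) (β + 1) * (sin φ * (cos θ * Jf (α + 1) (β + 1) k t θ φ + sin θ * JT (α + 1) (β + 1) k t θ φ))
def KP (k : ℕ) (t θ φ : ℝ) : ℝ :=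
  c0 (α + 1) (β + 1) * (sin θ * (cos φ * Jf (α + 1) (β + 1) k t θ φ + sin φ * JP (α + 1) (β + 1) k t θ φ))
def gf (θ : ℝ) : ℝ := cos θ + (2 * α + 1) * cos (θ / 2) ^ 2 - (2 * β + 1) * sin (θ / 2) ^ 2
def Af (k : ℕ) (t θ φ : ℝ) : ℝ :=
  c0 (α + 1) (β + 1) * (sin φ * (-(sin θ * JT (α + 1) (β + 1) k t θ φ) - gf α β θ * Jf (α + 1) (β + 1) k t θ φ))
def AP (k : ℕ) (t θ φ : ℝ) : ℝ :=
  c0 (α + 1) (β + 1) * (cos φ * (-(sin θ * JT (α + 1) (β + 1) k t θ φ) - gf α β θ * Jf (α + 1) (β + 1) k t θ φ) +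
    sin φ * (-(sin θ * JTP (α + 1) (β + 1) k t θ φ) - gf α β θ * JP (α + 1) (β + 1) k t θ φ))
def lam0 : ℝ := ((α + β + 1) / 2) ^ 2
def AT (k : ℕ) (t θ φ : ℝ) : ℝ := Kf α β (k + 2) t θ φ - lam0 α β * Kf α β k t θ φ

lemma Kf_dt (k : ℕ) {t : ℝ} (ht : 0 < t) (θ φ : ℝ) : HasDerivAt (fun t => Kf α β k t θ φ) (Kf α β (k + 1) t θ φ) t :=
  ((Jf_dt _ _ k ht θ φ).const_mul _).const_mul _

lemma Af_dt (k : ℕ) {t : ℝ} (ht : 0 < t) (θ φ : ℝ) : HasDerivAt (fun t => Af α β k t θ φ) (Af α β (k + 1) t θ φ) t :=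
  ((((JT_dt _ _ k ht θ φ).const_mul _).fun_neg.fun_sub ((Jf_dt _ _ k ht θ φ).const_mul _)).const_mul _).const_mul _

lemma Kf_dT (k : ℕ) {t : ℝ} (ht : 0 < t) (θ φ : ℝ) : HasDerivAt (fun θ => Kf α β k t θ φ) (KT α β k t θ φ) θ := by
  refine ((((hasDerivAt_sin θ).mul_const (sin φ)).fun_mul (Jf_dT _ _ k ht θ φ)).const_mul _).congr_deriv ?_
  unfold KT; ring

lemma Kf_dP (k : ℕ) {t : ℝ} (ht : 0 < t) (θ φ : ℝ) : HasDerivAt (fun φ => Kf α β k t θ φ) (KP α β k t θ φ) φ := by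
  refine ((((hasDerivAt_sin φ).const_mul (sin θ)).fun_mul (Jf_dP _ _ k ht θ φ)).const_mul _).congr_deriv ?_
  unfold KP; ring

lemma Af_dP (k : ℕ) {t : ℝ} (ht : 0 < t) (θ φ : ℝ) : HasDerivAt (fun φ => Af α β k t θ φ) (AP α β k t θ φ) φ :=
  ((hasDerivAt_sin φ).fun_mul
    (((JT_dP _ _ k ht θ φ).const_mul _).fun_neg.fun_sub ((Jf_dP _ _ k ht θ φ).const_mul _))).const_mul _

variable {α β}

lemma Af_dT (hα : -1 < α) (hβ : -1 < β) (k : ℕ) {t : ℝ} (ht : 0 < t) {θ : ℝ} (hθ : θ ∈ Ioo 0 π) (φ : ℝ) :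
    HasDerivAt (fun θ => Af α β k t θ φ) (AT α β k t θ φ) θ := by
  have hg : HasDerivAt (gf α β) (-sin θ * (α + β + 2)) θ := by
    refine (((hasDerivAt_cos θ).fun_add (((hd_cos2 θ).fun_pow 2).const_mul (2 * α + 1))).fun_sub
      (((hd_sin2 θ).fun_pow 2).const_mul (2 * β + 1))).congr_deriv ?_
    have h : sin θ = 2 * sin (θ / 2) * cos (θ / 2) := by rw [← sin_two_mul]; congr 1; ring
    rw [h]; push_cast; ring
  refine (((((hasDerivAt_sin θ).fun_mul (JT_dT (α + 1) (β + 1) k ht θ φ)).fun_neg.fun_sub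
    (hg.fun_mul (Jf_dT (α + 1) (β + 1) k ht θ φ))).const_mul (sin φ)).const_mul (c0 (α + 1) (β + 1))).congr_deriv ?_
  have hp := J_pde (by linarith : 0 < α + 1) (by linarith : 0 < β + 1) k ht hθ φ
  obtain ⟨hs, hc⟩ := halfang_pos hθ
  have h : sin θ = 2 * sin (θ / 2) * cos (θ / 2) := by rw [← sin_two_mul]; congr 1; ring
  have h2 : cos θ = cos (θ / 2) ^ 2 - sin (θ / 2) ^ 2 := by rw [← cos_two_mul']; congr 1; ring
  have hT : JTT (α + 1) (β + 1) k t θ φ = ((α + 1 + (β + 1) + 1) / 2) ^ 2 * Jf (α + 1) (β + 1) k t θ φ - Jf (α + 1) (β + 1) (k + 2) t θ φ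
    - ((α + 1 + 1 / 2) * (cos (θ / 2) / sin (θ / 2)) - (β + 1 + 1 / 2) * (sin (θ / 2) / cos (θ / 2))) * JT (α + 1) (β + 1) k t θ φ := by
    linarith
  unfold AT Kf gf lam0
  rw [hT, h, h2]
  field_simp
  ring

lemma delStar_K (k : ℕ) (t : ℝ) {θ : ℝ} (hθ : θ ∈ Ioo 0 π) (φ : ℝ) :
    Af α β k t θ φ = (-1) * KT α β k t θ φ +
      (-((α + 1 / 2) * (cos (θ / 2) / sin (θ / 2))) + (β + 1 / 2) * tan (θ / 2)) * Kf α β k t θ φ := by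
  obtain ⟨hs, hc⟩ := halfang_pos hθ
  have h : sin θ = 2 * sin (θ / 2) * cos (θ / 2) := by rw [← sin_two_mul]; congr 1; ring
  unfold Af KT Kf gf
  rw [tan_eq_sin_div_cos, h]
  field_simp
  ring

lemma jH_eq0 (hα : -1 < α) (hβ : -1 < β) {t : ℝ} (ht : 0 < t) (θ φ : ℝ) : jHtil α β t θ φ = Kf α β 0 t θ φ := by
  rw [jHtil_eq hα hβ ht θ φ, Kf, Jf_zero]

lemma delta_red (hα : -1 < α) (hβ : -1 < β) {s : ℝ} (hs : 0 < s) (φ : ℝ) (l : ℕ) :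
    (∀ θ ∈ Ioo 0 π, deltaOdd α β (2 * l) (fun θ' => jHtil α β s θ' φ) θ = Lop (lam0 α β) (fun k => Kf α β k s θ φ) l 0) ∧
    (∀ θ ∈ Ioo 0 π, deltaOdd α β (2 * l + 1) (fun θ' => jHtil α β s θ' φ) θ = Lop (lam0 α β) (fun k => Af α β k s θ φ) l 0) := by
  have step : ∀ l, (∀ θ ∈ Ioo 0 π, deltaOdd α β (2 * l) (fun θ' => jHtil α β s θ' φ) θ = Lop (lam0 α β) (fun k => Kf α β k s θ φ) l 0) →
     (∀ θ ∈ Ioo 0 π, deltaOdd α β (2 * l + 1) (fun θ' => jHtil α β s θ' φ) θ = Lop (lam0 α β) (fun k => Af α β k s θ φ) l 0) := by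
    intro l h θ hθ
    have hd : HasDerivAt (deltaOdd α β (2 * l) (fun θ' => jHtil α β s θ' φ)) (Lop (lam0 α β) (fun k => KT α β k s θ φ) l 0) θ := by
      refine (Lop_deriv (lam0 α β) (F := fun θ k => Kf α β k s θ φ) (fun k => Kf_dT α β k hs θ φ) l 0).congr_of_eventuallyEq ?_
      filter_upwards [isOpen_Ioo.mem_nhds hθ] with y hy using h y hy
    have h2 : (2 * l) % 2 = 0 := by omega
    simp only [deltaOdd, h2, if_true, delStar]
    rw [hd.deriv, h θ hθ]
    have : (fun k => Af α β k s θ φ) = fun k => (-1) * KT α β k s θ φ +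
      (-((α + 1 / 2) * (cos (θ / 2) / sin (θ / 2))) + (β + 1 / 2) * tan (θ / 2)) * Kf α β k s θ φ := by
      funext k; exact delStar_K k s hθ φ
    rw [this, Lop_lin]
    ring
  induction l with
  | zero =>
    have h0 : (∀ θ ∈ Ioo 0 π, deltaOdd α β (2 * 0) (fun θ' => jHtil α β s θ' φ) θ = Lop (lam0 α β) (fun k => Kf α β k s θ φ) 0 0) := by
      intro θ _
      exact jH_eq0 hα hβ hs θ φ
    exact ⟨h0, step 0 h0⟩
  | succ l ih =>
    have h0 : (∀ θ ∈ Ioo 0 π, deltaOdd α β (2 * (l + 1)) (fun θ' => jHtil α β s θ' φ) θ = Lop (lam0 α β) (fun k => Kf α β k s θ φ) (l + 1) 0) := by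
      intro θ hθ
      have hd : HasDerivAt (deltaOdd α β (2 * l + 1) (fun θ' => jHtil α β s θ' φ)) (Lop (lam0 α β) (fun k => AT α β k s θ φ) l 0) θ := by
        refine (Lop_deriv (lam0 α β) (F := fun θ k => Af α β k s θ φ) (fun k => Af_dT hα hβ k hs hθ φ) l 0).congr_of_eventuallyEq ?_
        filter_upwards [isOpen_Ioo.mem_nhds hθ] with y hy using ih.2 y hy
      have h2 : ¬ ((2 * l + 1) % 2 = 0) := by omega
      rw [show 2 * (l + 1) = (2 * l + 1) + 1 by ring]
      rw [deltaOdd]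
      simp only [h2, if_false]
      rw [hd.deriv, ← Lop_step]
      rfl
    exact ⟨h0, step _ h0⟩

variable (α β)
def FF (N k : ℕ) (t θ φ : ℝ) : ℝ := if Even N then Kf α β k t θ φ else Af α β k t θ φ
def FT (N k : ℕ) (t θ φ : ℝ) : ℝ := if Even N then KT α β k t θ φ else AT α β k t θ φ
def FP (N k : ℕ) (t θ φ : ℝ) : ℝ := if Even N then KP α β k t θ φ else AP α β k t θ φ
variable {α β}

lemma delta_FF (hα : -1 < α) (hβ : -1 < β) {s : ℝ} (hs : 0 < s) (φ : ℝ) (N : ℕ) {θ : ℝ} (hθ : θ ∈ Ioo 0 π) :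
    deltaOdd α β N (fun θ' => jHtil α β s θ' φ) θ = Lop (lam0 α β) (fun k => FF α β N k s θ φ) (N / 2) 0 := by
  have h := delta_red hα hβ hs φ (N / 2)
  unfold FF
  rcases Nat.even_or_odd N with he | ho
  · have h1 : 2 * (N / 2) = N := by obtain ⟨r, hr⟩ := he; omega
    rw [h1] at h
    simp only [he, if_true]; exact h.1 θ hθ
  · have h1 : 2 * (N / 2) + 1 = N := by obtain ⟨r, hr⟩ := ho; omega
    rw [h1] at h
    simp only [Nat.not_even_iff_odd.mpr ho, if_false]; exact h.2 θ hθ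

lemma FF_dt (N k : ℕ) {t : ℝ} (ht : 0 < t) (θ φ : ℝ) :
    HasDerivAt (fun t => FF α β N k t θ φ) (FF α β N (k + 1) t θ φ) t := by
  unfold FF; split_ifs
  · exact Kf_dt α β k ht θ φ
  · exact Af_dt α β k ht θ φ

lemma dtM (hα : -1 < α) (hβ : -1 < β) (φ : ℝ) (N M : ℕ) {θ : ℝ} (hθ : θ ∈ Ioo 0 π) : ∀ t, 0 < t →
    deriv^[M] (fun s => deltaOdd α β N (fun θ' => jHtil α β s θ' φ) θ) t =
      Lop (lam0 α β) (fun k => FF α β N k t θ φ) (N / 2) M := by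
  induction M with
  | zero => intro t ht; exact delta_FF hα hβ ht φ N hθ
  | succ M ih =>
    intro t ht
    rw [Function.iterate_succ', Function.comp]
    refine HasDerivAt.deriv ?_
    rw [← Lop_shift]
    refine (Lop_deriv (lam0 α β) (F := fun t k => FF α β N k t θ φ) (fun k => FF_dt N k ht θ φ) (N / 2) M).congr_of_eventuallyEq ?_
    filter_upwards [lt_mem_nhds ht] with s hs using ih s hs

lemma dTM (hα : -1 < α) (hβ : -1 < β) (φ : ℝ) (N M : ℕ) {θ : ℝ} (hθ : θ ∈ Ioo 0 π) {t : ℝ} (ht : 0 < t) :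
    deriv (fun θ'' => deriv^[M] (fun s => deltaOdd α β N (fun θ' => jHtil α β s θ' φ) θ'') t) θ =
      Lop (lam0 α β) (fun k => FT α β N k t θ φ) (N / 2) M := by
  refine HasDerivAt.deriv ?_
  have h : ∀ k, HasDerivAt (fun θ => FF α β N k t θ φ) (FT α β N k t θ φ) θ := by
    intro k; unfold FF FT; split_ifs
    · exact Kf_dT α β k ht θ φ
    · exact Af_dT hα hβ k ht hθ φ
  refine (Lop_deriv (lam0 α β) (F := fun θ k => FF α β N k t θ φ) h (N / 2) M).congr_of_eventuallyEq ?_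
  filter_upwards [isOpen_Ioo.mem_nhds hθ] with y hy using dtM hα hβ φ N M hy t ht

lemma dPM (hα : -1 < α) (hβ : -1 < β) (φ : ℝ) (N M : ℕ) {θ : ℝ} (hθ : θ ∈ Ioo 0 π) {t : ℝ} (ht : 0 < t) :
    deriv (fun φ' => deriv^[M] (fun s => deltaOdd α β N (fun θ' => jHtil α β s θ' φ') θ) t) φ =
      Lop (lam0 α β) (fun k => FP α β N k t θ φ) (N / 2) M := by
  refine HasDerivAt.deriv ?_
  have h : ∀ k, HasDerivAt (fun φ => FF α β N k t θ φ) (FP α β N k t θ φ) φ := by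
    intro k; unfold FF FP; split_ifs
    · exact Kf_dP α β k ht θ φ
    · exact Af_dP α β k ht θ φ
  refine (Lop_deriv (lam0 α β) (F := fun φ k => FF α β N k t θ φ) h (N / 2) M).congr_of_eventuallyEq ?_
  filter_upwards with y using dtM hα hβ y N M hθ t ht

end

end

section

lemma lowA {A B ω : ℝ} (hB : 0 ≤ B) (hAB : B < A) (hω : ω ∈ Icc 0 π) :
    1 / (4 * π ^ 2) * ((A - B) + A * ω ^ 2) ≤ A - B * cos ω := by
  have hp := pi_pos
  have hc := Real.cos_le_one_sub_mul_cos_sq (x := ω) (by rw [abs_of_nonneg hω.1]; exact hω.2)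
  have hp3 := pi_gt_three
  have h1 : B * (2 / π ^ 2 * ω ^ 2) ≤ B * (1 - cos ω) := mul_le_mul_of_nonneg_left (by linarith) hB
  have h2 : ω ^ 2 / π ^ 2 ≤ 1 := by
    rw [div_le_one (by positivity)]; exact pow_le_pow_left₀ hω.1 hω.2 2
  have h3 : 1 / (4 * π ^ 2) ≤ 1 / 36 := by
    apply one_div_le_one_div_of_le (by norm_num); nlinarith
  have e : 1 / (4 * π ^ 2) * ((A - B) + A * ω ^ 2) = 1 / (4 * π ^ 2) * (A - B) + A / 4 * (ω ^ 2 / π ^ 2) := by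
    field_simp
  rw [e]
  have h5 : 1 / (4 * π ^ 2) * (A - B) ≤ 1 / 36 * (A - B) := mul_le_mul_of_nonneg_right h3 (by linarith)
  have h1' : 2 * B * (ω ^ 2 / π ^ 2) ≤ B * (1 - cos ω) := by
    refine le_trans (le_of_eq ?_) h1; ring
  have h6 : 0 ≤ ω ^ 2 / π ^ 2 := by positivity
  set q := ω ^ 2 / π ^ 2
  nlinarith [mul_nonneg (sub_nonneg.mpr hAB.le) (sub_nonneg.mpr h2), mul_nonneg hB h6]

lemma int_g {a p : ℝ} (hp : a + 1 / 2 < p) :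
    ∀ (ha : 0 < a), IntegrableOn (fun x : ℝ => x ^ (2 * a) * (1 + x ^ 2) ^ (-p)) (Ioi 0) := by
  intro ha
  have h := (integrable_rpow_neg_one_add_norm_sq (E := ℝ) (μ := volume) (r := 2 * (p - a))
    (by simp; linarith)).integrableOn (s := Ioi 0)
  refine Integrable.mono' h ?_ ?_
  · refine ContinuousOn.aestronglyMeasurable ?_ measurableSet_Ioi
    apply ContinuousOn.mul
    · exact ContinuousOn.rpow_const (by fun_prop) (fun x hx => Or.inr (by linarith))
    · exact ContinuousOn.rpow_const (by fun_prop) (fun x hx => Or.inl (by positivity))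
  · refine (ae_restrict_iff' measurableSet_Ioi).mpr (ae_of_all _ (fun x hx => ?_))
    have hx0 : (0:ℝ) < x := hx
    rw [Real.norm_of_nonneg (by positivity), Real.norm_of_nonneg hx0.le]
    have e1 : x ^ (2 * a) = (x ^ 2) ^ a := by
      rw [← Real.rpow_natCast x 2, ← Real.rpow_mul hx0.le]; norm_num
    have e2 : x ^ (2 * a) ≤ (1 + x ^ 2) ^ a := by
      rw [e1]; exact Real.rpow_le_rpow (by positivity) (by linarith) ha.le
    calc x ^ (2 * a) * (1 + x ^ 2) ^ (-p) ≤ (1 + x ^ 2) ^ a * (1 + x ^ 2) ^ (-p) := by gcongr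
      _ = _ := by rw [← Real.rpow_add (by positivity)]; congr 1; ring

lemma oneD {a p : ℝ} (ha : 0 < a) (hp : a + 1 / 2 < p) : ∃ C : ℝ, 0 ≤ C ∧ ∀ A B : ℝ, 0 ≤ B → B < A →
    ∫ ω, (A - B * cos ω) ^ (-p) ∂(nu a) ≤ C * ((A - B) ^ (-(p - a - 1 / 2)) * A ^ (-(a + 1 / 2))) := by
  have hg := int_g hp ha
  refine ⟨(1 / (4 * π ^ 2)) ^ (-p) * ∫ x in Ioi (0:ℝ), x ^ (2 * a) * (1 + x ^ 2) ^ (-p), ?_, ?_⟩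
  · refine mul_nonneg (by have := pi_pos; positivity) (setIntegral_nonneg measurableSet_Ioi (fun x hx => ?_))
    have : (0:ℝ) < x := hx
    positivity
  intro A B hB hAB
  have hpi := pi_pos
  have hδ : 0 < A - B := by linarith
  have hA : 0 < A := by linarith
  set ρ := sqrt (A / (A - B)) with hρ
  have hρ0 : 0 < ρ := by rw [hρ]; exact sqrt_pos.mpr (by positivity)
  have hρ2 : ρ ^ 2 = A / (A - B) := sq_sqrt (by positivity)
  set c := 1 / (4 * π ^ 2) with hc
  have hc0 : 0 < c := by positivity
  have hcomp : IntegrableOn (fun x : ℝ => (ρ * x) ^ (2 * a) * (1 + (ρ * x) ^ 2) ^ (-p)) (Ioi 0) := by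
    have := (integrableOn_Ioi_comp_mul_left_iff (fun x : ℝ => x ^ (2 * a) * (1 + x ^ 2) ^ (-p)) 0 hρ0).mpr (by simpa using hg)
    exact this
  have hval : ∫ x in Ioi (0:ℝ), (ρ * x) ^ (2 * a) * (1 + (ρ * x) ^ 2) ^ (-p) =
      ρ⁻¹ * ∫ x in Ioi (0:ℝ), x ^ (2 * a) * (1 + x ^ 2) ^ (-p) := by
    have := integral_comp_mul_left_Ioi (fun x : ℝ => x ^ (2 * a) * (1 + x ^ 2) ^ (-p)) 0 hρ0
    simpa using this
  set I := ∫ x in Ioi (0:ℝ), x ^ (2 * a) * (1 + x ^ 2) ^ (-p) with hI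
  have hpt : ∀ ω ∈ Ioc 0 π, sin ω ^ (2 * a) * (A - B * cos ω) ^ (-p) ≤
      (c ^ (-p) * ((A - B) ^ (-p) * ρ ^ (-(2 * a)))) * ((ρ * ω) ^ (2 * a) * (1 + (ρ * ω) ^ 2) ^ (-p)) := by
    intro ω hω
    have hl := lowA hB hAB ⟨hω.1.le, hω.2⟩
    rw [← hc] at hl
    have hω0 := hω.1
    have e1 : (A - B) + A * ω ^ 2 = (A - B) * (1 + (ρ * ω) ^ 2) := by
      rw [mul_pow, hρ2]; field_simp
    have s1 : sin ω ^ (2 * a) ≤ ω ^ (2 * a) :=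
      Real.rpow_le_rpow (sin_nonneg_of_nonneg_of_le_pi hω0.le hω.2) (sin_le hω0.le) (by linarith)
    have s2 : (A - B * cos ω) ^ (-p) ≤ (c * ((A - B) * (1 + (ρ * ω) ^ 2))) ^ (-p) := by
      apply Real.rpow_le_rpow_of_nonpos (by positivity) (by rw [← e1]; exact hl) (by linarith)
    rw [Real.mul_rpow hc0.le (by positivity), Real.mul_rpow hδ.le (by positivity)] at s2
    have s3 : ρ ^ (-(2 * a)) * (ρ * ω) ^ (2 * a) = ω ^ (2 * a) := by
      rw [Real.mul_rpow hρ0.le hω0.le, ← mul_assoc, ← Real.rpow_add hρ0]; simp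
    calc sin ω ^ (2 * a) * (A - B * cos ω) ^ (-p) ≤ ω ^ (2 * a) * (c ^ (-p) * ((A - B) ^ (-p) * (1 + (ρ * ω) ^ 2) ^ (-p))) := by
          apply mul_le_mul s1 s2 _ (by positivity)
          apply Real.rpow_nonneg
          exact le_trans (by positivity) hl
      _ = _ := by rw [← s3]; ring
  rw [nu_int ha, intervalIntegral.integral_of_le hpi.le]
  have hAc : ∀ ω : ℝ, 0 < A - B * cos ω := by
    intro ω; nlinarith [cos_le_one ω]
  calc ∫ ω in Ioc 0 π, sin ω ^ (2 * a) * (A - B * cos ω) ^ (-p)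
      ≤ ∫ ω in Ioc 0 π, (c ^ (-p) * ((A - B) ^ (-p) * ρ ^ (-(2 * a)))) * ((ρ * ω) ^ (2 * a) * (1 + (ρ * ω) ^ 2) ^ (-p)) := by
        refine setIntegral_mono_on ?_ ((hcomp.mono_set Ioc_subset_Ioi_self).const_mul _) measurableSet_Ioc hpt
        refine (Continuous.integrableOn_Icc ?_).mono_set Ioc_subset_Icc_self
        apply Continuous.mul
        · exact continuous_sin.rpow_const (fun x => Or.inr (by linarith))
        · exact Continuous.rpow_const (by fun_prop) (fun x => Or.inl (hAc x).ne')
    _ = (c ^ (-p) * ((A - B) ^ (-p) * ρ ^ (-(2 * a)))) * ∫ ω in Ioc 0 π, ((ρ * ω) ^ (2 * a) * (1 + (ρ * ω) ^ 2) ^ (-p)) := by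
        rw [integral_const_mul]
    _ ≤ (c ^ (-p) * ((A - B) ^ (-p) * ρ ^ (-(2 * a)))) * ∫ ω in Ioi (0:ℝ), ((ρ * ω) ^ (2 * a) * (1 + (ρ * ω) ^ 2) ^ (-p)) := by
        apply mul_le_mul_of_nonneg_left _ (by positivity)
        refine setIntegral_mono_set hcomp ?_ (Filter.Eventually.of_forall Ioc_subset_Ioi_self)
        refine (ae_restrict_iff' measurableSet_Ioi).mpr (ae_of_all _ (fun x hx => ?_))
        have hx0 : (0:ℝ) < x := hx
        show (0:ℝ) ≤ _
        positivity
    _ = c ^ (-p) * I * ((A - B) ^ (-p) * (ρ ^ (-(2 * a)) * ρ⁻¹)) := by rw [hval]; ring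
    _ = _ := by
      congr 1
      have e1 : ρ ^ (-(2 * a)) * ρ⁻¹ = A ^ (-(a + 1 / 2)) * (A - B) ^ (a + 1 / 2) := by
        rw [← Real.rpow_neg_one, ← Real.rpow_add hρ0]
        have : ρ ^ (-(2 * a) + -1) = (ρ ^ 2) ^ (-(a + 1 / 2)) := by
          rw [← Real.rpow_natCast ρ 2, ← Real.rpow_mul hρ0.le]; congr 1; push_cast; ring
        rw [this, hρ2, Real.div_rpow hA.le hδ.le, Real.rpow_neg hδ.le (a + 1 / 2), div_inv_eq_mul]
      rw [e1]
      have e2 : (A - B) ^ (-(p - a - 1 / 2)) = (A - B) ^ (-p) * (A - B) ^ (a + 1 / 2) := by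
        rw [← Real.rpow_add hδ]; congr 1; ring
      rw [e2]; ring

lemma twoD {a b p : ℝ} (ha : 0 < a) (hb : 0 < b) (hp : a + b + 1 < p) : ∃ C : ℝ, 0 ≤ C ∧
    ∀ h S K : ℝ, 0 ≤ S → 0 ≤ K → S + K < h → ∫ x, (h - wf S K x) ^ (-p) ∂(nn a b) ≤
      C * ((h - S - K) ^ (-(p - a - b - 1)) * (h - K) ^ (-(a + 1 / 2)) * (h - S) ^ (-(b + 1 / 2))) := by
  obtain ⟨C1, hC1, h1⟩ := oneD hb (p := p) (by linarith)
  obtain ⟨C2, hC2, h2⟩ := oneD ha (p := p - b - 1 / 2) (by linarith)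
  refine ⟨C1 * C2, by positivity, ?_⟩
  intro h S K hS hK hh
  have hpos : ∀ x : ℝ × ℝ, 0 < h - wf S K x := by
    intro x; unfold wf; nlinarith [cos_le_one x.1, cos_le_one x.2]
  have hcont : Continuous (fun x => (h - wf S K x) ^ (-p)) :=
    (continuous_const.sub (wf_cont S K)).rpow_const (fun x => Or.inl (hpos x).ne')
  have hpos2 : ∀ ω : ℝ, 0 < h - K - S * cos ω := by
    intro ω; nlinarith [cos_le_one ω]
  have hS0 : 0 < h - S := by linarith
  have hintg : Integrable (fun x => (h - wf S K x) ^ (-p)) ((nu a).prod (nu b)) := nn_integrable a b hcont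
  unfold nn
  rw [integral_prod _ hintg]
  calc ∫ ω, ∫ η, (h - wf S K (ω, η)) ^ (-p) ∂(nu b) ∂(nu a)
      ≤ ∫ ω, (C1 * (h - S) ^ (-(b + 1 / 2))) * (h - K - S * cos ω) ^ (-(p - b - 1 / 2)) ∂(nu a) := by
        refine integral_mono hintg.integral_prod_left (nu_integrable a ?_) (fun ω => ?_)
        · exact continuous_const.mul (Continuous.rpow_const (by fun_prop) (fun x => Or.inl (hpos2 x).ne'))
        · have hco := cos_le_one ω
          have := h1 (h - cos ω * S) K hK (by nlinarith)
          have e : ∀ η, h - wf S K (ω, η) = h - cos ω * S - K * cos η := by intro η; unfold wf; simp only; ring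
          simp only [e]
          refine this.trans ?_
          rw [mul_assoc]
          apply mul_le_mul_of_nonneg_left _ hC1
          rw [mul_comm, show h - cos ω * S - K = h - K - S * cos ω by ring]
          apply mul_le_mul_of_nonneg_right _ (Real.rpow_nonneg (hpos2 ω).le _)
          apply Real.rpow_le_rpow_of_nonpos hS0 (by nlinarith) (by linarith)
    _ = (C1 * (h - S) ^ (-(b + 1 / 2))) * ∫ ω, (h - K - S * cos ω) ^ (-(p - b - 1 / 2)) ∂(nu a) := by
        rw [integral_const_mul]
    _ ≤ (C1 * (h - S) ^ (-(b + 1 / 2))) * (C2 * ((h - K - S) ^ (-(p - b - 1 / 2 - a - 1 / 2)) * (h - K) ^ (-(a + 1 / 2)))) := by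
        apply mul_le_mul_of_nonneg_left (h2 (h - K) S hS (by linarith)) (by positivity)
    _ = _ := by
        rw [show p - b - 1 / 2 - a - 1 / 2 = p - a - b - 1 by ring, show h - K - S = h - S - K by ring]; ring

end

section

def LB (a b : ℝ) (n : ℕ) (f : ℝ → ℝ → ℝ → ℝ × ℝ → ℝ) : Prop :=
  ∃ C : ℝ, 0 ≤ C ∧ ∀ t θ φ x, 0 < t →
    (t ≤ 2 → |f t θ φ x| ≤ C * (cosh (t / 2) - ww θ φ x) ^ (-(a + b + 3 / 2 + (n : ℝ) / 2))) ∧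
    (2 ≤ t → |f t θ φ x| ≤ C * exp (-(t / 2)))

lemma LB_G {a b : ℝ} (ha : 0 < a) (hb : 0 < b) (k l : ℕ) :
    LB a b (k + 2 * l) (fun t θ φ x => Gd (a + b + 2) k 1 0 l t (ww θ φ x)) := by
  obtain ⟨C1, hC1, h1⟩ := Gd_bound_small (γ := a + b + 2) k 1 0 l
  obtain ⟨C2, hC2, h2⟩ := Gd_bound_large (γ := a + b + 2) (by linarith) k 1 0 l
  refine ⟨C1 + C2, by positivity, fun t θ φ x ht => ⟨fun h => ?_, fun h => ?_⟩⟩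
  · have hD := ww_D ht θ φ x
    refine (h1 t _ ht h (ww_abs θ φ x)).trans ?_
    have e : -(a + b + 2) - (l : ℝ) + (((1 : ℕ) : ℝ) - k) / 2 = -(a + b + 3 / 2 + ((k + 2 * l : ℕ) : ℝ) / 2) := by
      push_cast; ring
    rw [e]
    exact mul_le_mul_of_nonneg_right (by linarith) (Real.rpow_nonneg hD.le _)
  · refine (h2 t _ h (ww_abs θ φ x)).trans ?_
    apply mul_le_mul (by linarith) _ (exp_pos _).le (by positivity)
    apply exp_le_exp.mpr
    have : (0:ℝ) ≤ l := l.cast_nonneg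
    push_cast
    nlinarith

lemma LB_add {a b : ℝ} {n : ℕ} {f g : ℝ → ℝ → ℝ → ℝ × ℝ → ℝ} (hf : LB a b n f) (hg : LB a b n g) :
    LB a b n (fun t θ φ x => f t θ φ x + g t θ φ x) := by
  obtain ⟨C1, hC1, h1⟩ := hf
  obtain ⟨C2, hC2, h2⟩ := hg
  refine ⟨C1 + C2, by positivity, fun t θ φ x ht => ⟨fun h => ?_, fun h => ?_⟩⟩
  · refine (abs_add_le _ _).trans ?_
    rw [add_mul]; exact add_le_add ((h1 t θ φ x ht).1 h) ((h2 t θ φ x ht).1 h)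
  · refine (abs_add_le _ _).trans ?_
    rw [add_mul]; exact add_le_add ((h1 t θ φ x ht).2 h) ((h2 t θ φ x ht).2 h)

lemma LB_bdd {a b : ℝ} {n : ℕ} {f : ℝ → ℝ → ℝ → ℝ × ℝ → ℝ} (hf : LB a b n f) {g : ℝ → ℝ → ℝ × ℝ → ℝ} {c : ℝ}
    (hg : ∀ θ φ x, |g θ φ x| ≤ c) : LB a b n (fun t θ φ x => g θ φ x * f t θ φ x) := by
  obtain ⟨C1, hC1, h1⟩ := hf
  have hc : 0 ≤ c := (abs_nonneg _).trans (hg 0 0 0)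
  refine ⟨c * C1, by positivity, fun t θ φ x ht => ⟨fun h => ?_, fun h => ?_⟩⟩
  · rw [abs_mul, mul_assoc]
    exact mul_le_mul (hg θ φ x) ((h1 t θ φ x ht).1 h) (abs_nonneg _) hc
  · rw [abs_mul, mul_assoc]
    exact mul_le_mul (hg θ φ x) ((h1 t θ φ x ht).2 h) (abs_nonneg _) hc

lemma LB_half {a b : ℝ} {n : ℕ} {f : ℝ → ℝ → ℝ → ℝ × ℝ → ℝ} (hf : LB a b (n + 1) f) {g : ℝ → ℝ → ℝ × ℝ → ℝ}
    (hg : ∀ θ φ x, 4 * g θ φ x ^ 2 ≤ 1 - ww θ φ x ^ 2) : LB a b n (fun t θ φ x => g θ φ x * f t θ φ x) := by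
  obtain ⟨C1, hC1, h1⟩ := hf
  have hg1 : ∀ θ φ x, |g θ φ x| ≤ 1 := by
    intro θ φ x
    apply abs_le_of_sq_le_sq _ (by norm_num)
    nlinarith [hg θ φ x, sq_nonneg (ww θ φ x), sq_nonneg (g θ φ x)]
  refine ⟨C1, hC1, fun t θ φ x ht => ⟨fun h => ?_, fun h => ?_⟩⟩
  · have hD := ww_D ht θ φ x
    have hch := ch_gt ht
    have hwl := (abs_le.mp (ww_abs θ φ x))
    have hg2 : |g θ φ x| ≤ (cosh (t / 2) - ww θ φ x) ^ ((1:ℝ) / 2) := by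
      rw [← Real.sqrt_eq_rpow]
      apply Real.abs_le_sqrt
      nlinarith [hg θ φ x]
    rw [abs_mul]
    calc |g θ φ x| * |f t θ φ x| ≤ (cosh (t / 2) - ww θ φ x) ^ ((1:ℝ) / 2) *
          (C1 * (cosh (t / 2) - ww θ φ x) ^ (-(a + b + 3 / 2 + ((n + 1 : ℕ) : ℝ) / 2))) :=
          mul_le_mul hg2 ((h1 t θ φ x ht).1 h) (abs_nonneg _) (by positivity)
      _ = C1 * ((cosh (t / 2) - ww θ φ x) ^ ((1:ℝ) / 2) *
          (cosh (t / 2) - ww θ φ x) ^ (-(a + b + 3 / 2 + ((n + 1 : ℕ) : ℝ) / 2))) := by ring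
      _ = _ := by rw [← Real.rpow_add hD]; congr 2; push_cast; ring
  · rw [abs_mul]
    calc |g θ φ x| * |f t θ φ x| ≤ 1 * (C1 * exp (-(t / 2))) :=
          mul_le_mul (hg1 θ φ x) ((h1 t θ φ x ht).2 h) (abs_nonneg _) (by norm_num)
      _ = _ := one_mul _

lemma wT_le (θ φ : ℝ) (x : ℝ × ℝ) : 4 * wT θ φ x ^ 2 ≤ 1 - ww θ φ x ^ 2 := by
  have h4 : 4 * wT θ φ x ^ 2 = cos x.1 ^ 2 * sin (φ / 2) ^ 2 + cos x.2 ^ 2 * cos (φ / 2) ^ 2 - ww θ φ x ^ 2 := by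
    unfold wT ww wf
    linear_combination (cos x.1 ^ 2 * sin (φ / 2) ^ 2 + cos x.2 ^ 2 * cos (φ / 2) ^ 2) * (sin_sq_add_cos_sq (θ / 2))
  rw [h4]
  nlinarith [sin_sq_add_cos_sq (φ / 2), cos_sq_le_one x.1, cos_sq_le_one x.2, sq_nonneg (sin (φ / 2)), sq_nonneg (cos (φ / 2))]

lemma wP_le (θ φ : ℝ) (x : ℝ × ℝ) : 4 * wP θ φ x ^ 2 ≤ 1 - ww θ φ x ^ 2 := by
  have h4 : 4 * wP θ φ x ^ 2 = cos x.1 ^ 2 * sin (θ / 2) ^ 2 + cos x.2 ^ 2 * cos (θ / 2) ^ 2 - ww θ φ x ^ 2 := by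
    unfold wP ww wf
    linear_combination (cos x.1 ^ 2 * sin (θ / 2) ^ 2 + cos x.2 ^ 2 * cos (θ / 2) ^ 2) * (sin_sq_add_cos_sq (φ / 2))
  rw [h4]
  nlinarith [sin_sq_add_cos_sq (θ / 2), cos_sq_le_one x.1, cos_sq_le_one x.2, sq_nonneg (sin (θ / 2)), sq_nonneg (cos (θ / 2))]

lemma wTP_le (θ φ : ℝ) (x : ℝ × ℝ) : |wTP θ φ x| ≤ 1 := by
  unfold wTP
  have h1 : |cos x.1 * (cos (θ / 2) * cos (φ / 2))| ≤ 1 := by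
    rw [abs_mul, abs_mul]
    exact mul_le_one₀ (abs_cos_le_one _) (by positivity) (mul_le_one₀ (abs_cos_le_one _) (abs_nonneg _) (abs_cos_le_one _))
  have h2 : |cos x.2 * (sin (θ / 2) * sin (φ / 2))| ≤ 1 := by
    rw [abs_mul, abs_mul]
    exact mul_le_one₀ (abs_cos_le_one _) (by positivity) (mul_le_one₀ (abs_sin_le_one _) (abs_nonneg _) (abs_sin_le_one _))
  rw [abs_le] at *
  constructor <;> linarith [h1.1, h1.2, h2.1, h2.2]

/-- pointwise kernel bounds -/
def PB (α β : ℝ) (n : ℕ) (T : ℝ → ℝ → ℝ → ℝ) : Prop :=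
  ∃ C : ℝ, 0 ≤ C ∧ ∀ t θ φ, 0 < t → θ ∈ Ioo 0 π → φ ∈ Ioo 0 π → θ ≠ φ →
    (t ≤ 2 → |T t θ φ| ≤ C * ((t + |θ - φ|) ^ (-((n : ℝ) + 1)) * (θ + (t + |θ - φ|)) ^ (-(2 * α + 1)) *
      (π - θ + (t + |θ - φ|)) ^ (-(2 * β + 1)))) ∧
    (2 ≤ t → |T t θ φ| ≤ C * exp (-(t / 2)))

lemma geom {t θ φ : ℝ} (ht : 0 < t) (hθ : θ ∈ Ioo 0 π) (hφ : φ ∈ Ioo 0 π) :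
    1 / (16 * π ^ 2) * (t + |θ - φ|) ^ 2 ≤ cosh (t / 2) - sin (θ / 2) * sin (φ / 2) - cos (θ / 2) * cos (φ / 2) ∧
    1 / (16 * π ^ 2) * (θ + (t + |θ - φ|)) ^ 2 ≤ cosh (t / 2) - cos (θ / 2) * cos (φ / 2) ∧
    1 / (16 * π ^ 2) * (π - θ + (t + |θ - φ|)) ^ 2 ≤ cosh (t / 2) - sin (θ / 2) * sin (φ / 2) := by
  have hpi := pi_gt_three
  obtain ⟨hs, hc⟩ := halfang_pos hθ
  obtain ⟨hσ, hχ⟩ := halfang_pos hφ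
  have hch : 1 + t ^ 2 / 8 ≤ cosh (t / 2) := by
    have e1 := cosh_two_mul (t / 4)
    have e2 := cosh_sq (t / 4)
    have e3 : t / 4 ≤ sinh (t / 4) := self_le_sinh_iff.2 (by linarith)
    rw [show 2 * (t / 4) = t / 2 by ring] at e1
    nlinarith
  set d := |θ - φ| with hd
  have hd0 : 0 ≤ d := abs_nonneg _
  have hz1 : sin (θ / 2) * sin (φ / 2) + cos (θ / 2) * cos (φ / 2) ≤ 1 - 2 / π ^ 2 * (d / 2) ^ 2 := by
    have e : sin (θ / 2) * sin (φ / 2) + cos (θ / 2) * cos (φ / 2) = cos (d / 2) := by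
      rw [show d / 2 = |θ / 2 - φ / 2| by rw [hd, ← sub_div, abs_div]; norm_num, cos_abs, cos_sub]; ring
    rw [e]
    apply cos_le_one_sub_mul_cos_sq
    have : d ≤ π := by rw [hd, abs_le]; constructor <;> linarith [hθ.1, hθ.2, hφ.1, hφ.2]
    rw [abs_of_nonneg (by positivity)]; linarith
  have hK : cos (θ / 2) * cos (φ / 2) ≤ 1 - 2 / π ^ 2 * (θ / 2) ^ 2 := by
    have := cos_le_one_sub_mul_cos_sq (x := θ / 2) (by rw [abs_of_pos (by linarith [hθ.1])]; linarith [hθ.2])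
    nlinarith [cos_le_one (φ / 2)]
  have hS : sin (θ / 2) * sin (φ / 2) ≤ 1 - 2 / π ^ 2 * ((π - θ) / 2) ^ 2 := by
    have := cos_le_one_sub_mul_cos_sq (x := (π - θ) / 2) (by rw [abs_of_pos (by linarith [hθ.2])]; linarith [hθ.1])
    rw [show (π - θ) / 2 = π / 2 - θ / 2 by ring, cos_pi_div_two_sub] at this
    rw [show (π - θ) / 2 = π / 2 - θ / 2 by ring]
    nlinarith [sin_le_one (φ / 2)]
  set c := 1 / (16 * π ^ 2) with hcd
  have hc1 : 2 / π ^ 2 = 32 * c := by rw [hcd]; field_simp; norm_num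
  have hc2 : c ≤ 1 / 144 := by rw [hcd]; apply one_div_le_one_div_of_le (by norm_num); nlinarith
  have hc0 : 0 < c := by rw [hcd]; positivity
  rw [hc1] at hz1 hK hS
  have ht2 : 16 * c * t ^ 2 ≤ t ^ 2 / 8 := by nlinarith [sq_nonneg t]
  have hz : 4 * c * (t + d) ^ 2 ≤ cosh (t / 2) - sin (θ / 2) * sin (φ / 2) - cos (θ / 2) * cos (φ / 2) := by
    nlinarith [mul_nonneg hc0.le (sq_nonneg (t - d)), mul_nonneg hc0.le (sq_nonneg t)]
  have hSp : 0 < sin (θ / 2) * sin (φ / 2) := by positivity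
  have hKp : 0 < cos (θ / 2) * cos (φ / 2) := by positivity
  refine ⟨?_, ?_, ?_⟩
  · nlinarith [mul_nonneg hc0.le (sq_nonneg (t + d))]
  · nlinarith [mul_nonneg hc0.le (sq_nonneg (θ - (t + d))), sq_nonneg t, mul_nonneg hc0.le (sq_nonneg θ)]
  · nlinarith [mul_nonneg hc0.le (sq_nonneg (π - θ - (t + d))), sq_nonneg t, mul_nonneg hc0.le (sq_nonneg (π - θ))]

lemma pow_conv {c x y q : ℝ} (hc : 0 < c) (hx : 0 < x) (hq : 0 ≤ q) (h : c * x ^ 2 ≤ y) :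
    y ^ (-q) ≤ c ^ (-q) * x ^ (-(2 * q)) := by
  have : x ^ (-(2 * q)) = (x ^ 2) ^ (-q) := by
    rw [← Real.rpow_natCast x 2, ← Real.rpow_mul hx.le]; congr 1; push_cast; ring
  rw [this, ← Real.mul_rpow hc.le (by positivity)]
  exact Real.rpow_le_rpow_of_nonpos (by positivity) h (by linarith)

lemma PB_int {a b : ℝ} (ha : 0 < a) (hb : 0 < b) {n : ℕ} {f : ℝ → ℝ → ℝ → ℝ × ℝ → ℝ} (hf : LB a b n f) :
    PB a b n (fun t θ φ => ∫ x, f t θ φ x ∂(nn a b)) := by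
  obtain ⟨C1, hC1, h1⟩ := hf
  have hn : (0:ℝ) ≤ n := n.cast_nonneg
  obtain ⟨C2, hC2, h2⟩ := twoD ha hb (p := a + b + 3 / 2 + (n : ℝ) / 2) (by linarith)
  set c := 1 / (16 * π ^ 2) with hcd
  have hc : 0 < c := by have := pi_pos; positivity
  set m := ∫ x, (1:ℝ) ∂(nn a b) with hm
  have hm0 : 0 ≤ m := integral_nonneg (fun x => by norm_num)
  refine ⟨C1 * C2 * (c ^ (-(((n : ℝ) + 1) / 2)) * c ^ (-(a + 1 / 2)) * c ^ (-(b + 1 / 2))) + C1 * m, by positivity, ?_⟩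
  intro t θ φ ht hθ hφ hne
  obtain ⟨hs, hcc⟩ := halfang_pos hθ
  obtain ⟨hσ, hχ⟩ := halfang_pos hφ
  obtain ⟨g1, g2, g3⟩ := geom ht hθ hφ
  have hr : 0 < t + |θ - φ| := by have := abs_nonneg (θ - φ); linarith
  have hX : 0 < θ + (t + |θ - φ|) := by linarith [hθ.1]
  have hY : 0 < π - θ + (t + |θ - φ|) := by linarith [hθ.2]
  refine ⟨fun h => ?_, fun h => ?_⟩
  · have hcont : Continuous (fun x => C1 * (cosh (t / 2) - ww θ φ x) ^ (-(a + b + 3 / 2 + (n : ℝ) / 2))) := by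
      refine continuous_const.mul ((continuous_const.sub (wf_cont _ _)).rpow_const (fun x => Or.inl (ww_D ht θ φ x).ne'))
    have := norm_integral_le_of_norm_le (f := fun x => f t θ φ x) (nn_integrable a b hcont) (ae_of_all _ (fun x => (h1 t θ φ x ht).1 h))
    rw [Real.norm_eq_abs, integral_const_mul] at this
    refine this.trans ?_
    have hz := h2 (cosh (t / 2)) (sin (θ / 2) * sin (φ / 2)) (cos (θ / 2) * cos (φ / 2)) (by positivity) (by positivity)
      (by have : 0 < 1 / (16 * π ^ 2) * (t + |θ - φ|) ^ 2 := by positivity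
          linarith)
    have p1 := pow_conv hc hr (q := ((n : ℝ) + 1) / 2) (by positivity) g1
    have p2 := pow_conv hc hX (q := a + 1 / 2) (by positivity) g2
    have p3 := pow_conv hc hY (q := b + 1 / 2) (by positivity) g3
    rw [show a + b + 3 / 2 + (n : ℝ) / 2 - a - b - 1 = ((n : ℝ) + 1) / 2 by ring] at hz
    rw [show 2 * (((n : ℝ) + 1) / 2) = (n : ℝ) + 1 by ring] at p1
    rw [show 2 * (a + 1 / 2) = 2 * a + 1 by ring] at p2
    rw [show 2 * (b + 1 / 2) = 2 * b + 1 by ring] at p3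
    have z1 : 0 < cosh (t / 2) - sin (θ / 2) * sin (φ / 2) - cos (θ / 2) * cos (φ / 2) := lt_of_lt_of_le (by positivity) g1
    have z2 : 0 < cosh (t / 2) - cos (θ / 2) * cos (φ / 2) := lt_of_lt_of_le (by positivity) g2
    have z3 : 0 < cosh (t / 2) - sin (θ / 2) * sin (φ / 2) := lt_of_lt_of_le (by positivity) g3
    set R := (t + |θ - φ|) ^ (-((n : ℝ) + 1))
    set XX := (θ + (t + |θ - φ|)) ^ (-(2 * a + 1))
    set YY := (π - θ + (t + |θ - φ|)) ^ (-(2 * b + 1))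
    have hR : 0 < R := Real.rpow_pos_of_pos hr _
    have hXX : 0 < XX := Real.rpow_pos_of_pos hX _
    have hYY : 0 < YY := Real.rpow_pos_of_pos hY _
    calc _ ≤ C1 * (C2 * ((c ^ (-(((n : ℝ) + 1) / 2)) * R) * (c ^ (-(a + 1 / 2)) * XX) * (c ^ (-(b + 1 / 2)) * YY))) := by
          apply mul_le_mul_of_nonneg_left (hz.trans _) hC1
          apply mul_le_mul_of_nonneg_left _ hC2
          apply mul_le_mul (mul_le_mul p1 p2 (by positivity) (by positivity)) p3 (by positivity) (by positivity)
      _ = C1 * C2 * (c ^ (-(((n : ℝ) + 1) / 2)) * c ^ (-(a + 1 / 2)) * c ^ (-(b + 1 / 2))) * (R * XX * YY) := by ring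
      _ ≤ _ := by
          apply mul_le_mul_of_nonneg_right _ (by positivity)
          have : 0 ≤ C1 * m := by positivity
          linarith
  · have := norm_integral_le_of_norm_le (f := fun x => f t θ φ x) (nn_integrable a b (f := fun _ => C1 * exp (-(t / 2)) * 1) continuous_const)
      (ae_of_all _ (fun x => by rw [mul_one, Real.norm_eq_abs]; exact (h1 t θ φ x ht).2 h))
    rw [Real.norm_eq_abs, integral_const_mul] at this
    refine this.trans ?_
    rw [← hm]
    have e0 := exp_pos (-(t / 2))
    have : 0 ≤ C1 * C2 * (c ^ (-(((n : ℝ) + 1) / 2)) * c ^ (-(a + 1 / 2)) * c ^ (-(b + 1 / 2))) * exp (-(t / 2)) := by positivity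
    nlinarith

lemma PB_Jf {a b : ℝ} (ha : 0 < a) (hb : 0 < b) (k : ℕ) : PB a b k (Jf a b k) :=
  PB_int ha hb (LB_G ha hb k 0)

lemma PB_JT {a b : ℝ} (ha : 0 < a) (hb : 0 < b) (k : ℕ) : PB a b (k + 1) (JT a b k) :=
  PB_int ha hb (LB_half (LB_bdd (LB_G ha hb k 1) (g := fun _ _ _ => a + b + 2) (fun _ _ _ => le_refl _)) wT_le)

lemma PB_JP {a b : ℝ} (ha : 0 < a) (hb : 0 < b) (k : ℕ) : PB a b (k + 1) (JP a b k) :=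
  PB_int ha hb (LB_half (LB_bdd (LB_G ha hb k 1) (g := fun _ _ _ => a + b + 2) (fun _ _ _ => le_refl _)) wP_le)

lemma PB_JTP {a b : ℝ} (ha : 0 < a) (hb : 0 < b) (k : ℕ) : PB a b (k + 2) (JTP a b k) := by
  have h1 := LB_bdd (LB_bdd (LB_G ha hb k 1) (g := fun _ _ _ => a + b + 2) (fun _ _ _ => le_refl _)) wTP_le
  have h2 : LB a b (k + 3) (fun t θ φ x => wP θ φ x * ((a + b + 3) * Gd (a + b + 2) k 1 0 2 t (ww θ φ x))) :=
    LB_half (LB_bdd (LB_G ha hb k 2) (g := fun _ _ _ => a + b + 3) (fun _ _ _ => le_refl _)) wP_le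
  have h3 : LB a b (k + 2) _ := LB_half (LB_bdd h2 (g := fun _ _ _ => a + b + 2) (fun _ _ _ => le_refl _)) wT_le
  have h4 := PB_int ha hb (LB_add h1 h3)
  have e : (fun t θ φ => ∫ x, (wTP θ φ x * ((a + b + 2) * Gd (a + b + 2) k 1 0 1 t (ww θ φ x)) +
      wT θ φ x * ((a + b + 2) * (wP θ φ x * ((a + b + 3) * Gd (a + b + 2) k 1 0 2 t (ww θ φ x))))) ∂(nn a b)) = JTP a b k := by
    funext t θ φ
    unfold JTP
    refine integral_congr_ae (ae_of_all _ (fun x => ?_))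
    simp only
    ring
  rw [← e]; exact h4

end

section

lemma PB_add {α β : ℝ} {n : ℕ} {T S : ℝ → ℝ → ℝ → ℝ} (hT : PB α β n T) (hS : PB α β n S) :
    PB α β n (fun t θ φ => T t θ φ + S t θ φ) := by
  obtain ⟨C, hC, h⟩ := hT
  obtain ⟨D, hD, k⟩ := hS
  refine ⟨C + D, by positivity, fun t θ φ ht hθ hφ hne => ⟨fun h2 => ?_, fun h2 => ?_⟩⟩
  · have a1 := (h t θ φ ht hθ hφ hne).1 h2
    have a2 := (k t θ φ ht hθ hφ hne).1 h2
    rw [add_mul]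
    exact (abs_add_le _ _).trans (add_le_add a1 a2)
  · have a1 := (h t θ φ ht hθ hφ hne).2 h2
    have a2 := (k t θ φ ht hθ hφ hne).2 h2
    rw [add_mul]
    exact (abs_add_le _ _).trans (add_le_add a1 a2)

lemma PB_const_mul {α β : ℝ} {n : ℕ} {T : ℝ → ℝ → ℝ → ℝ} (c : ℝ) (hT : PB α β n T) :
    PB α β n (fun t θ φ => c * T t θ φ) := by
  obtain ⟨C, hC, h⟩ := hT
  refine ⟨|c| * C, by positivity, fun t θ φ ht hθ hφ hne => ⟨fun h2 => ?_, fun h2 => ?_⟩⟩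
  · rw [abs_mul, mul_assoc]
    exact mul_le_mul_of_nonneg_left ((h t θ φ ht hθ hφ hne).1 h2) (abs_nonneg c)
  · rw [abs_mul, mul_assoc]
    exact mul_le_mul_of_nonneg_left ((h t θ φ ht hθ hφ hne).2 h2) (abs_nonneg c)

lemma PB_congr {α β : ℝ} {n : ℕ} {T S : ℝ → ℝ → ℝ → ℝ} (hT : PB α β n T) (h : ∀ t θ φ, S t θ φ = T t θ φ) :
    PB α β n S := by
  have : S = T := by funext t θ φ; exact h t θ φ
  rw [this]; exact hT

lemma PB_sub {α β : ℝ} {n : ℕ} {T S : ℝ → ℝ → ℝ → ℝ} (hT : PB α β n T) (hS : PB α β n S) :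
    PB α β n (fun t θ φ => T t θ φ - S t θ φ) :=
  PB_congr (PB_add hT (PB_const_mul (-1) hS)) (fun t θ φ => by ring)

lemma PB_mono {α β : ℝ} {n m : ℕ} (hnm : n ≤ m) {T : ℝ → ℝ → ℝ → ℝ} (hT : PB α β n T) : PB α β m T := by
  obtain ⟨C, hC, h⟩ := hT
  have hpi := pi_gt_three
  refine ⟨C * (2 + π) ^ (m - n), by positivity, fun t θ φ ht hθ hφ hne => ⟨fun h2 => ?_, fun h2 => ?_⟩⟩
  · refine ((h t θ φ ht hθ hφ hne).1 h2).trans ?_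
    have hd0 : 0 ≤ |θ - φ| := abs_nonneg _
    have hd : |θ - φ| ≤ π := by rw [abs_le]; constructor <;> linarith [hθ.1, hθ.2, hφ.1, hφ.2]
    have hr : 0 < t + |θ - φ| := by linarith
    have hX : 0 < θ + (t + |θ - φ|) := by linarith [hθ.1]
    have hY : 0 < π - θ + (t + |θ - φ|) := by linarith [hθ.2]
    have e : (t + |θ - φ|) ^ (-((n : ℝ) + 1)) = (t + |θ - φ|) ^ (m - n) * (t + |θ - φ|) ^ (-((m : ℝ) + 1)) := by
      rw [← Real.rpow_natCast, ← Real.rpow_add hr]; congr 1; push_cast [hnm]; ring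
    rw [e]
    have q : (t + |θ - φ|) ^ (m - n) ≤ (2 + π) ^ (m - n) := pow_le_pow_left₀ hr.le (by linarith) _
    have p1 := Real.rpow_pos_of_pos hr (-((m : ℝ) + 1))
    have p2 := Real.rpow_pos_of_pos hX (-(2 * α + 1))
    have p3 := Real.rpow_pos_of_pos hY (-(2 * β + 1))
    rw [mul_assoc, mul_assoc, mul_assoc C, ← mul_assoc (_ ^ (-((m : ℝ) + 1)))]
    apply mul_le_mul_of_nonneg_left _ hC
    exact mul_le_mul_of_nonneg_right q (by positivity)
  · refine ((h t θ φ ht hθ hφ hne).2 h2).trans ?_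
    apply mul_le_mul_of_nonneg_right _ (exp_pos _).le
    exact le_mul_of_one_le_right hC (one_le_pow₀ (by linarith))

lemma PB_coef {α β : ℝ} {n : ℕ} {T : ℝ → ℝ → ℝ → ℝ} (hT : PB (α + 1) (β + 1) n T) (e : ℕ) (f : ℝ → ℝ → ℝ) (Cf : ℝ)
    (h1 : ∀ θ φ r, 0 < r → θ ∈ Ioo 0 π → φ ∈ Ioo 0 π → |θ - φ| ≤ r → |f θ φ| * r ^ e ≤ Cf * ((θ + r) * (π - θ + r)) ^ 2)
    (h2 : ∀ θ φ, |f θ φ| ≤ Cf) : PB α β (n + e) (fun t θ φ => f θ φ * T t θ φ) := by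
  obtain ⟨C, hC, h⟩ := hT
  have hCf : 0 ≤ Cf := (abs_nonneg _).trans (h2 0 0)
  refine ⟨Cf * C, by positivity, fun t θ φ ht hθ hφ hne => ⟨fun h3 => ?_, fun h3 => ?_⟩⟩
  · have hd0 : 0 ≤ |θ - φ| := abs_nonneg _
    have hr : 0 < t + |θ - φ| := by linarith
    have a1 := (h t θ φ ht hθ hφ hne).1 h3
    have a2 := h1 θ φ _ hr hθ hφ (by linarith : |θ - φ| ≤ t + |θ - φ|)
    set r := t + |θ - φ|
    have hX : 0 < θ + r := by linarith [hθ.1]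
    have hY : 0 < π - θ + r := by linarith [hθ.2]
    have e1 : r ^ (-((n : ℝ) + 1)) = r ^ e * r ^ (-(((n + e : ℕ) : ℝ) + 1)) := by
      rw [← Real.rpow_natCast, ← Real.rpow_add hr]; congr 1; push_cast; ring
    have e2 : (θ + r) ^ (-(2 * α + 1)) = (θ + r) ^ 2 * (θ + r) ^ (-(2 * (α + 1) + 1)) := by
      rw [← Real.rpow_natCast, ← Real.rpow_add hX]; congr 1; push_cast; ring
    have e3 : (π - θ + r) ^ (-(2 * β + 1)) = (π - θ + r) ^ 2 * (π - θ + r) ^ (-(2 * (β + 1) + 1)) := by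
      rw [← Real.rpow_natCast, ← Real.rpow_add hY]; congr 1; push_cast; ring
    rw [e1] at a1
    rw [e2, e3, abs_mul]
    have p1 := Real.rpow_pos_of_pos hr (-(((n + e : ℕ) : ℝ) + 1))
    have p2 := Real.rpow_pos_of_pos hX (-(2 * (α + 1) + 1))
    have p3 := Real.rpow_pos_of_pos hY (-(2 * (β + 1) + 1))
    set R := r ^ (-(((n + e : ℕ) : ℝ) + 1))
    set XX := (θ + r) ^ (-(2 * (α + 1) + 1))
    set YY := (π - θ + r) ^ (-(2 * (β + 1) + 1))
    calc |f θ φ| * |T t θ φ| ≤ |f θ φ| * (C * (r ^ e * R * XX * YY)) := mul_le_mul_of_nonneg_left a1 (abs_nonneg _)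
      _ = (|f θ φ| * r ^ e) * (C * (R * XX * YY)) := by ring
      _ ≤ (Cf * ((θ + r) * (π - θ + r)) ^ 2) * (C * (R * XX * YY)) := mul_le_mul_of_nonneg_right a2 (by positivity)
      _ = _ := by ring
  · rw [abs_mul, mul_assoc]
    exact mul_le_mul (h2 θ φ) ((h t θ φ ht hθ hφ hne).2 h3) (abs_nonneg _) hCf

lemma XY_le {θ r u : ℝ} (hr : 0 < r) (hθ : θ ∈ Ioo 0 π) (hu : 0 ≤ u) (h1 : u ≤ θ + r) (h2 : u ≤ π - θ + r) :
    u ≤ (θ + r) * (π - θ + r) := by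
  have hpi := pi_gt_three
  rcases le_total 1 θ with h | h
  · nlinarith [hθ.1, hθ.2]
  · nlinarith [hθ.1, hθ.2]

lemma sin_bd {θ φ r : ℝ} (hr : 0 < r) (hθ : θ ∈ Ioo 0 π) (hφ : φ ∈ Ioo 0 π) (hd : |θ - φ| ≤ r) :
    r ≤ (θ + r) * (π - θ + r) ∧ |sin θ| ≤ (θ + r) * (π - θ + r) ∧ |sin φ| ≤ (θ + r) * (π - θ + r) := by
  have s1 := sin_pos_of_mem_Ioo hθ
  have s2 := sin_pos_of_mem_Ioo hφ
  have l1 := sin_le hθ.1.le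
  have l2 := sin_le hφ.1.le
  have l3 := sin_le (x := π - θ) (by linarith [hθ.2])
  have l4 := sin_le (x := π - φ) (by linarith [hφ.2])
  rw [sin_pi_sub] at l3 l4
  rw [abs_le] at hd
  rw [abs_of_pos s1, abs_of_pos s2]
  refine ⟨XY_le hr hθ hr.le (by linarith [hθ.1]) (by linarith [hθ.2]), XY_le hr hθ s1.le (by linarith) (by linarith),
    XY_le hr hθ s2.le (by linarith) (by linarith)⟩

lemma gf_bd (α β θ : ℝ) : |gf α β θ| ≤ 1 + |2 * α + 1| + |2 * β + 1| := by
  unfold gf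
  have h1 := abs_cos_le_one θ
  have h2 : |cos (θ / 2) ^ 2| ≤ 1 := by rw [abs_of_nonneg (sq_nonneg _)]; nlinarith [sin_sq_add_cos_sq (θ / 2), sq_nonneg (sin (θ / 2))]
  have h3 : |sin (θ / 2) ^ 2| ≤ 1 := by rw [abs_of_nonneg (sq_nonneg _)]; nlinarith [sin_sq_add_cos_sq (θ / 2), sq_nonneg (cos (θ / 2))]
  refine (abs_sub _ _).trans (add_le_add ((abs_add_le _ _).trans (add_le_add h1 ?_)) ?_)
  · rw [abs_mul]; exact mul_le_of_le_one_right (abs_nonneg _) h2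
  · rw [abs_mul]; exact mul_le_of_le_one_right (abs_nonneg _) h3

section
variable {α β : ℝ} {n : ℕ} {T : ℝ → ℝ → ℝ → ℝ}

lemma PB_ss (hT : PB (α + 1) (β + 1) n T) : PB α β n (fun t θ φ => sin θ * sin φ * T t θ φ) := by
  refine PB_coef hT 0 (fun θ φ => sin θ * sin φ) 1 (fun θ φ r hr hθ hφ hd => ?_) (fun θ φ => ?_)
  · obtain ⟨h1, h2, h3⟩ := sin_bd hr hθ hφ hd
    rw [abs_mul, pow_zero, mul_one, one_mul, sq]
    exact mul_le_mul h2 h3 (abs_nonneg _) (hr.le.trans h1)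
  · rw [abs_mul]; exact mul_le_one₀ (abs_sin_le_one _) (abs_nonneg _) (abs_sin_le_one _)

lemma PB_s (g : ℝ → ℝ → ℝ) {C : ℝ} (hg : ∀ θ φ, |g θ φ| ≤ C) (hT : PB (α + 1) (β + 1) n T) :
    PB α β (n + 1) (fun t θ φ => sin θ * g θ φ * T t θ φ) := by
  have hC := (abs_nonneg _).trans (hg 0 0)
  refine PB_coef hT 1 (fun θ φ => sin θ * g θ φ) C (fun θ φ r hr hθ hφ hd => ?_) (fun θ φ => ?_)
  · obtain ⟨h1, h2, h3⟩ := sin_bd hr hθ hφ hd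
    have hp := (hr.le.trans h1)
    rw [abs_mul, pow_one]
    calc _ ≤ (((θ + r) * (π - θ + r)) * C) * ((θ + r) * (π - θ + r)) :=
          mul_le_mul (mul_le_mul h2 (hg _ _) (abs_nonneg _) hp) h1 hr.le (by positivity)
      _ = _ := by ring
  · rw [abs_mul]; exact (mul_le_mul (abs_sin_le_one _) (hg _ _) (abs_nonneg _) zero_le_one).trans (one_mul C).le

lemma PB_s' (g : ℝ → ℝ → ℝ) {C : ℝ} (hg : ∀ θ φ, |g θ φ| ≤ C) (hT : PB (α + 1) (β + 1) n T) :
    PB α β (n + 1) (fun t θ φ => sin φ * g θ φ * T t θ φ) := by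
  have hC := (abs_nonneg _).trans (hg 0 0)
  refine PB_coef hT 1 (fun θ φ => sin φ * g θ φ) C (fun θ φ r hr hθ hφ hd => ?_) (fun θ φ => ?_)
  · obtain ⟨h1, h2, h3⟩ := sin_bd hr hθ hφ hd
    have hp := (hr.le.trans h1)
    rw [abs_mul, pow_one]
    calc _ ≤ (((θ + r) * (π - θ + r)) * C) * ((θ + r) * (π - θ + r)) :=
          mul_le_mul (mul_le_mul h3 (hg _ _) (abs_nonneg _) hp) h1 hr.le (by positivity)
      _ = _ := by ring
  · rw [abs_mul]; exact (mul_le_mul (abs_sin_le_one _) (hg _ _) (abs_nonneg _) zero_le_one).trans (one_mul C).le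

lemma PB_g (g : ℝ → ℝ → ℝ) {C : ℝ} (hg : ∀ θ φ, |g θ φ| ≤ C) (hT : PB (α + 1) (β + 1) n T) :
    PB α β (n + 2) (fun t θ φ => g θ φ * T t θ φ) := by
  have hC := (abs_nonneg _).trans (hg 0 0)
  refine PB_coef hT 2 g C (fun θ φ r hr hθ hφ hd => ?_) hg
  obtain ⟨h1, h2, h3⟩ := sin_bd hr hθ hφ hd
  exact mul_le_mul (hg _ _) (pow_le_pow_left₀ hr.le h1 2) (by positivity) hC


lemma PB_Kf (k : ℕ) (hα : -1 < α) (hβ : -1 < β) : PB α β k (Kf α β k) :=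
  PB_const_mul _ (PB_ss (PB_Jf (by linarith) (by linarith) k))

lemma PB_KT (k : ℕ) (hα : -1 < α) (hβ : -1 < β) : PB α β (k + 1) (KT α β k) := by
  have a : 0 < α + 1 := by linarith
  have b : 0 < β + 1 := by linarith
  refine PB_congr (PB_const_mul (c0 (α + 1) (β + 1)) (PB_add (PB_s' (fun θ _ => cos θ) (fun θ _ => abs_cos_le_one θ) (PB_Jf a b k))
    (PB_ss (PB_JT a b k)))) (fun t θ φ => ?_)
  unfold KT; ring

lemma PB_KP (k : ℕ) (hα : -1 < α) (hβ : -1 < β) : PB α β (k + 1) (KP α β k) := by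
  have a : 0 < α + 1 := by linarith
  have b : 0 < β + 1 := by linarith
  refine PB_congr (PB_const_mul (c0 (α + 1) (β + 1)) (PB_add (PB_s (fun _ φ => cos φ) (fun _ φ => abs_cos_le_one φ) (PB_Jf a b k))
    (PB_ss (PB_JP a b k)))) (fun t θ φ => ?_)
  unfold KP; ring

lemma PB_Af (k : ℕ) (hα : -1 < α) (hβ : -1 < β) : PB α β (k + 1) (Af α β k) := by
  have a : 0 < α + 1 := by linarith
  have b : 0 < β + 1 := by linarith
  refine PB_congr (PB_const_mul (-c0 (α + 1) (β + 1)) (PB_add (PB_s' (fun θ _ => gf α β θ) (fun θ _ => gf_bd α β θ) (PB_Jf a b k))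
    (PB_ss (PB_JT a b k)))) (fun t θ φ => ?_)
  unfold Af; ring

lemma PB_AP (k : ℕ) (hα : -1 < α) (hβ : -1 < β) : PB α β (k + 2) (AP α β k) := by
  have a : 0 < α + 1 := by linarith
  have b : 0 < β + 1 := by linarith
  have hg : ∀ θ φ, |cos φ * gf α β θ| ≤ 1 + |2 * α + 1| + |2 * β + 1| := fun θ φ => by
    rw [abs_mul]
    exact (mul_le_of_le_one_left (abs_nonneg _) (abs_cos_le_one φ)).trans (gf_bd α β θ)
  refine PB_congr (PB_const_mul (-c0 (α + 1) (β + 1)) (PB_add (PB_add (PB_s (fun _ φ => cos φ) (fun _ φ => abs_cos_le_one φ) (PB_JT a b k))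
    (PB_g (fun θ φ => cos φ * gf α β θ) hg (PB_Jf a b k)))
    (PB_add (PB_ss (PB_JTP a b k)) (PB_s' (fun θ _ => gf α β θ) (fun θ _ => gf_bd α β θ) (PB_JP a b k))))) (fun t θ φ => ?_)
  unfold AP; ring

lemma PB_AT (k : ℕ) (hα : -1 < α) (hβ : -1 < β) : PB α β (k + 2) (AT α β k) :=
  PB_sub (PB_Kf (k + 2) hα hβ) (PB_const_mul _ (PB_mono (by omega) (PB_Kf k hα hβ)))

lemma PB_Lop (μ : ℝ) {F : ℕ → ℝ → ℝ → ℝ → ℝ} {e : ℕ} (h : ∀ k, PB α β (k + e) (F k)) (l : ℕ) :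
    ∀ k, PB α β (k + 2 * l + e) (fun t θ φ => Lop μ (fun j => F j t θ φ) l k) := by
  induction l with
  | zero => intro k; exact h k
  | succ l ih =>
    intro k
    refine PB_sub (PB_mono (by omega) (ih (k + 2))) (PB_const_mul μ (PB_mono (by omega) (ih k)))

lemma PB_FF (M N : ℕ) (hα : -1 < α) (hβ : -1 < β) :
    PB α β (M + N) (fun t θ φ => Lop (lam0 α β) (fun k => FF α β N k t θ φ) (N / 2) M) := by
  have h : ∀ k, PB α β (k + N % 2) (FF α β N k) := by
    intro k
    unfold FF
    by_cases hN : Even N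
    · simp only [hN, if_true]; rw [Nat.even_iff.1 hN]; exact PB_Kf k hα hβ
    · simp only [hN, if_false]; rw [Nat.not_even_iff.1 hN]; exact PB_Af k hα hβ
  exact PB_mono (by omega) (PB_Lop (lam0 α β) h (N / 2) M)

lemma PB_FT (M N : ℕ) (hα : -1 < α) (hβ : -1 < β) :
    PB α β (M + N + 1) (fun t θ φ => Lop (lam0 α β) (fun k => FT α β N k t θ φ) (N / 2) M) := by
  have h : ∀ k, PB α β (k + (N % 2 + 1)) (FT α β N k) := by
    intro k
    unfold FT
    by_cases hN : Even N
    · simp only [hN, if_true]; rw [Nat.even_iff.1 hN]; exact PB_KT k hα hβ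
    · simp only [hN, if_false]; rw [Nat.not_even_iff.1 hN]; exact PB_AT k hα hβ
  exact PB_mono (by omega) (PB_Lop (lam0 α β) h (N / 2) M)

lemma PB_FP (M N : ℕ) (hα : -1 < α) (hβ : -1 < β) :
    PB α β (M + N + 1) (fun t θ φ => Lop (lam0 α β) (fun k => FP α β N k t θ φ) (N / 2) M) := by
  have h : ∀ k, PB α β (k + (N % 2 + 1)) (FP α β N k) := by
    intro k
    unfold FP
    by_cases hN : Even N
    · simp only [hN, if_true]; rw [Nat.even_iff.1 hN]; exact PB_KP k hα hβ
    · simp only [hN, if_false]; rw [Nat.not_even_iff.1 hN]; exact PB_AP k hα hβ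
  exact PB_mono (by omega) (PB_Lop (lam0 α β) h (N / 2) M)
end
end

section

def Om (α β θ d : ℝ) : ℝ := d * ((θ + d) ^ (2 * α + 1) * (π - θ + d) ^ (2 * β + 1))

lemma pw {q x A m : ℝ} (hq : 0 < q) (hqx : q ≤ x) (hx : x ≤ 1) (hm : m ≤ 0) (hmA : m ≤ A) : x ^ A ≤ q ^ m := by
  have hx0 : 0 < x := hq.trans_le hqx
  calc x ^ A ≤ x ^ m := Real.rpow_le_rpow_of_exponent_ge hx0 hx hmA
    _ ≤ q ^ m := Real.rpow_le_rpow_of_nonpos hq hqx hm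

lemma Om_pos {α β θ d : ℝ} (hθ : θ ∈ Ioo 0 π) (hd : 0 < d) : 0 < Om α β θ d := by
  have hX : 0 < θ + d := by linarith [hθ.1]
  have hY : 0 < π - θ + d := by linarith [hθ.2]
  have := Real.rpow_pos_of_pos hX (2 * α + 1)
  have := Real.rpow_pos_of_pos hY (2 * β + 1)
  unfold Om; positivity

/-- two-factor comparison -/
lemma two_pw {θ d r A B m L : ℝ} (hθ : θ ∈ Ioo 0 π) (hd : 0 < d) (hdr : d ≤ r) (hL : 0 < L) (hrL : π + r ≤ L)
    (hm : m ≤ 0) (hA : m ≤ A) (hB : m ≤ B) :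
    ((θ + d) / (θ + r)) ^ A * ((π - θ + d) / (π - θ + r)) ^ B ≤ (1 / L) ^ m * (d / r) ^ m := by
  have hpi := pi_gt_three
  have h0 := hθ.1
  have h1 := hθ.2
  have hr : 0 < r := hd.trans_le hdr
  have x1 : d / r ≤ (θ + d) / (θ + r) := by
    rw [div_le_div_iff₀ hr (by linarith)]; nlinarith
  have y1 : d / r ≤ (π - θ + d) / (π - θ + r) := by
    rw [div_le_div_iff₀ hr (by linarith)]; nlinarith
  have x2 : (θ + d) / (θ + r) ≤ 1 := by rw [div_le_one (by linarith)]; linarith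
  have y2 : (π - θ + d) / (π - θ + r) ≤ 1 := by rw [div_le_one (by linarith)]; linarith
  have hq : 0 < d / r := by positivity
  have p1 := pw hq x1 x2 hm hA
  have p2 := pw hq y1 y2 hm hB
  have hx0 : 0 < (θ + d) / (θ + r) := hq.trans_le x1
  have hy0 : 0 < (π - θ + d) / (π - θ + r) := hq.trans_le y1
  rcases le_total 1 θ with h | h
  · have z : 1 / L ≤ (θ + d) / (θ + r) := by
      rw [div_le_div_iff₀ hL (by linarith)]; nlinarith
    exact mul_le_mul (pw (by positivity) z x2 hm hA) p2 (Real.rpow_pos_of_pos hy0 _).le (by positivity)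
  · have z : 1 / L ≤ (π - θ + d) / (π - θ + r) := by
      rw [div_le_div_iff₀ hL (by linarith)]; nlinarith
    rw [mul_comm ((1 / L) ^ m)]
    exact mul_le_mul p1 (pw (by positivity) z y2 hm hB) (Real.rpow_pos_of_pos hy0 _).le (by positivity)

lemma PB_fin {α β : ℝ} (hα : -1 < α) (hβ : -1 < β) : ∃ ε : ℝ, 0 < ε ∧ ∀ (n : ℕ) (T : ℝ → ℝ → ℝ → ℝ), PB α β n T →
    ∃ C : ℝ, 0 ≤ C ∧ ∀ t θ φ, 0 < t → θ ∈ Ioo 0 π → φ ∈ Ioo 0 π → θ ≠ φ →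
      |T t θ φ| * Om α β θ |θ - φ| ≤ C * ((t + |θ - φ|) ^ (-(n : ℝ)) * (|θ - φ| / (t + |θ - φ|)) ^ ε) := by
  set m := min (min (2 * α + 1) (2 * β + 1)) 0 with hmd
  have hm0 : m ≤ 0 := min_le_right _ _
  have hmA : m ≤ 2 * α + 1 := (min_le_left _ _).trans (min_le_left _ _)
  have hmB : m ≤ 2 * β + 1 := (min_le_left _ _).trans (min_le_right _ _)
  have hm1 : -1 < m := lt_min (lt_min (by linarith) (by linarith)) (by norm_num)
  refine ⟨1 + m, by linarith, ?_⟩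
  intro n T ⟨C, hC, h⟩
  have hpi := pi_gt_three
  set K1 := (1 / (2 * π + 2)) ^ m with hK1
  have hK1p : 0 < K1 := by positivity
  set K2 := (2 * π + 2) ^ (|2 * α + 1|) * (2 * π + 2) ^ (|2 * β + 1|) with hK2
  have hK2p : 0 < K2 := by positivity
  set K3 := (2:ℝ) ^ (n + 1) * ((n + 1).factorial : ℝ) * exp (π / 2) with hK3
  have hK3p : 0 < K3 := by positivity
  set K4 := (2 + π) ^ (-m) with hK4
  have hK4p : 0 < K4 := by positivity
  refine ⟨C * K1 + C * (K1 * K4 * K2 * K3), by positivity, fun t θ φ ht hθ hφ hne => ?_⟩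
  have h0 := hθ.1
  have h1 := hθ.2
  have hd : 0 < |θ - φ| := abs_pos.2 (sub_ne_zero.2 hne)
  have hdp : |θ - φ| ≤ π := by rw [abs_le]; constructor <;> linarith [hθ.1, hθ.2, hφ.1, hφ.2]
  obtain ⟨hs, hl⟩ := h t θ φ ht hθ hφ hne
  set d := |θ - φ|
  have hXd : 0 < θ + d := by linarith
  have hYd : 0 < π - θ + d := by linarith
  have hr : 0 < t + d := by linarith
  have hX : 0 < θ + (t + d) := by linarith
  have hY : 0 < π - θ + (t + d) := by linarith
  have hRn : 0 < (t + d) ^ (-(n : ℝ)) := Real.rpow_pos_of_pos hr _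
  have hqe : 0 < (d / (t + d)) ^ (1 + m) := by positivity
  rcases le_total t 2 with h2 | h2
  · have a := hs h2
    have b := two_pw hθ hd (by linarith : d ≤ t + d) (L := 2 * π + 2) (by linarith) (by linarith) hm0 hmA hmB
    have e1 : (t + d) ^ (-((n : ℝ) + 1)) = (t + d) ^ (-(n : ℝ)) * (t + d)⁻¹ := by
      rw [← Real.rpow_neg_one, ← Real.rpow_add hr]; congr 1; ring
    have e2 : (d / (t + d)) ^ (1 + m) = d / (t + d) * (d / (t + d)) ^ m := by
      rw [Real.rpow_add (by positivity), Real.rpow_one]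
    rw [Real.div_rpow hXd.le hX.le, Real.div_rpow hYd.le hY.le] at b
    rw [e1, Real.rpow_neg hX.le, Real.rpow_neg hY.le] at a
    have p1 := Real.rpow_pos_of_pos hXd (2 * α + 1)
    have p2 := Real.rpow_pos_of_pos hYd (2 * β + 1)
    have hOm : 0 ≤ Om α β θ d := (Om_pos hθ hd).le
    calc |T t θ φ| * Om α β θ d ≤ _ := mul_le_mul_of_nonneg_right a hOm
      _ = C * ((t + d) ^ (-(n : ℝ)) * (d / (t + d) * ((θ + d) ^ (2 * α + 1) / (θ + (t + d)) ^ (2 * α + 1) *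
          ((π - θ + d) ^ (2 * β + 1) / (π - θ + (t + d)) ^ (2 * β + 1))))) := by unfold Om; simp only [div_eq_mul_inv]; ring
      _ ≤ C * ((t + d) ^ (-(n : ℝ)) * (d / (t + d) * (K1 * (d / (t + d)) ^ m))) := by
          apply mul_le_mul_of_nonneg_left _ hC
          apply mul_le_mul_of_nonneg_left _ hRn.le
          exact mul_le_mul_of_nonneg_left b (by positivity)
      _ = C * K1 * ((t + d) ^ (-(n : ℝ)) * (d / (t + d)) ^ (1 + m)) := by rw [e2]; ring
      _ ≤ _ := by
          apply mul_le_mul_of_nonneg_right _ (by positivity)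
          have : 0 ≤ C * (K1 * K4 * K2 * K3) := by positivity
          linarith
  · have a := hl h2
    have b := two_pw hθ hd (by linarith : d ≤ 2 + d) (L := 2 * π + 2) (by linarith) (by linarith) hm0 hmA hmB
    have hX2 : 0 < θ + (2 + d) := by linarith
    have hY2 : 0 < π - θ + (2 + d) := by linarith
    rw [Real.div_rpow hXd.le hX2.le, Real.div_rpow hYd.le hY2.le, div_mul_div_comm, div_le_iff₀ (by positivity)] at b
    have c1 : (θ + (2 + d)) ^ (2 * α + 1) ≤ (2 * π + 2) ^ (|2 * α + 1|) :=
      (Real.rpow_le_rpow_of_exponent_le (by linarith) (le_abs_self _)).trans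
        (Real.rpow_le_rpow hX2.le (by linarith) (abs_nonneg _))
    have c2 : (π - θ + (2 + d)) ^ (2 * β + 1) ≤ (2 * π + 2) ^ (|2 * β + 1|) :=
      (Real.rpow_le_rpow_of_exponent_le (by linarith) (le_abs_self _)).trans
        (Real.rpow_le_rpow hY2.le (by linarith) (abs_nonneg _))
    have c3 : (d / (2 + d)) ^ m ≤ K4 * d ^ m := by
      rw [Real.div_rpow hd.le (by linarith), div_eq_mul_inv, ← Real.rpow_neg (by linarith), mul_comm]
      apply mul_le_mul_of_nonneg_right _ (by positivity)
      exact Real.rpow_le_rpow (by linarith) (by linarith) (by linarith)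
    have b2 : (θ + d) ^ (2 * α + 1) * (π - θ + d) ^ (2 * β + 1) ≤ K1 * (K4 * d ^ m) * K2 := by
      refine b.trans (mul_le_mul (mul_le_mul_of_nonneg_left c3 hK1p.le) (mul_le_mul c1 c2 (by positivity) (by positivity))
        (by positivity) (by positivity))
    have e2 : d ^ (1 + m) = d * d ^ m := by rw [Real.rpow_add hd, Real.rpow_one]
    have b3 : Om α β θ d ≤ K1 * K4 * K2 * d ^ (1 + m) := by
      unfold Om
      calc _ ≤ d * (K1 * (K4 * d ^ m) * K2) := mul_le_mul_of_nonneg_left b2 hd.le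
        _ = _ := by rw [e2]; ring
    -- exponential factor
    have c4 : exp (-(t / 2)) * (t + d) ^ ((n : ℝ) + (1 + m)) ≤ K3 := by
      have f1 : (t + d) ^ ((n : ℝ) + (1 + m)) ≤ (t + π) ^ (n + 1) := by
        rw [← Real.rpow_natCast]
        refine (Real.rpow_le_rpow_of_exponent_le (by linarith) (by push_cast; linarith : (n : ℝ) + (1 + m) ≤ ((n + 1 : ℕ) : ℝ))).trans ?_
        exact Real.rpow_le_rpow hr.le (by linarith) (by positivity)
      have f2 := Real.pow_div_factorial_le_exp ((t + π) / 2) (by linarith) (n + 1)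
      rw [div_le_iff₀ (by positivity), div_pow, div_le_iff₀ (by positivity)] at f2
      calc _ ≤ exp (-(t / 2)) * (exp ((t + π) / 2) * ((n + 1).factorial : ℝ) * 2 ^ (n + 1)) :=
            mul_le_mul_of_nonneg_left (f1.trans f2) (exp_pos _).le
        _ = (exp (-(t / 2)) * exp ((t + π) / 2)) * (((n + 1).factorial : ℝ) * 2 ^ (n + 1)) := by ring
        _ = K3 := by rw [← exp_add, show -(t / 2) + (t + π) / 2 = π / 2 by ring, hK3]; ring
    have e3 : (t + d) ^ (-(n : ℝ)) * (d / (t + d)) ^ (1 + m) = d ^ (1 + m) * ((t + d) ^ ((n : ℝ) + (1 + m)))⁻¹ := by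
      rw [Real.div_rpow hd.le hr.le, Real.rpow_neg hr.le, Real.rpow_add hr (n : ℝ) (1 + m), mul_inv]; simp only [div_eq_mul_inv]; ring
    have hP : 0 < (t + d) ^ ((n : ℝ) + (1 + m)) := Real.rpow_pos_of_pos hr _
    have c5 : exp (-(t / 2)) ≤ K3 * ((t + d) ^ ((n : ℝ) + (1 + m)))⁻¹ := by
      rw [← div_eq_mul_inv, le_div_iff₀ hP]; exact c4
    rw [e3]
    have hdm : 0 < d ^ (1 + m) := Real.rpow_pos_of_pos hd _
    calc |T t θ φ| * Om α β θ d ≤ (C * (K3 * ((t + d) ^ ((n : ℝ) + (1 + m)))⁻¹)) * (K1 * K4 * K2 * d ^ (1 + m)) :=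
          mul_le_mul (a.trans (mul_le_mul_of_nonneg_left c5 hC)) b3 (Om_pos hθ hd).le (by positivity)
      _ = C * (K1 * K4 * K2 * K3) * (d ^ (1 + m) * ((t + d) ^ ((n : ℝ) + (1 + m)))⁻¹) := by ring
      _ ≤ _ := by
          apply mul_le_mul_of_nonneg_right _ (by positivity)
          have : 0 ≤ C * K1 := by positivity
          linarith
end

section

def gI (A c d η : ℝ) : ℝ≥0∞ := if (c - d < η ∧ η < c + d) ∧ 0 < η then ENNReal.ofReal (η ^ A) else 0

lemma gI_int {A c d : ℝ} (hA : -1 < A) (hc : 0 < c) (hd : 0 < d) :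
    ∫⁻ η, gI A c d η ≤ ENNReal.ofReal ((3 / (A + 1) + 2 * (1 / 3 : ℝ) ^ (-|A|)) * (d * (c + d) ^ A)) := by
  have hA1 : 0 < A + 1 := by linarith
  have hX : 0 < c + d := by linarith
  have hXA : 0 < (c + d) ^ A := Real.rpow_pos_of_pos hX A
  have hK : 0 < (1 / 3 : ℝ) ^ (-|A|) := by positivity
  rcases le_total c (2 * d) with h | h
  · have h1 : ∀ η, gI A c d η ≤ (Ioc 0 (c + d)).indicator (fun η => ENNReal.ofReal (η ^ A)) η := by
      intro η; unfold gI; split_ifs with hh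
      · rw [indicator_of_mem (s := Ioc 0 (c + d)) ⟨hh.2, hh.1.2.le⟩]
      · exact zero_le
    refine (lintegral_mono h1).trans ?_
    rw [lintegral_indicator measurableSet_Ioc, ← ofReal_integral_eq_lintegral_ofReal]
    · apply ENNReal.ofReal_le_ofReal
      rw [← intervalIntegral.integral_of_le hX.le, integral_rpow (Or.inl hA), Real.zero_rpow hA1.ne', sub_zero,
        Real.rpow_add hX, Real.rpow_one]
      have : (c + d) ^ A * (c + d) / (A + 1) ≤ 3 / (A + 1) * (d * (c + d) ^ A) := by
        rw [div_mul_eq_mul_div]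
        apply div_le_div_of_nonneg_right _ hA1.le
        nlinarith
      have : 0 ≤ 2 * (1 / 3 : ℝ) ^ (-|A|) * (d * (c + d) ^ A) := by positivity
      linarith
    · exact (intervalIntegrable_iff_integrableOn_Ioc_of_le hX.le).1 (intervalIntegral.intervalIntegrable_rpow' hA)
    · filter_upwards [ae_restrict_mem measurableSet_Ioc] with η hη
      exact (Real.rpow_pos_of_pos hη.1 _).le
  · have h1 : ∀ η, gI A c d η ≤ (Ioo (c - d) (c + d)).indicator (fun _ => ENNReal.ofReal ((1 / 3 : ℝ) ^ (-|A|) * (c + d) ^ A)) η := by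
      intro η; unfold gI; split_ifs with hh
      · rw [indicator_of_mem (s := Ioo (c - d) (c + d)) hh.1]
        apply ENNReal.ofReal_le_ofReal
        have := pw (q := 1 / 3) (x := η / (c + d)) (A := A) (m := -|A|) (by norm_num)
          (by rw [div_le_div_iff₀ (by norm_num) hX]; linarith [hh.1.1]) (by rw [div_le_one hX]; exact hh.1.2.le)
          (by simp) (neg_abs_le A)
        rw [Real.div_rpow hh.2.le hX.le, div_le_iff₀ hXA] at this
        exact this
      · exact zero_le
    refine (lintegral_mono h1).trans ?_
    rw [lintegral_indicator_const measurableSet_Ioo, Real.volume_Ioo, ← ENNReal.ofReal_mul (by positivity)]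
    apply ENNReal.ofReal_le_ofReal
    have : 0 ≤ 3 / (A + 1) * (d * (c + d) ^ A) := by positivity
    nlinarith

lemma gI_meas (A c d : ℝ) : Measurable (gI A c d) := by
  unfold gI
  refine Measurable.ite ?_ (by fun_prop) measurable_const
  exact ((measurableSet_Ioo (a := c - d) (b := c + d)).inter (measurableSet_Ioi (a := (0:ℝ))))

lemma sinhalf {u A : ℝ} (h0 : 0 < u) (h1 : u < π) : sin (u / 2) ^ A ≤ (1 / π) ^ (-|A|) * u ^ A := by
  have hpi := pi_gt_three
  have s1 : 2 / π * (u / 2) ≤ sin (u / 2) := mul_le_sin (by linarith) (by linarith)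
  have s2 : sin (u / 2) ≤ u / 2 := sin_le (by linarith)
  have s0 : 0 < sin (u / 2) := sin_pos_of_pos_of_lt_pi (by linarith) (by linarith)
  have := pw (q := 1 / π) (x := sin (u / 2) / u) (A := A) (m := -|A|) (by positivity)
    (by rw [le_div_iff₀ h0]; calc _ = 2 / π * (u / 2) := by ring
          _ ≤ _ := s1) (by rw [div_le_one h0]; linarith) (by simp) (neg_abs_le A)
  rwa [Real.div_rpow s0.le h0.le, div_le_iff₀ (Real.rpow_pos_of_pos h0 _)] at this

lemma rcmp {u v L B : ℝ} (hu : 1 ≤ u) (huL : u ≤ L) (hv : 1 ≤ v) (hvL : v ≤ L) :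
    u ^ B ≤ L ^ |B| * L ^ |B| * v ^ B := by
  have hL : 1 ≤ L := hu.trans huL
  have a1 : u ^ B ≤ L ^ |B| :=
    (Real.rpow_le_rpow_of_exponent_le hu (le_abs_self B)).trans (Real.rpow_le_rpow (by linarith) huL (abs_nonneg _))
  have a2 : (L ^ |B|)⁻¹ ≤ v ^ B := by
    rw [← Real.rpow_neg (by linarith)]
    exact (Real.rpow_le_rpow_of_nonpos (by linarith) hvL (by simp)).trans
      (Real.rpow_le_rpow_of_exponent_le hv (neg_abs_le B))
  have hp : 0 < L ^ |B| := Real.rpow_pos_of_pos (by linarith) _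
  have a3 : 1 ≤ L ^ |B| * v ^ B := by
    calc 1 = L ^ |B| * (L ^ |B|)⁻¹ := (mul_inv_cancel₀ hp.ne').symm
      _ ≤ _ := mul_le_mul_of_nonneg_left a2 hp.le
  rw [mul_assoc]
  exact a1.trans (le_mul_of_one_le_right hp.le a3)

lemma Ww_bd (a b : ℝ) : ∃ C : ℝ, 0 ≤ C ∧ ∀ θ d η, 0 < d → d ≤ π → θ ∈ Ioo 0 π → η ∈ Ioo 0 π → θ - d < η → η < θ + d →
    Ww a b η ≤ C * ((π - θ + d) ^ (2 * b + 1) * η ^ (2 * a + 1) + (θ + d) ^ (2 * a + 1) * (π - η) ^ (2 * b + 1)) := by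
  have hpi := pi_gt_three
  set A := 2 * a + 1
  set B := 2 * b + 1
  set KA := (1 / π) ^ (-|A|)
  set KB := (1 / π) ^ (-|B|)
  set LA := (2 * π) ^ |A|
  set LB := (2 * π) ^ |B|
  have hKA : 0 < KA := by positivity
  have hKB : 0 < KB := by positivity
  have hLA : 0 < LA := by positivity
  have hLB : 0 < LB := by positivity
  refine ⟨KA * KB * (LA * LA + LB * LB), by positivity, fun θ d η hd hdp hθ hη h1 h2 => ?_⟩
  have hw : Ww a b η = sin (η / 2) ^ A * cos (η / 2) ^ B := rfl
  have ec : cos (η / 2) = sin ((π - η) / 2) := by rw [← sin_pi_div_two_sub]; congr 1; ring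
  have s1 := sinhalf (A := A) hη.1 hη.2
  have s2 := sinhalf (A := B) (u := π - η) (by linarith [hη.2]) (by linarith [hη.1])
  have hs : 0 < sin ((π - η) / 2) := sin_pos_of_pos_of_lt_pi (by linarith [hη.2]) (by linarith [hη.1])
  have p1 := Real.rpow_pos_of_pos hη.1 A
  have p2 := Real.rpow_pos_of_pos (by linarith [hη.2] : 0 < π - η) B
  have p3 := Real.rpow_pos_of_pos (by linarith [hθ.2] : 0 < π - θ + d) B
  have p4 := Real.rpow_pos_of_pos (by linarith [hθ.1] : 0 < θ + d) A
  have base : Ww a b η ≤ KA * KB * (η ^ A * (π - η) ^ B) := by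
    rw [hw, ec]
    calc _ ≤ (KA * η ^ A) * (KB * (π - η) ^ B) := mul_le_mul s1 s2 (Real.rpow_pos_of_pos hs _).le (by positivity)
      _ = _ := by ring
  refine base.trans ?_
  rw [mul_assoc (KA * KB)]
  apply mul_le_mul_of_nonneg_left _ (by positivity)
  rcases le_total η (π / 2) with h | h
  · have := rcmp (B := B) (L := 2 * π) (u := π - η) (v := π - θ + d) (by linarith) (by linarith [hη.1]) (by linarith) (by linarith [hθ.1])
    calc η ^ A * (π - η) ^ B ≤ η ^ A * (LB * LB * (π - θ + d) ^ B) := mul_le_mul_of_nonneg_left this p1.le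
      _ = LB * LB * ((π - θ + d) ^ B * η ^ A) := by ring
      _ ≤ _ := mul_le_mul (by nlinarith) (by have := mul_pos p4 p2; linarith) (by positivity) (by positivity)
  · have := rcmp (B := A) (L := 2 * π) (u := η) (v := θ + d) (by linarith) (by linarith [hη.2]) (by linarith) (by linarith [hθ.2])
    calc η ^ A * (π - η) ^ B ≤ (LA * LA * (θ + d) ^ A) * (π - η) ^ B := mul_le_mul_of_nonneg_right this p2.le
      _ = LA * LA * ((θ + d) ^ A * (π - η) ^ B) := by ring
      _ ≤ _ := mul_le_mul (by nlinarith) (by have := mul_pos p3 p1; linarith) (by positivity) (by positivity)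

lemma ball_bd {α β : ℝ} (hα : -1 < α) (hβ : -1 < β) : ∃ C : ℝ, 0 < C ∧ ∀ θ d, 0 < d → d ≤ π → θ ∈ Ioo 0 π →
    0 < (ballMeasure α β θ d).toReal ∧ (ballMeasure α β θ d).toReal ≤ C * Om α β θ d := by
  obtain ⟨C, hC, h⟩ := Ww_bd α β
  have hpi := pi_gt_three
  set KA := 3 / (2 * α + 1 + 1) + 2 * (1 / 3 : ℝ) ^ (-|2 * α + 1|) with hKA
  set KB := 3 / (2 * β + 1 + 1) + 2 * (1 / 3 : ℝ) ^ (-|2 * β + 1|) with hKB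
  have hKAp : 0 < KA := by
    have : 0 < 2 * α + 1 + 1 := by linarith
    positivity
  have hKBp : 0 < KB := by
    have : 0 < 2 * β + 1 + 1 := by linarith
    positivity
  refine ⟨C * (KA + KB) + 1, by positivity, fun θ d hd hdp hθ => ?_⟩
  have hXd : 0 < θ + d := by linarith [hθ.1]
  have hYd : 0 < π - θ + d := by linarith [hθ.2]
  have p3 := Real.rpow_pos_of_pos hYd (2 * β + 1)
  have p4 := Real.rpow_pos_of_pos hXd (2 * α + 1)
  have hOm := Om_pos (α := α) (β := β) hθ hd
  have hmeas : Measurable (fun θ => ENNReal.ofReal (jPsi α β θ ^ 2)) := by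
    have := jPsi_meas α β
    fun_prop
  have up : ballMeasure α β θ d ≤ ENNReal.ofReal (C * (KA + KB) * Om α β θ d) := by
    unfold ballMeasure
    rw [jplus_eq, withDensity_apply _ measurableSet_Ioo, Measure.restrict_restrict measurableSet_Ioo,
      ← lintegral_indicator (measurableSet_Ioo.inter measurableSet_Ioo)]
    have hp : ∀ η, (Ioo (θ - d) (θ + d) ∩ Ioo 0 π).indicator (fun θ => ENNReal.ofReal (jPsi α β θ ^ 2)) η ≤
        ENNReal.ofReal C * (ENNReal.ofReal ((π - θ + d) ^ (2 * β + 1)) * gI (2 * α + 1) θ d η +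
          ENNReal.ofReal ((θ + d) ^ (2 * α + 1)) * gI (2 * β + 1) (π - θ) d (π - η)) := by
      intro η
      by_cases hη : η ∈ Ioo (θ - d) (θ + d) ∩ Ioo 0 π
      · rw [indicator_of_mem hη, jPsi_sq α β hη.2]
        have := h θ d η hd hdp hθ hη.2 hη.1.1 hη.1.2
        refine (ENNReal.ofReal_le_ofReal this).trans (le_of_eq ?_)
        have q1 := Real.rpow_pos_of_pos hη.2.1 (2 * α + 1)
        have q2 := Real.rpow_pos_of_pos (by linarith [hη.2.2] : 0 < π - η) (2 * β + 1)
        unfold gI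
        rw [if_pos ⟨hη.1, hη.2.1⟩, if_pos ⟨⟨by linarith [hη.1.2], by linarith [hη.1.1]⟩, by linarith [hη.2.2]⟩,
          ENNReal.ofReal_mul hC, ENNReal.ofReal_add (by positivity) (by positivity), ENNReal.ofReal_mul p3.le, ENNReal.ofReal_mul p4.le]
      · rw [indicator_of_notMem hη]; exact zero_le
    refine (lintegral_mono hp).trans ?_
    have m1 := gI_meas (2 * α + 1) θ d
    have m2 : Measurable (fun η => gI (2 * β + 1) (π - θ) d (π - η)) := (gI_meas (2 * β + 1) (π - θ) d).comp (by fun_prop)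
    rw [lintegral_const_mul _ ((m1.const_mul _).fun_add (m2.const_mul _)), lintegral_add_left (m1.const_mul _),
      lintegral_const_mul _ m1, lintegral_const_mul _ m2, lintegral_sub_left_eq_self (fun x => gI (2 * β + 1) (π - θ) d x) π]
    have i1 := gI_int (A := 2 * α + 1) (c := θ) (d := d) (by linarith) hθ.1 hd
    have i2 := gI_int (A := 2 * β + 1) (c := π - θ) (d := d) (by linarith) (by linarith [hθ.2]) hd
    calc _ ≤ ENNReal.ofReal C * (ENNReal.ofReal ((π - θ + d) ^ (2 * β + 1)) * ENNReal.ofReal (KA * (d * (θ + d) ^ (2 * α + 1))) +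
          ENNReal.ofReal ((θ + d) ^ (2 * α + 1)) * ENNReal.ofReal (KB * (d * (π - θ + d) ^ (2 * β + 1)))) := by gcongr
      _ = _ := by
        rw [← ENNReal.ofReal_mul p3.le, ← ENNReal.ofReal_mul p4.le, ← ENNReal.ofReal_add (by positivity) (by positivity),
          ← ENNReal.ofReal_mul hC]
        congr 1; unfold Om; ring
  have hfin : ballMeasure α β θ d ≠ ⊤ := (up.trans_lt ENNReal.ofReal_lt_top).ne
  refine ⟨ENNReal.toReal_pos ?_ hfin, ?_⟩
  · unfold ballMeasure
    rw [jplus_eq]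
    intro h0
    rw [withDensity_apply_eq_zero hmeas] at h0
    have hms : MeasurableSet {x | ENNReal.ofReal (jPsi α β x ^ 2) ≠ 0} := hmeas (measurableSet_singleton 0).compl
    rw [Measure.restrict_apply (hms.inter measurableSet_Ioo)] at h0
    have hsub : Ioo θ (min (θ + d) π) ⊆ {x | ENNReal.ofReal (jPsi α β x ^ 2) ≠ 0} ∩ Ioo (θ - d) (θ + d) ∩ Ioo 0 π := by
      intro η hη
      have g2 : η < θ + d := hη.2.trans_le (min_le_left _ _)
      have g3 : η < π := hη.2.trans_le (min_le_right _ _)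
      have hη' : η ∈ Ioo 0 π := ⟨hθ.1.trans hη.1, g3⟩
      refine ⟨⟨?_, by linarith [hη.1], g2⟩, hη'⟩
      simp only [mem_setOf_eq, ne_eq, ENNReal.ofReal_eq_zero, not_le]
      rw [jPsi_sq α β hη']
      obtain ⟨u1, u2⟩ := halfang_pos hη'
      exact mul_pos (Real.rpow_pos_of_pos u1 _) (Real.rpow_pos_of_pos u2 _)
    have := measure_mono_null hsub h0
    rw [Real.volume_Ioo, ENNReal.ofReal_eq_zero] at this
    have : θ < min (θ + d) π := lt_min (by linarith) hθ.2
    linarith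
  · have := ENNReal.toReal_mono ENNReal.ofReal_ne_top up
    rw [ENNReal.toReal_ofReal (by positivity)] at this
    linarith

lemma sqint {ε C Ω d : ℝ} (hε : 0 < ε) (hC : 0 ≤ C) (hΩ : 0 < Ω) (hd : 0 < d) {m j e : ℕ} (he : e + 1 = 2 * m) {T : ℝ → ℝ}
    (h : ∀ t, 0 < t → |T t| * Ω ≤ C * ((t + d) ^ (-((m + j : ℕ) : ℝ)) * (d / (t + d)) ^ ε)) :
    (∫⁻ t in Ioi (0:ℝ), ENNReal.ofReal (T t ^ 2 * t ^ e)) ^ (1 / 2 : ℝ) ≤ ENNReal.ofReal (C / √(2 * ε) / (d ^ j * Ω)) := by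
  have key : ∀ t ∈ Ioi (0:ℝ), ENNReal.ofReal (T t ^ 2 * t ^ e) ≤
      ENNReal.ofReal ((C / (d ^ j * Ω)) ^ 2 * d ^ (2 * ε) * (t + d) ^ (-1 - 2 * ε)) := by
    intro t ht
    have ht : 0 < t := ht
    apply ENNReal.ofReal_le_ofReal
    have hr : 0 < t + d := by linarith
    have a := h t ht
    rw [← le_div_iff₀ hΩ] at a
    have a2 : T t ^ 2 ≤ (C * ((t + d) ^ (-((m + j : ℕ) : ℝ)) * (d / (t + d)) ^ ε) / Ω) ^ 2 := by
      rw [← sq_abs]; exact pow_le_pow_left₀ (abs_nonneg _) a 2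
    have a3 : t ^ e ≤ (t + d) ^ e := pow_le_pow_left₀ ht.le (by linarith) _
    have a4 : ((t + d) ^ j)⁻¹ ≤ (d ^ j)⁻¹ := inv_anti₀ (by positivity) (pow_le_pow_left₀ hd.le (by linarith) _)
    have e1 : (t + d) ^ (-1 - 2 * ε) = (t + d) ^ (-(1:ℝ)) * ((t + d) ^ ε)⁻¹ ^ 2 := by
      rw [← Real.rpow_neg hr.le, ← Real.rpow_natCast, ← Real.rpow_mul hr.le, ← Real.rpow_add hr]; congr 1; push_cast; ring
    have e2 : d ^ (2 * ε) = (d ^ ε) ^ 2 := by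
      rw [← Real.rpow_natCast, ← Real.rpow_mul hd.le]; congr 1; push_cast; ring
    have e3 : ((t + d) ^ (-((m + j : ℕ) : ℝ))) ^ 2 * (t + d) ^ e = ((t + d) ^ j)⁻¹ ^ 2 * (t + d) ^ (-(1:ℝ)) := by
      rw [Real.rpow_neg hr.le, Real.rpow_natCast, Real.rpow_neg_one]
      have : (t + d) ^ e * (t + d) = (t + d) ^ (2 * m) := by rw [← pow_succ, he]
      field_simp
      rw [mul_comm (t + d) ((t + d) ^ e), this, ← pow_mul, ← pow_mul, ← pow_add]; congr 1; ring
    have q1 : 0 < (t + d) ^ (-(1:ℝ)) := Real.rpow_pos_of_pos hr _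
    have q2 : 0 < (t + d) ^ ε := Real.rpow_pos_of_pos hr _
    have q3 : 0 < d ^ ε := Real.rpow_pos_of_pos hd _
    calc T t ^ 2 * t ^ e ≤ (C * ((t + d) ^ (-((m + j : ℕ) : ℝ)) * (d / (t + d)) ^ ε) / Ω) ^ 2 * (t + d) ^ e :=
          mul_le_mul a2 a3 (by positivity) (by positivity)
      _ = (((t + d) ^ (-((m + j : ℕ) : ℝ))) ^ 2 * (t + d) ^ e) * ((C / Ω) ^ 2 * ((d / (t + d)) ^ ε) ^ 2) := by ring
      _ = ((t + d) ^ j)⁻¹ ^ 2 * ((t + d) ^ (-(1:ℝ)) * ((C / Ω) ^ 2 * ((d / (t + d)) ^ ε) ^ 2)) := by rw [e3]; ring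
      _ ≤ (d ^ j)⁻¹ ^ 2 * ((t + d) ^ (-(1:ℝ)) * ((C / Ω) ^ 2 * ((d / (t + d)) ^ ε) ^ 2)) := by
          apply mul_le_mul_of_nonneg_right _ (by positivity)
          exact pow_le_pow_left₀ (by positivity) a4 2
      _ = _ := by
          rw [Real.div_rpow hd.le hr.le, e1, e2]; simp only [div_eq_mul_inv, mul_inv]; ring
  have hintg : IntegrableOn (fun t : ℝ => (t + d) ^ (-1 - 2 * ε)) (Ioi 0) :=
    integrableOn_add_rpow_Ioi_of_lt (by linarith) (by linarith)
  have hval : ∫ t in Ioi (0:ℝ), (t + d) ^ (-1 - 2 * ε) = (d ^ (2 * ε))⁻¹ / (2 * ε) := by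
    have hsh : ∫ t in Ioi (0:ℝ), (t + d) ^ (-1 - 2 * ε) = ∫ t in Ioi d, t ^ (-1 - 2 * ε) := by
      rw [← integral_indicator measurableSet_Ioi, ← integral_indicator measurableSet_Ioi,
        ← integral_add_right_eq_self ((Ioi d).indicator fun t => t ^ (-1 - 2 * ε)) d]
      congr 1
      funext t
      by_cases ht : 0 < t
      · rw [indicator_of_mem (s := Ioi (0:ℝ)) ht, indicator_of_mem (s := Ioi d) (by simpa using ht)]
      · rw [indicator_of_notMem (s := Ioi (0:ℝ)) ht, indicator_of_notMem (s := Ioi d) (by simpa using ht)]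
    rw [hsh, integral_Ioi_rpow_of_lt (by linarith) hd,
      show -1 - 2 * ε + 1 = -(2 * ε) by ring, Real.rpow_neg hd.le]
    field_simp
  have h1 : ∫⁻ t in Ioi (0:ℝ), ENNReal.ofReal (T t ^ 2 * t ^ e) ≤ ENNReal.ofReal ((C / √(2 * ε) / (d ^ j * Ω)) ^ 2) := by
    refine (setLIntegral_mono' measurableSet_Ioi key).trans ?_
    rw [← ofReal_integral_eq_lintegral_ofReal (hintg.const_mul _)]
    · apply ENNReal.ofReal_le_ofReal
      rw [integral_const_mul, hval]
      have q : 0 < d ^ (2 * ε) := Real.rpow_pos_of_pos hd _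
      have hs : √(2 * ε) ^ 2 = 2 * ε := Real.sq_sqrt (by positivity)
      apply le_of_eq
      rw [div_right_comm, div_pow _ (√(2 * ε)), hs]
      field_simp
    · filter_upwards [ae_restrict_mem measurableSet_Ioi] with t ht
      have ht : 0 < t := ht
      have : 0 < t + d := by linarith
      simp only [Pi.zero_apply]; positivity
  refine (ENNReal.rpow_le_rpow h1 (by norm_num)).trans ?_
  rw [ENNReal.ofReal_rpow_of_nonneg (by positivity) (by norm_num), ← Real.sqrt_eq_rpow, Real.sqrt_sq (by positivity)]
end

/-- Theorem (standard estimates for the vector-valued square function kernel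
`{∂_t^M δ_N^odd H̃_t^{α,β}(θ,φ)}_{t>0}` in `L²(ℝ₊, t^{2M+2N−1}dt)`). -/
theorem squareKernelOdd_standard_estimates (α β : ℝ) (hα : -1 < α) (hβ : -1 < β)
    (M N : ℕ) (hMN : 0 < M + N) :
    ∃ C : ℝ, 0 < C ∧ ∀ θ ∈ Ioo (0 : ℝ) π, ∀ φ ∈ Ioo (0 : ℝ) π, θ ≠ φ →
      (∫⁻ t in Ioi (0 : ℝ), ENNReal.ofReal
          ((deriv^[M] (fun s => deltaOdd α β N (fun θ' => jHtil α β s θ' φ) θ) t) ^ 2 *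
            t ^ (2 * M + 2 * N - 1))) ^ (1 / 2 : ℝ) ≤
        ENNReal.ofReal (C / (ballMeasure α β θ |θ - φ|).toReal) ∧
      (∫⁻ t in Ioi (0 : ℝ), ENNReal.ofReal
            ((deriv (fun θ'' =>
                deriv^[M] (fun s => deltaOdd α β N (fun θ' => jHtil α β s θ' φ) θ'') t) θ) ^ 2 *
              t ^ (2 * M + 2 * N - 1))) ^ (1 / 2 : ℝ) +
        (∫⁻ t in Ioi (0 : ℝ), ENNReal.ofReal
            ((deriv (fun φ' =>
                deriv^[M] (fun s => deltaOdd α β N (fun θ' => jHtil α β s θ' φ') θ) t) φ) ^ 2 *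
              t ^ (2 * M + 2 * N - 1))) ^ (1 / 2 : ℝ) ≤
        ENNReal.ofReal (C / (|θ - φ| * (ballMeasure α β θ |θ - φ|).toReal)) := by
  obtain ⟨ε, hε, hfin⟩ := PB_fin hα hβ
  obtain ⟨C1, hC1, h1⟩ := hfin _ _ (PB_FF M N hα hβ)
  obtain ⟨C2, hC2, h2⟩ := hfin _ _ (PB_FT M N hα hβ)
  obtain ⟨C3, hC3, h3⟩ := hfin _ _ (PB_FP M N hα hβ)
  obtain ⟨CB, hCB, hB⟩ := ball_bd hα hβ
  have hse : 0 < √(2 * ε) := Real.sqrt_pos.2 (by positivity)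
  refine ⟨(C1 + C2 + C3 + 1) / √(2 * ε) * CB, by positivity, ?_⟩
  intro θ hθ φ hφ hne
  have hd : 0 < |θ - φ| := abs_pos.2 (sub_ne_zero.2 hne)
  have hdp : |θ - φ| ≤ π := by rw [abs_le]; constructor <;> linarith [hθ.1, hθ.2, hφ.1, hφ.2]
  obtain ⟨b1, b2⟩ := hB θ |θ - φ| hd hdp hθ
  have hOm := Om_pos (α := α) (β := β) hθ hd
  have he : (2 * M + 2 * N - 1) + 1 = 2 * (M + N) := by omega
  have i1 := sqint hε hC1 hOm hd (j := 0) he (fun t ht => h1 t θ φ ht hθ hφ hne)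
  have i2 := sqint hε hC2 hOm hd (j := 1) he (fun t ht => h2 t θ φ ht hθ hφ hne)
  have i3 := sqint hε hC3 hOm hd (j := 1) he (fun t ht => h3 t θ φ ht hθ hφ hne)
  have r1 : ∀ t ∈ Ioi (0:ℝ), ENNReal.ofReal
          ((deriv^[M] (fun s => deltaOdd α β N (fun θ' => jHtil α β s θ' φ) θ) t) ^ 2 *
            t ^ (2 * M + 2 * N - 1)) = ENNReal.ofReal ((Lop (lam0 α β) (fun k => FF α β N k t θ φ) (N / 2) M) ^ 2 *
            t ^ (2 * M + 2 * N - 1)) := fun t ht => by rw [dtM hα hβ φ N M hθ t ht]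
  have r2 : ∀ t ∈ Ioi (0:ℝ), ENNReal.ofReal
          ((deriv (fun θ'' => deriv^[M] (fun s => deltaOdd α β N (fun θ' => jHtil α β s θ' φ) θ'') t) θ) ^ 2 *
            t ^ (2 * M + 2 * N - 1)) = ENNReal.ofReal ((Lop (lam0 α β) (fun k => FT α β N k t θ φ) (N / 2) M) ^ 2 *
            t ^ (2 * M + 2 * N - 1)) := fun t ht => by rw [dTM hα hβ φ N M hθ ht]
  have r3 : ∀ t ∈ Ioi (0:ℝ), ENNReal.ofReal
          ((deriv (fun φ' => deriv^[M] (fun s => deltaOdd α β N (fun θ' => jHtil α β s θ' φ') θ) t) φ) ^ 2 *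
            t ^ (2 * M + 2 * N - 1)) = ENNReal.ofReal ((Lop (lam0 α β) (fun k => FP α β N k t θ φ) (N / 2) M) ^ 2 *
            t ^ (2 * M + 2 * N - 1)) := fun t ht => by rw [dPM hα hβ φ N M hθ ht]
  rw [setLIntegral_congr_fun measurableSet_Ioi r1, setLIntegral_congr_fun measurableSet_Ioi r2,
    setLIntegral_congr_fun measurableSet_Ioi r3]
  set Ω := Om α β θ |θ - φ|
  set μB := (ballMeasure α β θ |θ - φ|).toReal
  set d := |θ - φ|
  have inv : 1 / Ω ≤ CB / μB := by
    rw [div_le_div_iff₀ hOm b1]; linarith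
  constructor
  · refine i1.trans (ENNReal.ofReal_le_ofReal ?_)
    calc C1 / √(2 * ε) / (d ^ 0 * Ω) = C1 / √(2 * ε) * (1 / Ω) := by rw [pow_zero, one_mul]; ring
      _ ≤ (C1 + C2 + C3 + 1) / √(2 * ε) * (CB / μB) := by
        apply mul_le_mul _ inv (by positivity) (by positivity)
        apply div_le_div_of_nonneg_right _ hse.le
        linarith
      _ = _ := by ring
  · refine (add_le_add i2 i3).trans ?_
    rw [← ENNReal.ofReal_add (by positivity) (by positivity)]
    apply ENNReal.ofReal_le_ofReal
    calc C2 / √(2 * ε) / (d ^ 1 * Ω) + C3 / √(2 * ε) / (d ^ 1 * Ω) = ((C2 + C3) / √(2 * ε) / d) * (1 / Ω) := by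
          rw [pow_one]; field_simp
      _ ≤ ((C1 + C2 + C3 + 1) / √(2 * ε) / d) * (CB / μB) := by
        apply mul_le_mul _ inv (by positivity) (by positivity)
        apply div_le_div_of_nonneg_right _ hd.le
        apply div_le_div_of_nonneg_right _ hse.le
        linarith
      _ = _ := by field_simp
end
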